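/- arXiv:1902.00158 — 2 statements merged into one kernel-verified Lean document; each statement's English description precedes it below -/
import Mathlib

section
/- Let u be a variational solution of the one-phase free boundary problem in all of ℝ² which is Lipschitz continuous and non-degenerate, and assume 0 ∈ F(u). Let R_j → ∞ and suppose the rescalings w_j(x) = R_j^{-1} u(R_j x) converge uniformly on compact subsets of ℝ² to a function w. Then there is a rotation ρ of ℝ² such that either w∘ρ = P or w∘ρ = W_s for some s > 0. If in addition u is a viscosity solution, then w is a viscosity solution and, up to rotation, either w = P or w = W_s for some 0 < s ≤ 1. -/
open Complex Metric Set Filter MeasureTheory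
open scoped Topology Classical NNReal

noncomputable section

/-- The positive phase of `u` in `Ω`. -/
def posSet (Ω : Set ℂ) (u : ℂ → ℝ) : Set ℂ := {z ∈ Ω | 0 < u z}

/-- The free boundary of `u` in `Ω`. -/
def FB (Ω : Set ℂ) (u : ℂ → ℝ) : Set ℂ := Ω ∩ frontier (posSet Ω u)

/-- The gradient of `u : ℂ → ℝ`, viewed as a complex number `∂ₓu + i ∂ᵧu`. -/
def grad2 (u : ℂ → ℝ) (z : ℂ) : ℂ :=
  ((fderiv ℝ u z 1 : ℝ) : ℂ) + ((fderiv ℝ u z Complex.I : ℝ) : ℂ) * Complex.I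

/-- Second derivative (Hessian) of `u : ℂ → ℝ` at `z` in directions `v, w`. -/
def hess (u : ℂ → ℝ) (z v w : ℂ) : ℝ := fderiv ℝ (fun x => fderiv ℝ u x v) z w

/-- `u` is harmonic on `s`: twice continuously differentiable with vanishing Laplacian. -/
def HarmonicOn2 (u : ℂ → ℝ) (s : Set ℂ) : Prop :=
  ContDiffOn ℝ 2 u s ∧ ∀ z ∈ s, hess u z 1 1 + hess u z Complex.I Complex.I = 0

/-- A classical solution of the one-phase free boundary problem `Δu = 0` in `{u>0}`,
`|∇u| = 1` on the free boundary, in the open set `Ω ⊆ ℝ² ≅ ℂ`. -/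
structure IsClassicalSolution (Ω : Set ℂ) (u : ℂ → ℝ) : Prop where
  contOn : ContinuousOn u Ω
  nonneg : ∀ z ∈ Ω, 0 ≤ u z
  harm : HarmonicOn2 u (posSet Ω u)
  smooth_ext : ∃ v : ℂ → ℝ, ContDiffOn ℝ (⊤ : ℕ∞) v (Ω ∩ closure (posSet Ω u)) ∧
    Set.EqOn u v (Ω ∩ closure (posSet Ω u))
  fb_manifold : ∀ z ∈ FB Ω u, ∃ V : Set ℂ, IsOpen V ∧ z ∈ V ∧ V ⊆ Ω ∧
    ∃ φ : ℂ → ℝ, ContDiffOn ℝ (⊤ : ℕ∞) φ V ∧ (∀ w ∈ V, fderiv ℝ φ w ≠ 0) ∧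
      V ∩ posSet Ω u = {w ∈ V | 0 < φ w} ∧
      V ∩ {w | u w = 0} = {w ∈ V | φ w ≤ 0} ∧
      V ∩ FB Ω u = {w ∈ V | φ w = 0}
  grad_one : ∀ z ∈ FB Ω u,
    Filter.Tendsto (fun w => ‖grad2 u w‖) (nhdsWithin z (posSet Ω u)) (nhds 1)

/-- One-plane solution `P(z) = max (Re z) 0`. -/
def Pfun (z : ℂ) : ℝ := max z.re 0

/-- Wedge solution `W_s(z) = s |Re z|`. -/
def Wfun (s : ℝ) (z : ℂ) : ℝ := s * |z.re|

/-- Two-plane solution `TP_a`. -/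
def TPfun (a : ℝ) (z : ℂ) : ℝ := max z.re 0 + max (-z.re - a) 0

/-- Rotation of the plane by angle `θ`. -/
def rot (θ : ℝ) (z : ℂ) : ℂ := Complex.exp (θ * Complex.I) * z

/-- The strip `S = {|Im ζ| < π/2}`. -/
def Sstrip : Set ℂ := {ζ : ℂ | |ζ.im| < Real.pi / 2}

/-- The hairpin domain `Ω₁ = {|x₂| < π/2 + cosh x₁}`. -/
def Omega1 : Set ℂ := {z : ℂ | |z.im| < Real.pi / 2 + Real.cosh z.re}

/-- Dilated hairpin domain `Ω_a = aΩ₁`. -/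
def OmegaA (a : ℝ) : Set ℂ := {z : ℂ | z / (a : ℂ) ∈ Omega1}

/-- The Hauswirth–Hélein–Pacard double hairpin solution `H = H₁`:
`H(z) = Re (cosh w)` where `w` is the unique point of the strip `S` with `w + sinh w = z`,
and `H(z) = 0` if there is no such point. -/
def hairpinH (z : ℂ) : ℝ :=
  if h : ∃ w : ℂ, w ∈ Sstrip ∧ w + Complex.sinh w = z then (Complex.cosh h.choose).re else 0

/-- The double hairpin solution `H_a(z) = a H(z/a)`. -/
def hairpin (a : ℝ) (z : ℂ) : ℝ := a * hairpinH (z / (a : ℂ))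

/-- Euclidean dot product of two complex numbers viewed as vectors in ℝ². -/
def dot2 (a b : ℂ) : ℝ := a.re * b.re + a.im * b.im

/-- Divergence of a vector field `ψ : ℂ → ℂ` on ℝ². -/
def div2 (ψ : ℂ → ℂ) (z : ℂ) : ℝ := (fderiv ℝ ψ z 1).re + (fderiv ℝ ψ z Complex.I).im

/-- A variational (weak) solution of the one-phase free boundary problem in `Ω`:
`u ∈ H¹_loc(Ω) ∩ C(Ω)`, `u ≥ 0`, `u ∈ C²({u>0})`, and the domain-variation
Euler–Lagrange identity holds for all compactly supported smooth vector fields. -/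
def VariationalSolution (Ω : Set ℂ) (u : ℂ → ℝ) : Prop :=
  ContinuousOn u Ω ∧ (∀ z ∈ Ω, 0 ≤ u z) ∧
  (∀ K : Set ℂ, K ⊆ Ω → IsCompact K →
    MeasureTheory.IntegrableOn (fun z => (u z) ^ 2 + ‖grad2 u z‖ ^ 2) K) ∧
  ContDiffOn ℝ 2 u (posSet Ω u) ∧
  ∀ ψ : ℂ → ℂ, ContDiff ℝ (⊤ : ℕ∞) ψ → HasCompactSupport ψ → tsupport ψ ⊆ Ω →
    ∫ z in Ω, ((‖grad2 u z‖ ^ 2 + Set.indicator {w | 0 < u w} (fun _ => (1 : ℝ)) z) * div2 ψ z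
      - 2 * dot2 (grad2 u z) (fderiv ℝ ψ z (grad2 u z))) = 0

/-- Average of `w` over the circle of radius `r` around `z`. -/
def circleAvg (w : ℂ → ℝ) (z : ℂ) (r : ℝ) : ℝ :=
  (1 / (2 * Real.pi)) * ∫ θ in (0 : ℝ)..(2 * Real.pi), w (z + r * Complex.exp (θ * Complex.I))

/-- Superharmonicity on `s` via the super-mean-value property. -/
def SuperharmonicOn2 (w : ℂ → ℝ) (s : Set ℂ) : Prop :=
  ∀ z ∈ s, ∀ r : ℝ, 0 < r → Metric.closedBall z r ⊆ s → circleAvg w z r ≤ w z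

/-- Subharmonicity on `s` via the sub-mean-value property. -/
def SubharmonicOn2 (w : ℂ → ℝ) (s : Set ℂ) : Prop :=
  ∀ z ∈ s, ∀ r : ℝ, 0 < r → Metric.closedBall z r ⊆ s → w z ≤ circleAvg w z r

/-- Non-tangential approach region in `B` at `x₀` with aperture `C`. -/
def NontangentialIn (B : Set ℂ) (x₀ : ℂ) (C : ℝ) : Set ℂ :=
  {x ∈ B | ‖x - x₀‖ ≤ C * Metric.infDist x Bᶜ}

/-- `w(x) = α ⟨x − x₀, ν⟩⁺ + o(|x − x₀|)` as `x → x₀` within the region `R`. -/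
def HasSlopeAt (w : ℂ → ℝ) (x₀ ν : ℂ) (α : ℝ) (R : Set ℂ) : Prop :=
  Filter.Tendsto (fun x => (w x - α * max (dot2 (x - x₀) ν) 0) / ‖x - x₀‖)
    (nhdsWithin x₀ R) (nhds 0)

/-- Viscosity supersolution of the one-phase free boundary problem in `Ω`. -/
structure ViscositySupersolution (Ω : Set ℂ) (w : ℂ → ℝ) : Prop where
  contOn : ContinuousOn w Ω
  nonneg : ∀ z ∈ Ω, 0 ≤ w z
  superharm : SuperharmonicOn2 w (posSet Ω w)
  slope : ∀ x₀ ∈ FB Ω w, ∀ (y : ℂ) (ρ : ℝ), 0 < ρ → Metric.ball y ρ ⊆ posSet Ω w →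
    dist x₀ y = ρ → ∃ α : ℝ, α ≤ 1 ∧ ∀ C : ℝ, 1 < C →
      HasSlopeAt w x₀ ((y - x₀) / (ρ : ℂ)) α (NontangentialIn (Metric.ball y ρ) x₀ C)

/-- Viscosity subsolution of the one-phase free boundary problem in `Ω`. -/
structure ViscositySubsolution (Ω : Set ℂ) (w : ℂ → ℝ) : Prop where
  contOn : ContinuousOn w Ω
  nonneg : ∀ z ∈ Ω, 0 ≤ w z
  subharm : SubharmonicOn2 w (posSet Ω w)
  slope : ∀ x₀ ∈ FB Ω w, ∀ (y : ℂ) (ρ : ℝ), 0 < ρ →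
    Metric.ball y ρ ⊆ {z ∈ Ω | w z = 0} → dist x₀ y = ρ →
    ∃ α : ℝ, 1 ≤ α ∧ ∀ C : ℝ, 1 < C →
      HasSlopeAt w x₀ ((x₀ - y) / (ρ : ℂ)) α
        (NontangentialIn (closure (Metric.ball y ρ))ᶜ x₀ C)

/-- Viscosity solution: both a supersolution and a subsolution. -/
def ViscositySolution (Ω : Set ℂ) (w : ℂ → ℝ) : Prop :=
  ViscositySupersolution Ω w ∧ ViscositySubsolution Ω w

/-- Non-degeneracy with constant `c`: linear growth away from the free boundary. -/
def Nondegenerate (Ω : Set ℂ) (w : ℂ → ℝ) (c : ℝ) : Prop :=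
  ∀ x ∈ FB Ω w, ∀ r : ℝ, 0 < r → Metric.ball x r ⊆ Ω → c * r ≤ sSup (w '' Metric.ball x r)

/-- The open annulus `{δ < |z| < R}`. -/
def ann (δ R : ℝ) : Set ℂ := {z : ℂ | δ < ‖z‖ ∧ ‖z‖ < R}

/-- Condition (A): the free boundary of `u` in the annulus `{δ < |z| < R}` consists of
exactly two connected components, each non-compact with closure meeting both boundary
circles. -/
def ConditionA (δ R : ℝ) (u : ℂ → ℝ) : Prop :=
  ∃ F₁ F₂ : Set ℂ,
    F₁.Nonempty ∧ F₂.Nonempty ∧ Disjoint F₁ F₂ ∧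
    F₁ ∪ F₂ = FB (ann δ R) u ∧
    (∀ z ∈ F₁, connectedComponentIn (FB (ann δ R) u) z = F₁) ∧
    (∀ z ∈ F₂, connectedComponentIn (FB (ann δ R) u) z = F₂) ∧
    ¬ IsCompact F₁ ∧ ¬ IsCompact F₂ ∧
    (closure F₁ ∩ Metric.sphere 0 δ).Nonempty ∧
    (closure F₁ ∩ Metric.sphere 0 R).Nonempty ∧
    (closure F₂ ∩ Metric.sphere 0 δ).Nonempty ∧
    (closure F₂ ∩ Metric.sphere 0 R).Nonempty

/-- `k` is the curvature of the set `S` at the point `p`, computed via an arc-length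
parametrization. -/
def IsCurvatureAt (S : Set ℂ) (p : ℂ) (k : ℝ) : Prop :=
  ∃ γ : ℝ → ℂ, ContDiff ℝ 2 γ ∧ γ 0 = p ∧ (∀ s : ℝ, ‖deriv γ s‖ = 1) ∧
    (∃ ε > 0, ∀ s ∈ Set.Ioo (-ε) ε, γ s ∈ S) ∧ ‖deriv (deriv γ) 0‖ = k

/-- A set has exactly two connected components. -/
def HasExactlyTwoComponents (S : Set ℂ) : Prop :=
  ∃ z₁ ∈ S, ∃ z₂ ∈ S, connectedComponentIn S z₁ ≠ connectedComponentIn S z₂ ∧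
    ∀ z ∈ S, connectedComponentIn S z = connectedComponentIn S z₁ ∨
      connectedComponentIn S z = connectedComponentIn S z₂

end

structure BSol (L : ℝ≥0) (u : ℂ → ℝ) : Prop where
  lip : LipschitzWith L u
  nonneg : ∀ z, 0 ≤ u z
  c2 : ContDiffOn ℝ 2 u {z | 0 < u z}
  var : ∀ ψ : ℂ → ℂ, ContDiff ℝ (⊤ : ℕ∞) ψ → HasCompactSupport ψ →
    ∫ z, ((‖grad2 u z‖ ^ 2 + Set.indicator {w | 0 < u w} (fun _ => (1 : ℝ)) z) * div2 ψ z
      - 2 * dot2 (grad2 u z) (fderiv ℝ ψ z (grad2 u z))) = 0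

lemma BSol.of_var {L : ℝ≥0} {u : ℂ → ℝ} (h : VariationalSolution Set.univ u)
    (hl : LipschitzOnWith L u Set.univ) : BSol L u := by
  obtain ⟨h1, h2, h3, h4, h5⟩ := h
  refine ⟨lipschitzOnWith_univ.1 hl, fun z => h2 z trivial, ?_, ?_⟩
  · simpa [posSet] using h4
  · intro ψ a b
    simpa using h5 ψ a b (subset_univ _)

lemma clm_eq_dot (f : ℂ →L[ℝ] ℝ) (h : ℂ) : f h = h.re * f 1 + h.im * f Complex.I := by
  conv_lhs => rw [← Complex.re_add_im h]
  have : (h.re : ℂ) + h.im * Complex.I = h.re • (1 : ℂ) + h.im • Complex.I := by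
    simp
  rw [this, map_add, map_smul, map_smul]; simp

lemma clmC_eq (f : ℂ →L[ℝ] ℂ) (h : ℂ) : f h = h.re * f 1 + h.im * f Complex.I := by
  conv_lhs => rw [← Complex.re_add_im h]
  have : (h.re : ℂ) + h.im * Complex.I = h.re • (1 : ℂ) + h.im • Complex.I := by
    simp
  rw [this, map_add, map_smul, map_smul]; simp

lemma grad2_re (u : ℂ → ℝ) (z : ℂ) : (grad2 u z).re = fderiv ℝ u z 1 := by simp [grad2]
lemma grad2_im (u : ℂ → ℝ) (z : ℂ) : (grad2 u z).im = fderiv ℝ u z Complex.I := by simp [grad2]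

lemma fderiv_eq_dot (u : ℂ → ℝ) (z h : ℂ) : fderiv ℝ u z h = dot2 (grad2 u z) h := by
  rw [clm_eq_dot, dot2, grad2_re, grad2_im]; ring

lemma normsq_eq (g : ℂ) : ‖g‖ ^ 2 = g.re ^ 2 + g.im ^ 2 := by
  rw [← Complex.normSq_eq_norm_sq, Complex.normSq_apply]; ring

lemma dot2_self (g : ℂ) : dot2 g g = ‖g‖ ^ 2 := by
  rw [normsq_eq, dot2]; ring

lemma abs_dot2_le (a b : ℂ) : |dot2 a b| ≤ ‖a‖ * ‖b‖ := by
  have : dot2 a b = (a * (starRingEnd ℂ) b).re := by simp [dot2]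
  rw [this]
  refine (Complex.abs_re_le_norm _).trans ?_
  simp

lemma norm_grad2_le {L : ℝ≥0} {u : ℂ → ℝ} (h : LipschitzWith L u) (z : ℂ) : ‖grad2 u z‖ ≤ L := by
  have h1 : ‖fderiv ℝ u z‖ ≤ L := norm_fderiv_le_of_lipschitz ℝ h
  have h2 := (fderiv ℝ u z).le_opNorm (grad2 u z)
  rw [fderiv_eq_dot, dot2_self] at h2
  have h3 : ‖grad2 u z‖ ^ 2 ≤ L * ‖grad2 u z‖ := by
    have := mul_le_mul_of_nonneg_right h1 (norm_nonneg (grad2 u z))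
    exact (le_abs_self _).trans (h2.trans this)
  rcases (norm_nonneg (grad2 u z)).eq_or_lt with h4 | h4
  · rw [← h4]; exact L.2
  · nlinarith

lemma grad2_zero {u : ℂ → ℝ} (hn : ∀ z, 0 ≤ u z) {z : ℂ} (hz : u z = 0) : grad2 u z = 0 := by
  have : IsLocalMin u z := Filter.Eventually.of_forall (fun y => by rw [hz]; exact hn y)
  simp [grad2, this.fderiv_eq_zero]

lemma measurable_grad2 (u : ℂ → ℝ) : Measurable (grad2 u) := by
  unfold grad2
  have h1 := measurable_fderiv_apply_const ℝ u (1 : ℂ)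
  have h2 := measurable_fderiv_apply_const ℝ u Complex.I
  fun_prop

lemma continuous_dot2 : Continuous (fun p : ℂ × ℂ => dot2 p.1 p.2) := by
  unfold dot2; fun_prop

lemma measurable_dot2 {f g : ℂ → ℂ} (hf : Measurable f) (hg : Measurable g) :
    Measurable (fun z => dot2 (f z) (g z)) := by
  unfold dot2
  exact ((Complex.measurable_re.comp hf).mul (Complex.measurable_re.comp hg)).add
    ((Complex.measurable_im.comp hf).mul (Complex.measurable_im.comp hg))

/-- bounded measurable with bounded support is integrable -/
lemma integrable_of_bdd_supp {f : ℂ → ℝ} (hm : Measurable f) {C r : ℝ} (hb : ∀ z, |f z| ≤ C)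
    (hs : ∀ z, r < ‖z‖ → f z = 0) : Integrable f := by
  have h1 : IntegrableOn f (closedBall 0 r) := by
    apply Measure.integrableOn_of_bounded (M := C)
    · exact (isCompact_closedBall (0:ℂ) r).measure_lt_top.ne
    · exact hm.aestronglyMeasurable
    · exact Filter.Eventually.of_forall (fun z => by simpa using hb z)
  refine h1.integrable_of_forall_notMem_eq_zero ?_
  intro z hz
  exact hs z (by simpa using hz)

lemma integral_fderiv_zero {f : ℂ → ℝ} (hf : ContDiff ℝ 1 f) (hc : HasCompactSupport f) (v : ℂ) :
    Integrable (fun z => fderiv ℝ f z v) ∧ ∫ z, fderiv ℝ f z v = 0 := by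
  have hi : Integrable (fun z => fderiv ℝ f z v) := by
    apply Continuous.integrable_of_hasCompactSupport
    · exact (hf.continuous_fderiv (by simp)).clm_apply continuous_const
    · exact hc.fderiv_apply (𝕜 := ℝ) v
  refine ⟨hi, ?_⟩
  have := integral_mul_fderiv_eq_neg_fderiv_mul_of_integrable (𝕜 := ℝ) (μ := (volume : Measure ℂ))
    (f := fun _ : ℂ => (1:ℝ)) (g := f) (v := v) (by simp) (by simpa using hi)
    (by simpa using hf.continuous.integrable_of_hasCompactSupport hc)
    (fun x _ => differentiableAt_const _) (fun x _ => hf.differentiable (by simp) x)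
  simpa using this

lemma integral_div2_zero {X : ℂ → ℂ} (hX : ContDiff ℝ 1 X) (hc : HasCompactSupport X) :
    ∫ z, div2 X z = 0 := by
  have h1 : ContDiff ℝ 1 (fun z => (X z).re) := Complex.reCLM.contDiff.comp hX
  have h2 : ContDiff ℝ 1 (fun z => (X z).im) := Complex.imCLM.contDiff.comp hX
  have c1 : HasCompactSupport (fun z => (X z).re) := hc.comp_left (g := Complex.re) rfl
  have c2 : HasCompactSupport (fun z => (X z).im) := hc.comp_left (g := Complex.im) rfl
  have e : ∀ z, div2 X z = fderiv ℝ (fun z => (X z).re) z 1 + fderiv ℝ (fun z => (X z).im) z Complex.I := by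
    intro z
    have hd := (hX.differentiable (by simp) z).hasFDerivAt
    have d1 : fderiv ℝ (fun z => (X z).re) z = Complex.reCLM.comp (fderiv ℝ X z) :=
      (Complex.reCLM.hasFDerivAt.comp z hd).fderiv
    have d2 : fderiv ℝ (fun z => (X z).im) z = Complex.imCLM.comp (fderiv ℝ X z) :=
      (Complex.imCLM.hasFDerivAt.comp z hd).fderiv
    rw [d1, d2]; simp [div2]
  simp_rw [e]
  rw [integral_add (integral_fderiv_zero h1 c1 1).1 (integral_fderiv_zero h2 c2 _).1,
    (integral_fderiv_zero h1 c1 1).2, (integral_fderiv_zero h2 c2 _).2, add_zero]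

lemma BSol.isOpen {L : ℝ≥0} {u : ℂ → ℝ} (h : BSol L u) : IsOpen {z | 0 < u z} :=
  isOpen_lt continuous_const h.lip.continuous

lemma BSol.c2At {L : ℝ≥0} {u : ℂ → ℝ} (h : BSol L u) {z : ℂ} (hz : 0 < u z) : ContDiffAt ℝ 2 u z :=
  h.c2.contDiffAt (h.isOpen.mem_nhds hz)

lemma BSol.fderivC1 {L : ℝ≥0} {u : ℂ → ℝ} (h : BSol L u) {z : ℂ} (hz : 0 < u z) (v : ℂ) :
    ContDiffAt ℝ 1 (fun x => fderiv ℝ u x v) z :=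
  ((h.c2At hz).fderiv_right (m := 1) (by norm_num)).clm_apply contDiffAt_const

lemma contDiff_of_loc {f η : ℂ → ℝ} {U : Set ℂ} {n : ℕ∞} (hη : tsupport η ⊆ U)
    (h0 : ∀ z, η z = 0 → f z = 0)
    (h : ∀ z ∈ U, ContDiffAt ℝ n f z) : ContDiff ℝ n f := by
  rw [contDiff_iff_contDiffAt]
  intro z
  by_cases hz : z ∈ U
  · exact h z hz
  · have : z ∉ tsupport η := fun hh => hz (hη hh)
    have h1 : η =ᶠ[𝓝 z] 0 := notMem_tsupport_iff_eventuallyEq.1 this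
    have h2 : f =ᶠ[𝓝 z] fun _ => (0:ℝ) := by
      filter_upwards [h1] with y hy using h0 y hy
    exact contDiffAt_const.congr_of_eventuallyEq h2

lemma continuous_of_loc {f η : ℂ → ℝ} {U : Set ℂ} (hη : tsupport η ⊆ U)
    (h0 : ∀ z, η z = 0 → f z = 0)
    (h : ∀ z ∈ U, ContinuousAt f z) : Continuous f := by
  rw [continuous_iff_continuousAt]
  intro z
  by_cases hz : z ∈ U
  · exact h z hz
  · have : z ∉ tsupport η := fun hh => hz (hη hh)
    have h1 : η =ᶠ[𝓝 z] 0 := notMem_tsupport_iff_eventuallyEq.1 this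
    have h2 : f =ᶠ[𝓝 z] fun _ => (0:ℝ) := by
      filter_upwards [h1] with y hy using h0 y hy
    exact continuousAt_const.congr h2.symm

lemma hcs_of_zero {f η : ℂ → ℝ} (hc : HasCompactSupport η) (h0 : ∀ z, η z = 0 → f z = 0) :
    HasCompactSupport f := by
  refine hc.mono (fun z hz => ?_)
  intro h; exact hz (h0 z h)

lemma hess_symm {L : ℝ≥0} {u : ℂ → ℝ} (h : BSol L u) {z : ℂ} (hz : 0 < u z) :
    fderiv ℝ (fun x => fderiv ℝ u x 1) z Complex.I = fderiv ℝ (fun x => fderiv ℝ u x Complex.I) z 1 := by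
  have hd : DifferentiableAt ℝ (fderiv ℝ u) z :=
    ((h.c2At hz).fderiv_right (m := 1) (by norm_num)).differentiableAt (by simp)
  have hs := (h.c2At hz).isSymmSndFDerivAt (by simp)
  rw [fderiv_clm_apply hd (differentiableAt_const _), fderiv_clm_apply hd (differentiableAt_const _)]
  simpa using hs.eq Complex.I 1

lemma BSol.test {L : ℝ≥0} {u : ℂ → ℝ} (h : BSol L u) {η : ℂ → ℝ} (hη : ContDiff ℝ (⊤ : ℕ∞) η)
    (hc : HasCompactSupport η) (hs : tsupport η ⊆ {z | 0 < u z}) (e : ℂ) :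
    ∫ z, η z * (fderiv ℝ u z e * (fderiv ℝ (fun x => fderiv ℝ u x 1) z 1 +
      fderiv ℝ (fun x => fderiv ℝ u x Complex.I) z Complex.I)) = 0 := by
  set p := fun x => fderiv ℝ u x 1 with hp
  set q := fun x => fderiv ℝ u x Complex.I with hq
  set D := fun z => fderiv ℝ p z 1 + fderiv ℝ q z Complex.I with hD
  have cp : ∀ z ∈ {z | 0 < u z}, ContDiffAt ℝ 1 p z := fun z hz => h.fderivC1 hz 1
  have cq : ∀ z ∈ {z | 0 < u z}, ContDiffAt ℝ 1 q z := fun z hz => h.fderivC1 hz Complex.I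
  have cη : ContDiff ℝ 1 η := hη.of_le (by exact_mod_cast le_top)
  let s := fun z => e.re * p z + e.im * q z
  -- X = η (|g|^2 e - 2 (g.e) g)
  let a := fun z => η z * ((p z ^ 2 + q z ^ 2) * e.re - 2 * (s z) * p z)
  let b := fun z => η z * ((p z ^ 2 + q z ^ 2) * e.im - 2 * (s z) * q z)
  have hs' : ∀ z ∈ {z | 0 < u z}, ContDiffAt ℝ 1 s z := fun z hz =>
    (contDiffAt_const.mul (cp z hz)).add (contDiffAt_const.mul (cq z hz))
  have ca : ContDiff ℝ 1 a := contDiff_of_loc (η := η) (n := 1) hs (fun z hz => by simp [a, hz]) (fun z hz =>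
    cη.contDiffAt.mul (((((cp z hz).pow 2).add ((cq z hz).pow 2)).mul contDiffAt_const).sub
      ((contDiffAt_const.mul (hs' z hz)).mul (cp z hz))))
  have cb : ContDiff ℝ 1 b := contDiff_of_loc (η := η) (n := 1) hs (fun z hz => by simp [b, hz]) (fun z hz =>
    cη.contDiffAt.mul (((((cp z hz).pow 2).add ((cq z hz).pow 2)).mul contDiffAt_const).sub
      ((contDiffAt_const.mul (hs' z hz)).mul (cq z hz))))
  have ia := integral_fderiv_zero ca (hcs_of_zero hc (fun z hz => by simp [a, hz])) 1
  have ib := integral_fderiv_zero cb (hcs_of_zero hc (fun z hz => by simp [b, hz])) Complex.I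
  have iη := integral_fderiv_zero cη hc e
  have hDc : ∀ z ∈ {z | 0 < u z}, ContinuousAt D z := by
    intro z hz
    have h1 := ((cp z hz).fderiv_right (m := 0) (by simp)).continuousAt
    have h2 := ((cq z hz).fderiv_right (m := 0) (by simp)).continuousAt
    exact (h1.clm_apply continuousAt_const).add (h2.clm_apply continuousAt_const)
  have hFc : Continuous (fun z => 2 * (η z * (fderiv ℝ u z e * D z))) := by
    refine continuous_of_loc (η := η) hs (fun z hz => by simp [hz]) (fun z hz => ?_)
    exact continuousAt_const.mul (cη.continuous.continuousAt.mul
      ((h.fderivC1 hz e).continuousAt.mul (hDc z hz)))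
  have iF := hFc.integrable_of_hasCompactSupport (μ := volume)
    (hcs_of_zero hc (fun z hz => by simp [hz]))
  have hv := h.var (fun z => (η z : ℂ) * e) (by
      exact (Complex.ofRealCLM.contDiff.comp hη).mul contDiff_const)
      ((hc.comp_left (g := fun t : ℝ => (t : ℂ)) rfl).mul_right)
  have key : ∀ z, (‖grad2 u z‖ ^ 2 + Set.indicator {w | 0 < u w} (fun _ => (1 : ℝ)) z) *
      div2 (fun z => (η z : ℂ) * e) z
      - 2 * dot2 (grad2 u z) (fderiv ℝ (fun z => (η z : ℂ) * e) z (grad2 u z)) =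
      ((fderiv ℝ a z 1 + fderiv ℝ b z Complex.I) + fderiv ℝ η z e) +
        2 * (η z * (fderiv ℝ u z e * D z)) := by
    intro z
    have dη := (cη.differentiable (by simp) z).hasFDerivAt
    have dψ : HasFDerivAt (fun z => (η z : ℂ) * e)
        ((Complex.ofRealCLM.comp (fderiv ℝ η z)).smulRight e) z := by
      have hh := (Complex.ofRealCLM.hasFDerivAt.comp z dη).mul_const e
      refine hh.congr_fderiv ?_
      ext <;> simp [mul_comm]
    rw [div2, dψ.fderiv]
    by_cases hz : 0 < u z
    · have dp := ((cp z hz).differentiableAt (by simp)).hasFDerivAt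
      have dq := ((cq z hz).differentiableAt (by simp)).hasFDerivAt
      have ds : HasFDerivAt s _ z := (dp.const_mul e.re).add (dq.const_mul e.im)
      have da : HasFDerivAt a _ z := dη.mul ((((dp.pow 2).add (dq.pow 2)).mul_const e.re).sub
        ((ds.const_mul 2).mul dp))
      have db : HasFDerivAt b _ z := dη.mul ((((dp.pow 2).add (dq.pow 2)).mul_const e.im).sub
        ((ds.const_mul 2).mul dq))
      rw [da.fderiv, db.fderiv]
      have hsy : fderiv ℝ p z Complex.I = fderiv ℝ q z 1 := hess_symm h hz
      have e1 := clm_eq_dot (fderiv ℝ η z) e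
      have e2 := clm_eq_dot (fderiv ℝ η z) (grad2 u z)
      have e3 := clm_eq_dot (fderiv ℝ u z) e
      rw [grad2_re, grad2_im] at e2
      simp only [dot2, normsq_eq, grad2_re, grad2_im, indicator_of_mem (show z ∈ {w | 0 < u w} from hz)]
      simp [e1, e2, e3, hsy, hD, s]
      change _ = _
      have E1 : fderiv ℝ u z 1 = p z := rfl
      have E2 : fderiv ℝ u z Complex.I = q z := rfl
      rw [E1, E2]
      ring
    · have hz' : z ∉ tsupport η := fun hh => hz (hs hh)
      have h1 : η =ᶠ[𝓝 z] fun _ => (0:ℝ) := notMem_tsupport_iff_eventuallyEq.1 hz'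
      have h2 : fderiv ℝ η z = 0 := by rw [h1.fderiv_eq]; simp
      have h3 : fderiv ℝ a z = 0 := by
        have : a =ᶠ[𝓝 z] fun _ => (0:ℝ) := by filter_upwards [h1] with y hy; simp [a, hy]
        rw [this.fderiv_eq]; simp
      have h4 : fderiv ℝ b z = 0 := by
        have : b =ᶠ[𝓝 z] fun _ => (0:ℝ) := by filter_upwards [h1] with y hy; simp [b, hy]
        rw [this.fderiv_eq]; simp
      simp [h2, h3, h4, h1.self_of_nhds, dot2]
  simp_rw [key] at hv
  have i1 : Integrable (fun z => fderiv ℝ a z 1 + fderiv ℝ b z Complex.I) := ia.1.add ib.1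
  have i2 : Integrable (fun z => (fderiv ℝ a z 1 + fderiv ℝ b z Complex.I) + fderiv ℝ η z e) :=
    i1.add iη.1
  rw [integral_add i2 iF, integral_add i1 iη.1,
    integral_add ia.1 ib.1, ia.2, ib.2, iη.2, integral_const_mul] at hv
  linarith

lemma BSol.lap_zero {L : ℝ≥0} {u : ℂ → ℝ} (h : BSol L u) {z : ℂ} (hz : 0 < u z) :
    fderiv ℝ (fun x => fderiv ℝ u x 1) z 1 +
      fderiv ℝ (fun x => fderiv ℝ u x Complex.I) z Complex.I = 0 := by
  set p := fun x => fderiv ℝ u x 1 with hp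
  set q := fun x => fderiv ℝ u x Complex.I with hq
  set D := fun z => fderiv ℝ p z 1 + fderiv ℝ q z Complex.I with hD
  have cp : ∀ z ∈ {z | 0 < u z}, ContDiffAt ℝ 1 p z := fun z hz => h.fderivC1 hz 1
  have cq : ∀ z ∈ {z | 0 < u z}, ContDiffAt ℝ 1 q z := fun z hz => h.fderivC1 hz Complex.I
  have hDc : ContinuousOn D {z | 0 < u z} := by
    intro z hz
    have h1 := ((cp z hz).fderiv_right (m := 0) (by simp)).continuousAt
    have h2 := ((cq z hz).fderiv_right (m := 0) (by simp)).continuousAt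
    exact ((h1.clm_apply continuousAt_const).add (h2.clm_apply continuousAt_const)).continuousWithinAt
  have main : ∀ e : ℂ, ∀ z, 0 < u z → fderiv ℝ u z e * D z = 0 := by
    intro e
    have hcont : ContinuousOn (fun z => fderiv ℝ u z e * D z) {z | 0 < u z} :=
      ContinuousOn.mul (fun z hz => (h.fderivC1 hz e).continuousAt.continuousWithinAt) hDc
    have hae := h.isOpen.ae_eq_zero_of_integral_contDiff_smul_eq_zero (μ := volume)
      (hcont.locallyIntegrableOn h.isOpen.measurableSet)
      (fun g hg hgc hgs => by simpa using h.test hg hgc hgs e)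
    have h2 : (fun z => fderiv ℝ u z e * D z) =ᵐ[volume.restrict {z | 0 < u z}] fun _ => 0 := by
      rw [Filter.EventuallyEq, ae_restrict_iff' h.isOpen.measurableSet]; exact hae
    exact fun z hz => MeasureTheory.Measure.eqOn_open_of_ae_eq h2 h.isOpen hcont continuousOn_const hz
  by_contra hne
  have hev : ∀ᶠ y in 𝓝 z, D y ≠ 0 := (hDc.continuousAt (h.isOpen.mem_nhds hz)).eventually_ne hne
  have hev2 : ∀ᶠ y in 𝓝 z, 0 < u y := h.isOpen.mem_nhds hz
  have z1 : p =ᶠ[𝓝 z] fun _ => 0 := by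
    filter_upwards [hev, hev2] with y h1 h2
    exact (mul_eq_zero.1 (main 1 y h2)).resolve_right h1
  have z2 : q =ᶠ[𝓝 z] fun _ => 0 := by
    filter_upwards [hev, hev2] with y h1 h2
    exact (mul_eq_zero.1 (main Complex.I y h2)).resolve_right h1
  apply hne
  simp [z1.fderiv_eq, z2.fderiv_eq]

lemma BSol.harmonicAt {L : ℝ≥0} {u : ℂ → ℝ} (h : BSol L u) {z : ℂ} (hz : 0 < u z) :
    InnerProductSpace.HarmonicAt u z := by
  refine ⟨h.c2At hz, ?_⟩
  filter_upwards [h.isOpen.mem_nhds hz] with y hy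
  have := h.lap_zero hy
  have hd : DifferentiableAt ℝ (fderiv ℝ u) y :=
    ((h.c2At hy).fderiv_right (m := 1) (by norm_num)).differentiableAt (by simp)
  rw [fderiv_clm_apply hd (differentiableAt_const _), fderiv_clm_apply hd (differentiableAt_const _)] at this
  rw [InnerProductSpace.laplacian_eq_iteratedFDeriv_complexPlane]
  simpa [iteratedFDeriv_two_apply] using this

noncomputable def cutF (t : ℝ) : ℝ := t * Real.smoothTransition (t - 1)

lemma cutF_contDiff : ContDiff ℝ (⊤ : ℕ∞) cutF := by
  unfold cutF
  exact contDiff_id.mul (Real.smoothTransition.contDiff.comp (contDiff_id.sub contDiff_const))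

lemma cutF_zero {t : ℝ} (h : t ≤ 1) : cutF t = 0 := by
  rw [cutF, Real.smoothTransition.zero_of_nonpos (by linarith), mul_zero]

lemma cutF_id {t : ℝ} (h : 2 ≤ t) : cutF t = t := by
  rw [cutF, Real.smoothTransition.one_of_one_le (by linarith), mul_one]

lemma cutF_abs {t : ℝ} (h : 0 ≤ t) : |cutF t| ≤ t := by
  rw [cutF, abs_mul, abs_of_nonneg h, abs_of_nonneg (Real.smoothTransition.nonneg _)]
  exact mul_le_of_le_one_right h (Real.smoothTransition.le_one _)

lemma cutF_deriv_one {t : ℝ} (h : 2 < t) : deriv cutF t = 1 := by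
  have : cutF =ᶠ[𝓝 t] id := by
    filter_upwards [lt_mem_nhds h] with s hs using cutF_id hs.le
  rw [this.deriv_eq]; simp

lemma cutF_deriv_zero {t : ℝ} (h : t < 1) : deriv cutF t = 0 := by
  have : cutF =ᶠ[𝓝 t] fun _ => 0 := by
    filter_upwards [gt_mem_nhds h] with s hs using cutF_zero (le_of_lt hs)
  rw [this.deriv_eq]; simp

lemma cutF_deriv_bdd : ∃ C, 0 ≤ C ∧ ∀ t, |deriv cutF t| ≤ C := by
  have hc : Continuous (deriv cutF) := cutF_contDiff.continuous_deriv (by simp)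
  obtain ⟨C, hC⟩ := (isCompact_Icc (a := (1:ℝ)) (b := 2)).exists_bound_of_continuousOn hc.continuousOn
  refine ⟨max C 1, by positivity, fun t => ?_⟩
  rcases lt_or_ge t 1 with h | h
  · rw [cutF_deriv_zero h]; simp
  rcases lt_or_ge 2 t with h' | h'
  · rw [cutF_deriv_one h']; simp
  · exact (hC t ⟨h, h'⟩).trans (le_max_left _ _)

lemma BSol.energy_n {L : ℝ≥0} {u : ℂ → ℝ} (h : BSol L u) {ζ : ℂ → ℝ} (hζ : ContDiff ℝ 1 ζ)
    (hc : HasCompactSupport ζ) {n : ℝ} (hn : 0 < n) :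
    ∫ z, (deriv cutF (n * u z) * ‖grad2 u z‖ ^ 2 * ζ z +
      n⁻¹ * cutF (n * u z) * fderiv ℝ ζ z (grad2 u z)) = 0 := by
  set p := fun x => fderiv ℝ u x 1 with hp
  set q := fun x => fderiv ℝ u x Complex.I with hq
  have cp : ∀ z ∈ {z | 0 < u z}, ContDiffAt ℝ 1 p z := fun z hz => h.fderivC1 hz 1
  have cq : ∀ z ∈ {z | 0 < u z}, ContDiffAt ℝ 1 q z := fun z hz => h.fderivC1 hz Complex.I
  let a := fun z => n⁻¹ * cutF (n * u z) * ζ z * p z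
  let b := fun z => n⁻¹ * cutF (n * u z) * ζ z * q z
  have hF1 : ContDiff ℝ 1 cutF := cutF_contDiff.of_le (by exact_mod_cast le_top)
  have loc : ∀ z, ¬ 0 < u z → ∀ᶠ y in 𝓝 z, cutF (n * u y) = 0 := by
    intro z hz
    have : ∀ᶠ y in 𝓝 z, n * u y < 1 := by
      have hcont : Continuous (fun y => n * u y) := continuous_const.mul h.lip.continuous
      have h0 : u z = 0 := le_antisymm (not_lt.1 hz) (h.nonneg z)
      exact hcont.continuousAt.eventually_lt continuousAt_const (by simp [h0])
    filter_upwards [this] with y hy using cutF_zero hy.le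
  have cG : ∀ z, 0 < u z → ContDiffAt ℝ 1 (fun z => n⁻¹ * cutF (n * u z)) z := fun z hz =>
    contDiffAt_const.mul (hF1.contDiffAt.comp z (contDiffAt_const.mul ((h.c2At hz).of_le (by norm_num))))
  have ca : ContDiff ℝ 1 a := by
    rw [contDiff_iff_contDiffAt]; intro z
    by_cases hz : 0 < u z
    · exact ((cG z hz).mul hζ.contDiffAt).mul (cp z hz)
    · have : a =ᶠ[𝓝 z] fun _ => 0 := by
        filter_upwards [loc z hz] with y hy; simp [a, hy]
      exact contDiffAt_const.congr_of_eventuallyEq this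
  have cb : ContDiff ℝ 1 b := by
    rw [contDiff_iff_contDiffAt]; intro z
    by_cases hz : 0 < u z
    · exact ((cG z hz).mul hζ.contDiffAt).mul (cq z hz)
    · have : b =ᶠ[𝓝 z] fun _ => 0 := by
        filter_upwards [loc z hz] with y hy; simp [b, hy]
      exact contDiffAt_const.congr_of_eventuallyEq this
  have ia := integral_fderiv_zero ca (hcs_of_zero hc (fun z hz => by simp [a, hz])) 1
  have ib := integral_fderiv_zero cb (hcs_of_zero hc (fun z hz => by simp [b, hz])) Complex.I
  have key : ∀ z, (deriv cutF (n * u z) * ‖grad2 u z‖ ^ 2 * ζ z +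
      n⁻¹ * cutF (n * u z) * fderiv ℝ ζ z (grad2 u z)) =
      fderiv ℝ a z 1 + fderiv ℝ b z Complex.I := by
    intro z
    by_cases hz : 0 < u z
    · have dp := ((cp z hz).differentiableAt (by simp)).hasFDerivAt
      have dq := ((cq z hz).differentiableAt (by simp)).hasFDerivAt
      have du := ((h.c2At hz).differentiableAt (by simp)).hasFDerivAt
      have dζ := (hζ.differentiable (by simp) z).hasFDerivAt
      have dF := (hF1.differentiable (by simp) (n * u z)).hasDerivAt
      have dG : HasFDerivAt (fun z => n⁻¹ * cutF (n * u z)) _ z :=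
        (HasDerivAt.comp_hasFDerivAt (h₂ := cutF) z dF (du.const_mul n)).const_mul n⁻¹
      have da : HasFDerivAt a _ z := (dG.mul dζ).mul dp
      have db : HasFDerivAt b _ z := (dG.mul dζ).mul dq
      rw [da.fderiv, db.fderiv]
      have hl : fderiv ℝ q z Complex.I = - fderiv ℝ p z 1 := by
        have := h.lap_zero hz; linarith
      have e2 := clm_eq_dot (fderiv ℝ ζ z) (grad2 u z)
      rw [grad2_re, grad2_im] at e2
      simp only [normsq_eq, grad2_re, grad2_im, e2]
      simp [hl]
      have E1 : fderiv ℝ u z 1 = p z := rfl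
      have E2 : fderiv ℝ u z Complex.I = q z := rfl
      rw [E1, E2]
      field_simp
      ring
    · have h3 : fderiv ℝ a z = 0 := by
        have : a =ᶠ[𝓝 z] fun _ => (0:ℝ) := by filter_upwards [loc z hz] with y hy; simp [a, hy]
        rw [this.fderiv_eq]; simp
      have h4 : fderiv ℝ b z = 0 := by
        have : b =ᶠ[𝓝 z] fun _ => (0:ℝ) := by filter_upwards [loc z hz] with y hy; simp [b, hy]
        rw [this.fderiv_eq]; simp
      have h0 : u z = 0 := le_antisymm (not_lt.1 hz) (h.nonneg z)
      simp [h3, h4, grad2_zero h.nonneg h0]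
  simp_rw [key]
  rw [integral_add ia.1 ib.1, ia.2, ib.2, add_zero]

lemma BSol.energy {L : ℝ≥0} {u : ℂ → ℝ} (h : BSol L u) {ζ : ℂ → ℝ} (hζ : ContDiff ℝ 1 ζ)
    (hc : HasCompactSupport ζ) :
    ∫ z, (‖grad2 u z‖ ^ 2 * ζ z + u z * fderiv ℝ ζ z (grad2 u z)) = 0 := by
  obtain ⟨C, hC0, hC⟩ := cutF_deriv_bdd
  have mg := measurable_grad2 u
  have mu : Measurable u := h.lip.continuous.measurable
  have hζ' : Continuous (fderiv ℝ ζ) := hζ.continuous_fderiv (by simp)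
  have mζ : ∀ z, fderiv ℝ ζ z (grad2 u z) = (grad2 u z).re * fderiv ℝ ζ z 1
      + (grad2 u z).im * fderiv ℝ ζ z Complex.I := fun z => clm_eq_dot _ _
  have c1 : Continuous (fun z => fderiv ℝ ζ z 1) := hζ'.clm_apply continuous_const
  have c2 : Continuous (fun z => fderiv ℝ ζ z Complex.I) := hζ'.clm_apply continuous_const
  have mζ' : Measurable (fun z => fderiv ℝ ζ z (grad2 u z)) := by
    simp_rw [mζ]
    exact ((Complex.measurable_re.comp mg).mul c1.measurable).add
      ((Complex.measurable_im.comp mg).mul c2.measurable)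
  have hbound : Integrable (fun z => C * L ^ 2 * ‖ζ z‖ + L * (u z * ‖fderiv ℝ ζ z‖)) := by
    apply Continuous.integrable_of_hasCompactSupport
    · exact (continuous_const.mul hζ.continuous.norm).add
        (continuous_const.mul (h.lip.continuous.mul hζ'.norm))
    · apply HasCompactSupport.add
      · exact hc.norm.mul_left
      · exact ((hc.fderiv (𝕜 := ℝ)).norm.mul_left).mul_left
  have hlim := tendsto_integral_of_dominated_convergence (μ := volume)
    (F := fun (n : ℕ) z => (deriv cutF (((n:ℝ)+1) * u z) * ‖grad2 u z‖ ^ 2 * ζ z +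
      ((n:ℝ)+1)⁻¹ * cutF (((n:ℝ)+1) * u z) * fderiv ℝ ζ z (grad2 u z)))
    (f := fun z => (‖grad2 u z‖ ^ 2 * ζ z + u z * fderiv ℝ ζ z (grad2 u z)))
    (fun z => C * L ^ 2 * ‖ζ z‖ + L * (u z * ‖fderiv ℝ ζ z‖)) ?_ hbound ?_ ?_
  · have : ∀ n : ℕ, ∫ z, (deriv cutF (((n:ℝ)+1) * u z) * ‖grad2 u z‖ ^ 2 * ζ z +
      ((n:ℝ)+1)⁻¹ * cutF (((n:ℝ)+1) * u z) * fderiv ℝ ζ z (grad2 u z)) = 0 :=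
      fun n => h.energy_n hζ hc (by positivity)
    simp_rw [this] at hlim
    exact tendsto_nhds_unique hlim tendsto_const_nhds
  · intro n
    have hF : Measurable cutF := cutF_contDiff.continuous.measurable
    have hF' : Measurable (deriv cutF) := measurable_deriv _
    have mm : Measurable (fun z => ((n:ℝ)+1) * u z) := measurable_const.mul mu
    exact (((hF'.comp mm).mul (mg.norm.pow_const 2)).mul hζ.continuous.measurable |>.add
      ((measurable_const.mul (hF.comp mm)).mul mζ')).aestronglyMeasurable
  · intro n
    refine Eventually.of_forall (fun z => ?_)
    have hn : (0:ℝ) < (n:ℝ) + 1 := by positivity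
    have g1 := norm_grad2_le h.lip z
    have e1 : ‖deriv cutF (((n:ℝ)+1) * u z) * ‖grad2 u z‖ ^ 2 * ζ z‖ ≤ C * L ^ 2 * ‖ζ z‖ := by
      rw [norm_mul, norm_mul]
      gcongr
      · exact hC _
      · rw [norm_pow, norm_norm]; gcongr
    have e2 : ‖((n:ℝ)+1)⁻¹ * cutF (((n:ℝ)+1) * u z) * fderiv ℝ ζ z (grad2 u z)‖ ≤
        L * (u z * ‖fderiv ℝ ζ z‖) := by
      rw [norm_mul, norm_mul]
      have a1 : ‖((n:ℝ)+1)⁻¹‖ * ‖cutF (((n:ℝ)+1) * u z)‖ ≤ u z := by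
        rw [norm_inv, Real.norm_of_nonneg hn.le, inv_mul_le_iff₀ hn]
        exact cutF_abs (mul_nonneg hn.le (h.nonneg z))
      have a2 : ‖fderiv ℝ ζ z (grad2 u z)‖ ≤ ‖fderiv ℝ ζ z‖ * L :=
        ((fderiv ℝ ζ z).le_opNorm _).trans (by gcongr)
      calc _ ≤ u z * (‖fderiv ℝ ζ z‖ * L) := by
            gcongr
            exact h.nonneg z
        _ = _ := by ring
    exact (norm_add_le _ _).trans (add_le_add e1 e2)
  · refine Eventually.of_forall (fun z => ?_)
    by_cases hz : 0 < u z
    · apply tendsto_const_nhds.congr'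
      have : ∀ᶠ n : ℕ in atTop, 2 < ((n:ℝ) + 1) * u z := by
        have : Tendsto (fun n : ℕ => ((n:ℝ)+1) * u z) atTop atTop :=
          (tendsto_natCast_atTop_atTop.atTop_add tendsto_const_nhds).atTop_mul_const hz
        exact this.eventually_gt_atTop 2
      filter_upwards [this] with n hn
      have hn0 : ((n:ℝ) + 1) ≠ 0 := by positivity
      rw [cutF_deriv_one hn, cutF_id hn.le]
      field_simp
    · have h0 : u z = 0 := le_antisymm (not_lt.1 hz) (h.nonneg z)
      simp [grad2_zero h.nonneg h0]

lemma BSol.sq_hasFDerivAt {L : ℝ≥0} {u : ℂ → ℝ} (h : BSol L u) (z : ℂ) :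
    HasFDerivAt (fun z => u z ^ 2) ((2 * u z) • fderiv ℝ u z) z := by
  by_cases hz : 0 < u z
  · have du := ((h.c2At hz).differentiableAt (by simp)).hasFDerivAt
    simpa using du.pow 2
  · have h0 : u z = 0 := le_antisymm (not_lt.1 hz) (h.nonneg z)
    rw [h0]
    simp only [mul_zero, zero_smul]
    rw [hasFDerivAt_iff_isLittleO_nhds_zero]
    have : (fun h' : ℂ => u (z + h') ^ 2 - u z ^ 2 - (0 : ℂ →L[ℝ] ℝ) h') =O[𝓝 0]
        fun h' : ℂ => ‖h'‖ ^ 2 := by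
      refine Asymptotics.IsBigO.of_bound ((L:ℝ) ^ 2) (Eventually.of_forall fun y => ?_)
      have := h.lip.dist_le_mul (z + y) z
      simp only [h0, sub_zero, dist_eq_norm, add_sub_cancel_left] at this
      simp [h0]
      rw [← mul_pow, ← sq_abs]
      gcongr
      exact this
    refine this.trans_isLittleO ?_
    exact (Asymptotics.isLittleO_norm_pow_id one_lt_two)

lemma BSol.sq_contDiff {L : ℝ≥0} {u : ℂ → ℝ} (h : BSol L u) : ContDiff ℝ 1 (fun z => u z ^ 2) := by
  rw [contDiff_one_iff_hasFDerivAt]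
  refine ⟨fun z => (2 * u z) • fderiv ℝ u z, ?_, h.sq_hasFDerivAt⟩
  rw [continuous_iff_continuousAt]
  intro z
  by_cases hz : 0 < u z
  · exact (continuousAt_const.mul h.lip.continuous.continuousAt).smul
      ((h.c2At hz).fderiv_right (m := 1) (by norm_num)).continuousAt
  · have h0 : u z = 0 := le_antisymm (not_lt.1 hz) (h.nonneg z)
    rw [ContinuousAt, h0]
    simp only [mul_zero, zero_smul]
    apply squeeze_zero_norm (a := fun y => 2 * u y * L)
    · intro y
      rw [norm_smul, Real.norm_of_nonneg (mul_nonneg zero_le_two (h.nonneg y))]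
      exact mul_le_mul_of_nonneg_left (norm_fderiv_le_of_lipschitz ℝ h.lip)
        (mul_nonneg zero_le_two (h.nonneg y))
    · have hc : Continuous (fun y => 2 * u y * L) := by
        have := h.lip.continuous; fun_prop
      have := hc.tendsto z
      simpa [h0] using this

lemma dot2_comm (a b : ℂ) : dot2 a b = dot2 b a := by simp [dot2, mul_comm]

lemma normSq_dot (z : ℂ) : dot2 z z = normSq z := by simp [dot2, normSq_apply]

lemma normSq_cd : ContDiff ℝ (⊤ : ℕ∞) (fun z : ℂ => normSq z) := by
  have : (fun z : ℂ => normSq z) = fun z => reCLM z * reCLM z + imCLM z * imCLM z := by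
    ext z; simp [normSq_apply]
  rw [this]
  exact (reCLM.contDiff.mul reCLM.contDiff).add (imCLM.contDiff.mul imCLM.contDiff)

lemma hasFDerivAt_normSq' (z : ℂ) :
    HasFDerivAt (fun z : ℂ => normSq z) ((2 * z.re) • reCLM + (2 * z.im) • imCLM) z := by
  have : (fun z : ℂ => normSq z) = fun z => reCLM z * reCLM z + imCLM z * imCLM z := by
    ext z; simp [normSq_apply]
  rw [this]
  refine ((reCLM.hasFDerivAt.mul reCLM.hasFDerivAt).add
    (imCLM.hasFDerivAt.mul imCLM.hasFDerivAt)).congr_fderiv ?_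
  ext h; simp; ring

lemma radial_hasFDerivAt {k : ℝ → ℝ} {k' : ℝ} {z : ℂ} (h : HasDerivAt k k' (normSq z)) :
    HasFDerivAt (fun z : ℂ => k (normSq z)) (k' • ((2 * z.re) • reCLM + (2 * z.im) • imCLM)) z :=
  HasDerivAt.comp_hasFDerivAt (h₂ := k) z h (hasFDerivAt_normSq' z)

lemma radial_fderiv {k : ℝ → ℝ} {k' : ℝ} {z : ℂ} (h : HasDerivAt k k' (normSq z)) (v : ℂ) :
    fderiv ℝ (fun z : ℂ => k (normSq z)) z v = 2 * k' * dot2 z v := by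
  rw [(radial_hasFDerivAt h).fderiv]; simp [dot2]; ring

lemma radial_hcs {k : ℝ → ℝ} {r : ℝ} (hk : ∀ t, r < t → k t = 0) :
    HasCompactSupport (fun z : ℂ => k (normSq z)) := by
  refine HasCompactSupport.intro (isCompact_closedBall 0 (Real.sqrt r)) (fun z hz => hk _ ?_)
  have : Real.sqrt r < ‖z‖ := by simpa using hz
  rw [normSq_eq_norm_sq]
  rw [Real.sqrt_lt' (lt_of_le_of_lt (Real.sqrt_nonneg r) this)] at this
  exact this

lemma intg {m B c : ℂ → ℝ} (hm : Measurable m) (hB : Continuous B) (hmB : ∀ z, |m z| ≤ B z)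
    (hc : Continuous c) (hs : HasCompactSupport c) : Integrable (fun z => m z * c z) := by
  have h1 : Integrable (fun z => B z * |c z|) :=
    (hB.mul hc.abs).integrable_of_hasCompactSupport (hs.norm.mul_left)
  refine h1.mono' (hm.mul hc.measurable).aestronglyMeasurable (Eventually.of_forall fun z => ?_)
  simp only [norm_mul, Real.norm_eq_abs]
  exact mul_le_mul_of_nonneg_right (hmB z) (abs_nonneg _)

section
variable {L : ℝ≥0} {u : ℂ → ℝ}

noncomputable def chi (u : ℂ → ℝ) (z : ℂ) : ℝ := Set.indicator {w | 0 < u w} (fun _ => (1 : ℝ)) z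

lemma chi_abs (u : ℂ → ℝ) (z : ℂ) : |chi u z| ≤ 1 := by
  unfold chi indicator; split_ifs <;> simp

lemma BSol.chi_meas (h : BSol L u) : Measurable (chi u) :=
  measurable_const.indicator h.isOpen.measurableSet

noncomputable def pu (u : ℂ → ℝ) (z : ℂ) : ℝ := dot2 (grad2 u z) z

lemma pu_meas (u : ℂ → ℝ) : Measurable (pu u) := measurable_dot2 (measurable_grad2 u) measurable_id

lemma BSol.pu_abs (h : BSol L u) (z : ℂ) : |pu u z| ≤ L * ‖z‖ :=
  (abs_dot2_le _ _).trans (by have := norm_grad2_le h.lip z; gcongr)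

lemma BSol.weiss_id (h : BSol L u) {k : ℝ → ℝ} (hk : ContDiff ℝ (⊤ : ℕ∞) k) {r : ℝ}
    (hr : ∀ t, r < t → k t = 0) :
    ∫ z, (4 * (pu u z - u z) ^ 2 * k (normSq z) -
      ((4 * u z ^ 2 + 4 * pu u z ^ 2 - 2 * chi u z * normSq z) *
          (2 * k (normSq z) + normSq z * deriv k (normSq z))
        + 4 * (u z * pu u z) * (3 * normSq z * deriv k (normSq z)
          + normSq z ^ 2 * deriv (deriv k) (normSq z)))) = 0 := by
  have hk1 : ContDiff ℝ (⊤ : ℕ∞) (deriv k) := by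
    have := (contDiff_infty_iff_deriv.1 hk).2; exact this
  have hk2 : ContDiff ℝ (⊤ : ℕ∞) (deriv (deriv k)) := by
    have := (contDiff_infty_iff_deriv.1 hk1).2; exact this
  have r1 : ∀ t, r < t → deriv k t = 0 := by
    intro t ht
    have : k =ᶠ[𝓝 t] fun _ => 0 := by filter_upwards [lt_mem_nhds ht] with s hs using hr s hs
    rw [this.deriv_eq]; simp
  have r2 : ∀ t, r < t → deriv (deriv k) t = 0 := by
    intro t ht
    have : deriv k =ᶠ[𝓝 t] fun _ => 0 := by filter_upwards [lt_mem_nhds ht] with s hs using r1 s hs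
    rw [this.deriv_eq]; simp
  have d0 : ∀ t, HasDerivAt k (deriv k t) t := fun t => (hk.differentiable (by simp) t).hasDerivAt
  have d1 : ∀ t, HasDerivAt (deriv k) (deriv (deriv k) t) t :=
    fun t => (hk1.differentiable (by simp) t).hasDerivAt
  let N := fun t => t * k t
  have hN : ContDiff ℝ (⊤ : ℕ∞) N := contDiff_id.mul hk
  have dN : ∀ t, HasDerivAt N (k t + t * deriv k t) t := fun t => by
    have := (hasDerivAt_id t).mul (d0 t)
    refine this.congr_deriv ?_
    simp
  let M := fun t => 2 * t * k t + 2 * t ^ 2 * deriv k t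
  have hM : ContDiff ℝ (⊤ : ℕ∞) M :=
    ((contDiff_const.mul contDiff_id).mul hk).add ((contDiff_const.mul (contDiff_id.pow 2)).mul hk1)
  have dM : ∀ t, HasDerivAt M (2 * k t + 6 * t * deriv k t + 2 * t ^ 2 * deriv (deriv k) t) t := by
    intro t
    have := ((((hasDerivAt_id t).const_mul 2).mul (d0 t)).add
      ((((hasDerivAt_id t).pow 2).const_mul 2).mul (d1 t)))
    refine this.congr_deriv ?_
    simp; ring
  have hNs : ContDiff ℝ (⊤ : ℕ∞) (fun z : ℂ => N (normSq z)) := hN.comp normSq_cd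
  -- first identity
  have v1 := h.var (fun z => (N (normSq z) : ℂ) * z)
    ((Complex.ofRealCLM.contDiff.comp hNs).mul contDiff_id)
    (((radial_hcs (k := N) (r := r) (fun t ht => by simp [N, hr t ht])).comp_left
      (g := fun t : ℝ => (t : ℂ)) rfl).mul_right)
  have e1 : ∀ z, (‖grad2 u z‖ ^ 2 + Set.indicator {w | 0 < u w} (fun _ => (1 : ℝ)) z) *
      div2 (fun z => (N (normSq z) : ℂ) * z) z
      - 2 * dot2 (grad2 u z) (fderiv ℝ (fun z => (N (normSq z) : ℂ) * z) z (grad2 u z)) =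
      (‖grad2 u z‖ ^ 2 + chi u z) * (4 * normSq z * k (normSq z) + 2 * normSq z ^ 2 * deriv k (normSq z))
      - (4 * pu u z ^ 2 * (k (normSq z) + normSq z * deriv k (normSq z)) +
        2 * ‖grad2 u z‖ ^ 2 * (normSq z * k (normSq z))) := by
    intro z
    have dd : HasFDerivAt (fun z : ℂ => (N (normSq z) : ℂ) * z) _ z :=
      (Complex.ofRealCLM.hasFDerivAt.comp z (radial_hasFDerivAt (dN (normSq z)))).mul (hasFDerivAt_id z)
    rw [div2, dd.fderiv]
    simp only [chi, normsq_eq, pu, dot2]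
    simp [N, normSq_apply]
    ring
  simp_rw [e1] at v1
  -- second
  have v2 := h.energy (ζ := fun z => M (normSq z)) ((hM.comp normSq_cd).of_le (by exact_mod_cast le_top))
    (radial_hcs (r := r) (fun t ht => by simp [M, hr t ht, r1 t ht]))
  have e2 : ∀ z, ‖grad2 u z‖ ^ 2 * M (normSq z) + u z * fderiv ℝ (fun z : ℂ => M (normSq z)) z (grad2 u z)
      = ‖grad2 u z‖ ^ 2 * (2 * normSq z * k (normSq z) + 2 * normSq z ^ 2 * deriv k (normSq z)) +
       2 * (u z * pu u z) * (2 * k (normSq z) + 6 * normSq z * deriv k (normSq z)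
          + 2 * normSq z ^ 2 * deriv (deriv k) (normSq z)) := by
    intro z
    rw [radial_fderiv (dM (normSq z)), dot2_comm, ← pu]
    simp only [M]; ring
  simp_rw [e2] at v2
  -- third
  let X := fun z : ℂ => ((k (normSq z) * u z ^ 2 : ℝ) : ℂ) * z
  have ck : ContDiff ℝ 1 (fun z : ℂ => k (normSq z)) :=
    (hk.comp normSq_cd).of_le (by exact_mod_cast le_top)
  have cku : ContDiff ℝ 1 (fun z : ℂ => k (normSq z) * u z ^ 2) := ck.mul h.sq_contDiff
  have v3 := integral_div2_zero (X := X)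
    ((Complex.ofRealCLM.contDiff.comp cku).mul contDiff_id)
    ((((radial_hcs hr).mul_right).comp_left (g := fun t : ℝ => (t : ℂ)) rfl).mul_right)
  have e3 : ∀ z, div2 X z = u z ^ 2 * (2 * normSq z * deriv k (normSq z) + 2 * k (normSq z)) +
      2 * (u z * pu u z) * k (normSq z) := by
    intro z
    have d3 := (radial_hasFDerivAt (d0 (normSq z))).mul (h.sq_hasFDerivAt z)
    have dd : HasFDerivAt X _ z :=
      (Complex.ofRealCLM.hasFDerivAt.comp z d3).mul (hasFDerivAt_id z)
    rw [div2, dd.fderiv]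
    simp only [pu, dot2, grad2_re, grad2_im]
    have hre : (((u z : ℝ) : ℂ) ^ 2).re = u z ^ 2 := by rw [← Complex.ofReal_pow, Complex.ofReal_re]
    have him : (((u z : ℝ) : ℂ) ^ 2).im = 0 := by rw [← Complex.ofReal_pow, Complex.ofReal_im]
    simp [normSq_apply, hre, him]
    ring
  simp_rw [e3] at v3
  -- integrability
  have q0 : Continuous (fun z : ℂ => normSq z) := continuous_normSq
  have k0 : Continuous (fun z : ℂ => k (normSq z)) := hk.continuous.comp q0
  have k1 : Continuous (fun z : ℂ => deriv k (normSq z)) := hk1.continuous.comp q0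
  have k2 : Continuous (fun z : ℂ => deriv (deriv k) (normSq z)) := hk2.continuous.comp q0
  have s0 : HasCompactSupport (fun z : ℂ => k (normSq z)) := radial_hcs hr
  have s1 : HasCompactSupport (fun z : ℂ => deriv k (normSq z)) := radial_hcs r1
  have s2 : HasCompactSupport (fun z : ℂ => deriv (deriv k) (normSq z)) := radial_hcs r2
  have hu := h.lip.continuous
  have mg : Measurable (fun z => ‖grad2 u z‖ ^ 2) := (measurable_grad2 u).norm.pow_const 2
  have bg : ∀ z, |‖grad2 u z‖ ^ 2| ≤ (L:ℝ) ^ 2 := fun z => by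
    rw [abs_of_nonneg (by positivity)]
    have := norm_grad2_le h.lip z
    gcongr
  have i1 : Integrable (fun z => (‖grad2 u z‖ ^ 2 + chi u z) *
      (4 * normSq z * k (normSq z) + 2 * normSq z ^ 2 * deriv k (normSq z))) := by
    refine intg (B := fun _ => (L:ℝ) ^ 2 + 1) (mg.add h.chi_meas) continuous_const
      (fun z => (abs_add_le _ _).trans (add_le_add (bg z) (chi_abs u z))) (by fun_prop) ?_
    exact s0.mul_left.add s1.mul_left
  have i1b : Integrable (fun z => 4 * pu u z ^ 2 * (k (normSq z) + normSq z * deriv k (normSq z))) := by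
    refine intg (B := fun z => 4 * (L * ‖z‖) ^ 2) (((pu_meas u).pow_const 2).const_mul 4) (by fun_prop)
      (fun z => ?_) (by fun_prop) ?_
    · rw [abs_mul, abs_pow]
      have := h.pu_abs z
      simp only [abs_of_pos (show (0:ℝ) < 4 by norm_num)]
      gcongr
    · exact s0.add s1.mul_left
  have i1c : Integrable (fun z => 2 * ‖grad2 u z‖ ^ 2 * (normSq z * k (normSq z))) := by
    refine intg (B := fun _ => 2 * (L:ℝ) ^ 2) (mg.const_mul 2) continuous_const
      (fun z => ?_) (by fun_prop) s0.mul_left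
    rw [abs_mul, abs_of_pos (show (0:ℝ) < 2 by norm_num)]
    have := bg z
    gcongr
  have i2a : Integrable (fun z => ‖grad2 u z‖ ^ 2 *
      (2 * normSq z * k (normSq z) + 2 * normSq z ^ 2 * deriv k (normSq z))) :=
    intg (B := fun _ => (L:ℝ) ^ 2) mg continuous_const bg (by fun_prop) (s0.mul_left.add s1.mul_left)
  have mup : Measurable (fun z => 2 * (u z * pu u z)) := (hu.measurable.mul (pu_meas u)).const_mul 2
  have bup : ∀ z, |2 * (u z * pu u z)| ≤ 2 * (u z * (L * ‖z‖)) := fun z => by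
    rw [abs_mul, abs_mul, abs_of_pos (show (0:ℝ) < 2 by norm_num), abs_of_nonneg (h.nonneg z)]
    have := h.pu_abs z
    have := h.nonneg z
    gcongr
  have i2b : Integrable (fun z => 2 * (u z * pu u z) * (2 * k (normSq z) + 6 * normSq z * deriv k (normSq z)
          + 2 * normSq z ^ 2 * deriv (deriv k) (normSq z))) :=
    intg (B := fun z => 2 * (u z * (L * ‖z‖))) mup (by fun_prop) bup (by fun_prop)
      ((s0.mul_left.add s1.mul_left).add s2.mul_left)
  have i3a : Integrable (fun z => u z ^ 2 * (2 * normSq z * deriv k (normSq z) + 2 * k (normSq z))) :=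
    intg (B := fun z => u z ^ 2) (hu.measurable.pow_const 2) (by fun_prop)
      (fun z => le_of_eq (abs_of_nonneg (by positivity))) (by fun_prop) (s1.mul_left.add s0.mul_left)
  have i3b : Integrable (fun z => 2 * (u z * pu u z) * k (normSq z)) :=
    intg (B := fun z => 2 * (u z * (L * ‖z‖))) mup (by fun_prop) bup k0 s0
  have I1 := i1.sub (i1b.add i1c)
  have I2 := i2a.add i2b
  have I3 := i3a.add i3b
  have tot := integral_sub (I1.sub I2) (I3.const_mul 2)
  rw [integral_sub' I1 I2, integral_const_mul] at tot
  simp only [Pi.add_apply, Pi.sub_apply] at tot v1 v2 v3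
  rw [v1, v2, v3] at tot
  rw [show (0:ℝ) = 0 - 0 - 2 * 0 by norm_num, ← tot]
  congr 1
  ext z
  ring

end

noncomputable def KK (q : ℝ) : ℝ := 1 - Real.smoothTransition (q - 1)

lemma KK_cd : ContDiff ℝ (⊤ : ℕ∞) KK :=
  contDiff_const.sub (Real.smoothTransition.contDiff.comp (contDiff_id.sub contDiff_const))

lemma KK_one {q : ℝ} (h : q ≤ 1) : KK q = 1 := by
  rw [KK, Real.smoothTransition.zero_of_nonpos (by linarith)]; simp

lemma KK_zero {q : ℝ} (h : 2 ≤ q) : KK q = 0 := by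
  rw [KK, Real.smoothTransition.one_of_one_le (by linarith)]; simp

lemma KK_anti : Antitone KK := by
  intro a b hab
  unfold KK
  have := Real.smoothTransition.monotone (show a - 1 ≤ b - 1 by linarith)
  linarith

lemma KK_d_cd : ContDiff ℝ (⊤ : ℕ∞) (deriv KK) := (contDiff_infty_iff_deriv.1 KK_cd).2
lemma KK_dd_cd : ContDiff ℝ (⊤ : ℕ∞) (deriv (deriv KK)) := (contDiff_infty_iff_deriv.1 KK_d_cd).2

lemma KK_d_zero {q : ℝ} (h : q < 1 ∨ 2 < q) : deriv KK q = 0 := by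
  rcases h with h | h
  · have : KK =ᶠ[𝓝 q] fun _ => 1 := by
      filter_upwards [gt_mem_nhds h] with s hs using KK_one hs.le
    rw [this.deriv_eq]; simp
  · have : KK =ᶠ[𝓝 q] fun _ => 0 := by
      filter_upwards [lt_mem_nhds h] with s hs using KK_zero hs.le
    rw [this.deriv_eq]; simp

lemma KK_dd_zero {q : ℝ} (h : q < 1 ∨ 2 < q) : deriv (deriv KK) q = 0 := by
  rcases h with h | h
  · have : deriv KK =ᶠ[𝓝 q] fun _ => 0 := by
      filter_upwards [gt_mem_nhds h] with s hs using KK_d_zero (.inl hs)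
    rw [this.deriv_eq]; simp
  · have : deriv KK =ᶠ[𝓝 q] fun _ => 0 := by
      filter_upwards [lt_mem_nhds h] with s hs using KK_d_zero (.inr hs)
    rw [this.deriv_eq]; simp

lemma bdd_of_supp {f : ℝ → ℝ} (hf : Continuous f) (h : ∀ q, q < 1 ∨ 2 < q → f q = 0) :
    ∃ C, 0 ≤ C ∧ ∀ t, |f t| ≤ C := by
  obtain ⟨C, hC⟩ := (isCompact_Icc (a := (1:ℝ)) (b := 2)).exists_bound_of_continuousOn hf.continuousOn
  refine ⟨max C 0, le_max_right _ _, fun t => ?_⟩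
  by_cases ht : t ∈ Icc (1:ℝ) 2
  · exact (hC t ht).trans (le_max_left _ _)
  · rw [h t]
    · simp
    · by_contra hh; push Not at hh; exact ht ⟨hh.1, hh.2⟩

lemma KK_bounds : ∃ C, 0 ≤ C ∧ (∀ t, |deriv KK t| ≤ C) ∧ ∀ t, |deriv (deriv KK) t| ≤ C := by
  obtain ⟨C, hC, h1⟩ := bdd_of_supp KK_d_cd.continuous (fun q => KK_d_zero)
  obtain ⟨D, hD, h2⟩ := bdd_of_supp KK_dd_cd.continuous (fun q => KK_dd_zero)
  exact ⟨max C D, le_max_of_le_left hC, fun t => (h1 t).trans (le_max_left _ _),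
    fun t => (h2 t).trans (le_max_right _ _)⟩

noncomputable def Lam (Q q : ℝ) : ℝ := KK (q / Q) - KK q
noncomputable def kq (Q q : ℝ) : ℝ := Lam Q q / q ^ 2

lemma Lam_zero {Q q : ℝ} (hQ : 2 ≤ Q) (h : q ≤ 1) : Lam Q q = 0 := by
  rw [Lam, KK_one h, KK_one]; · simp
  rw [div_le_one (by linarith)]; linarith

lemma Lam_cd (Q : ℝ) : ContDiff ℝ (⊤ : ℕ∞) (Lam Q) :=
  (KK_cd.comp (contDiff_id.div_const Q)).sub KK_cd

lemma kq_cd {Q : ℝ} (hQ : 2 ≤ Q) : ContDiff ℝ (⊤ : ℕ∞) (kq Q) := by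
  rw [contDiff_iff_contDiffAt]
  intro q
  by_cases h : q < 1
  · have : kq Q =ᶠ[𝓝 q] fun _ => 0 := by
      filter_upwards [gt_mem_nhds h] with s hs
      rw [kq, Lam_zero hQ hs.le]; simp
    exact contDiffAt_const.congr_of_eventuallyEq this
  · exact (Lam_cd Q).contDiffAt.div (contDiff_id.pow 2).contDiffAt (by simp; intro h'; linarith)

lemma Lam_eq {Q : ℝ} (hQ : 2 ≤ Q) : Lam Q = fun q => q ^ 2 * kq Q q := by
  ext q
  by_cases h : q = 0
  · subst h; rw [Lam_zero hQ (by norm_num)]; simp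
  · rw [kq]; field_simp

lemma kq_vanish {Q q : ℝ} (hQ : 2 ≤ Q) (h : 2 * Q < q) : kq Q q = 0 := by
  have : 2 ≤ q / Q := by rw [le_div_iff₀ (by linarith)]; linarith
  rw [kq, Lam, KK_zero this, KK_zero (by linarith)]; simp

lemma kq_nonneg {Q q : ℝ} (hQ : 2 ≤ Q) (h : 0 ≤ q) : 0 ≤ kq Q q := by
  rw [kq, Lam]
  have := KK_anti (show q / Q ≤ q from div_le_self h (by linarith))
  exact div_nonneg (by linarith) (by positivity)

lemma kq_mid {Q q : ℝ} (hQ : 2 ≤ Q) (h : 2 ≤ q) (h' : q ≤ Q) : kq Q q = (q ^ 2)⁻¹ := by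
  rw [kq, Lam, KK_zero h, KK_one]; · simp
  rw [div_le_one (by linarith)]; linarith

lemma Lam_d (Q q : ℝ) : HasDerivAt (Lam Q) (deriv KK (q / Q) / Q - deriv KK q) q := by
  have h1 : ∀ t, HasDerivAt KK (deriv KK t) t :=
    fun t => (KK_cd.differentiable (by simp) t).hasDerivAt
  have := ((h1 (q / Q)).comp q ((hasDerivAt_id q).div_const Q)).sub (h1 q)
  refine this.congr_deriv ?_
  ring

lemma Lam_dd (Q q : ℝ) : HasDerivAt (deriv (Lam Q))
    (deriv (deriv KK) (q / Q) / Q / Q - deriv (deriv KK) q) q := by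
  have h1 : ∀ t, HasDerivAt (deriv KK) (deriv (deriv KK) t) t :=
    fun t => (KK_d_cd.differentiable (by simp) t).hasDerivAt
  have e : deriv (Lam Q) = fun q => deriv KK (q / Q) / Q - deriv KK q := by
    ext q; exact (Lam_d Q q).deriv
  rw [e]
  have := (((h1 (q / Q)).comp q ((hasDerivAt_id q).div_const Q)).div_const Q).sub (h1 q)
  refine this.congr_deriv ?_
  ring

lemma kq_d {Q : ℝ} (hQ : 2 ≤ Q) (q : ℝ) :
    2 * q * kq Q q + q ^ 2 * deriv (kq Q) q = deriv KK (q / Q) / Q - deriv KK q := by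
  have d0 : HasDerivAt (kq Q) (deriv (kq Q) q) q := ((kq_cd hQ).differentiable (by simp) q).hasDerivAt
  have h := Lam_d Q q
  rw [Lam_eq hQ] at h
  have := ((hasDerivAt_id q).pow 2).mul d0
  have := this.unique h
  simpa using this

lemma kq_dd {Q : ℝ} (hQ : 2 ≤ Q) (q : ℝ) :
    2 * kq Q q + 4 * q * deriv (kq Q) q + q ^ 2 * deriv (deriv (kq Q)) q
      = deriv (deriv KK) (q / Q) / Q / Q - deriv (deriv KK) q := by
  have d0 : ∀ q, HasDerivAt (kq Q) (deriv (kq Q) q) q :=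
    fun q => ((kq_cd hQ).differentiable (by simp) q).hasDerivAt
  have d1 : HasDerivAt (deriv (kq Q)) (deriv (deriv (kq Q)) q) q :=
    (((contDiff_infty_iff_deriv.1 (kq_cd hQ)).2).differentiable (by simp) q).hasDerivAt
  have h := Lam_dd Q q
  have e : deriv (Lam Q) = fun q => 2 * q * kq Q q + q ^ 2 * deriv (kq Q) q := by
    ext q; rw [(Lam_d Q q).deriv, kq_d hQ]
  rw [e] at h
  have := (((hasDerivAt_id q).const_mul 2).mul (d0 q)).add (((hasDerivAt_id q).pow 2).mul d1)
  have := this.unique h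
  rw [← this]
  simp; ring

/-- pointwise bound -/
lemma rest_bound {Q q a p x L C : ℝ} (hQ : 2 ≤ Q) (hq : 0 ≤ q) (hC : 0 ≤ C)
    (h1 : ∀ t, |deriv KK t| ≤ C) (h2 : ∀ t, |deriv (deriv KK) t| ≤ C)
    (ha : a ^ 2 ≤ L ^ 2 * q) (hp : p ^ 2 ≤ L ^ 2 * q) (hx : |x| ≤ 1) :
    |(4 * a ^ 2 + 4 * p ^ 2 - 2 * x * q) * (2 * kq Q q + q * deriv (kq Q) q)
        + 4 * (a * p) * (3 * q * deriv (kq Q) q + q ^ 2 * deriv (deriv (kq Q)) q)|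
     ≤ (20 * L ^ 2 + 2) * C * (Q⁻¹ * (if q ≤ 2 * Q then 1 else 0) + (if q ≤ 2 then 1 else 0)) := by
  have hQ0 : 0 < Q := by linarith
  rcases hq.eq_or_lt with h0 | h0
  · subst h0
    have : a = 0 := by nlinarith
    have : p = 0 := by nlinarith
    subst_vars
    simp
    positivity
  set A := deriv KK (q / Q) / Q - deriv KK q with hA
  set B := deriv (deriv KK) (q / Q) / Q / Q - deriv (deriv KK) q with hB
  set I := (Q⁻¹ * (if q ≤ 2 * Q then 1 else 0) + (if q ≤ 2 then 1 else 0) : ℝ) with hI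
  have eA : 2 * kq Q q + q * deriv (kq Q) q = A / q := by
    have := kq_d hQ q
    field_simp
    linarith
  have eB : 3 * q * deriv (kq Q) q + q ^ 2 * deriv (deriv (kq Q)) q = B - A / q := by
    have := kq_dd hQ q
    rw [← eA]; linarith
  have bA : |A| ≤ C * I := by
    have t1 : |deriv KK (q / Q) / Q| ≤ C * (Q⁻¹ * (if q ≤ 2 * Q then 1 else 0)) := by
      split_ifs with h
      · rw [abs_div, abs_of_pos hQ0, mul_one, div_eq_mul_inv]
        have := h1 (q / Q); gcongr
      · rw [KK_d_zero]; · simp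
        right; rw [lt_div_iff₀ hQ0]; linarith
    have t2 : |deriv KK q| ≤ C * (if q ≤ 2 then 1 else 0) := by
      split_ifs with h
      · simpa using h1 q
      · rw [KK_d_zero]; · simp
        right; linarith
    rw [hI, mul_add]
    exact (abs_sub _ _).trans (add_le_add t1 t2)
  have bB : q * |B| ≤ 2 * C * I := by
    have t1 : q * |deriv (deriv KK) (q / Q) / Q / Q| ≤ 2 * C * (Q⁻¹ * (if q ≤ 2 * Q then 1 else 0)) := by
      split_ifs with h
      · rw [abs_div, abs_div, abs_of_pos hQ0, mul_one]
        have := h2 (q / Q)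
        have : |deriv (deriv KK) (q / Q)| / Q / Q ≤ C / Q / Q := by gcongr
        calc _ ≤ (2 * Q) * (C / Q / Q) := by gcongr
          _ = _ := by field_simp
      · rw [KK_dd_zero]; · simp
        right; rw [lt_div_iff₀ hQ0]; linarith
    have t2 : q * |deriv (deriv KK) q| ≤ 2 * C * (if q ≤ 2 then 1 else 0) := by
      split_ifs with h
      · have := h2 q
        rw [mul_one]; gcongr
      · rw [KK_dd_zero]; · simp
        right; linarith
    rw [hI, mul_add]
    have := abs_sub (deriv (deriv KK) (q / Q) / Q / Q) (deriv (deriv KK) q)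
    calc _ ≤ q * (|deriv (deriv KK) (q / Q) / Q / Q| + |deriv (deriv KK) q|) := by gcongr
      _ ≤ _ := by rw [mul_add]; exact add_le_add t1 t2
  have hap : |a * p| ≤ L ^ 2 * q := by
    rw [abs_le]; constructor <;> nlinarith [sq_nonneg (a - p), sq_nonneg (a + p)]
  rw [eA, eB]
  have x1 : |4 * a ^ 2 + 4 * p ^ 2 - 2 * x * q| ≤ (8 * L ^ 2 + 2) * q := by
    rw [abs_le] at hx ⊢
    constructor <;> nlinarith [sq_nonneg a, sq_nonneg p]
  have x2 : |(4 * a ^ 2 + 4 * p ^ 2 - 2 * x * q) * (A / q)| ≤ (8 * L ^ 2 + 2) * |A| := by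
    rw [abs_mul, abs_div, abs_of_pos h0]
    calc _ ≤ (8 * L ^ 2 + 2) * q * (|A| / q) := by gcongr
      _ = _ := by field_simp
  have x3 : |4 * (a * p) * (B - A / q)| ≤ 4 * L ^ 2 * (q * |B| + |A|) := by
    rw [abs_mul, abs_mul, abs_of_pos (show (0:ℝ) < 4 by norm_num)]
    have := abs_sub B (A / q)
    rw [abs_div, abs_of_pos h0] at this
    calc _ ≤ 4 * (L ^ 2 * q) * (|B| + |A| / q) := by gcongr
      _ = _ := by field_simp
  calc _ ≤ _ := abs_add_le _ _
    _ ≤ (8 * L ^ 2 + 2) * |A| + 4 * L ^ 2 * (q * |B| + |A|) := add_le_add x2 x3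
    _ ≤ (8 * L ^ 2 + 2) * (C * I) + 4 * L ^ 2 * (2 * C * I + C * I) := by gcongr
    _ = _ := by ring

section
variable {L : ℝ≥0} {u : ℂ → ℝ}

lemma ball_ind_int {t : ℝ} (ht : 0 ≤ t) :
    Integrable (fun z : ℂ => if normSq z ≤ t then (1:ℝ) else 0) ∧
    ∫ z : ℂ, (if normSq z ≤ t then (1:ℝ) else 0) = Real.pi * t := by
  have e : (fun z : ℂ => if normSq z ≤ t then (1:ℝ) else 0) =
      (closedBall (0:ℂ) (√t)).indicator (fun _ => 1) := by
    ext z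
    have : normSq z ≤ t ↔ z ∈ closedBall (0:ℂ) (√t) := by
      rw [mem_closedBall_zero_iff, Real.le_sqrt (norm_nonneg _) ht, normSq_eq_norm_sq]
    simp only [this, indicator]
  rw [e]
  constructor
  · rw [integrable_indicator_iff measurableSet_closedBall]
    exact integrableOn_const (measure_closedBall_lt_top.ne)
  · rw [integral_indicator measurableSet_closedBall, setIntegral_const, measureReal_def,
      Complex.volume_closedBall]
    simp [← ENNReal.ofReal_pow, Real.sq_sqrt ht, mul_comm, ENNReal.toReal_ofReal ht]

lemma BSol.u_sq (h : BSol L u) (h0 : u 0 = 0) (z : ℂ) : u z ^ 2 ≤ (L:ℝ) ^ 2 * normSq z := by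
  have := h.lip.dist_le_mul z 0
  rw [h0, Real.dist_eq, sub_zero, dist_zero_right] at this
  rw [normSq_eq_norm_sq, ← mul_pow, ← sq_abs]
  gcongr

lemma BSol.pu_sq (h : BSol L u) (z : ℂ) : pu u z ^ 2 ≤ (L:ℝ) ^ 2 * normSq z := by
  have := h.pu_abs z
  rw [normSq_eq_norm_sq, ← mul_pow, ← sq_abs]
  gcongr

lemma BSol.weiss_bound (h : BSol L u) (h0 : u 0 = 0) : ∃ D, ∀ Q, 2 ≤ Q →
    ∫ z in {z : ℂ | 2 ≤ normSq z ∧ normSq z ≤ Q}, (normSq z ^ 2)⁻¹ * (pu u z - u z) ^ 2 ≤ D := by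
  obtain ⟨C, hC, h1, h2⟩ := KK_bounds
  refine ⟨(20 * (L:ℝ) ^ 2 + 2) * C * (4 * Real.pi) / 4, fun Q hQ => ?_⟩
  have hid := h.weiss_id (kq_cd hQ) (r := 2 * Q) (fun t ht => kq_vanish hQ ht)
  set F := fun z : ℂ => 4 * (pu u z - u z) ^ 2 * kq Q (normSq z) with hF
  set G := fun z : ℂ => (4 * u z ^ 2 + 4 * pu u z ^ 2 - 2 * chi u z * normSq z) *
          (2 * kq Q (normSq z) + normSq z * deriv (kq Q) (normSq z))
        + 4 * (u z * pu u z) * (3 * normSq z * deriv (kq Q) (normSq z)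
          + normSq z ^ 2 * deriv (deriv (kq Q)) (normSq z)) with hG
  set B := fun z : ℂ => (20 * (L:ℝ) ^ 2 + 2) * C * (Q⁻¹ * (if normSq z ≤ 2 * Q then 1 else 0)
    + (if normSq z ≤ 2 then 1 else 0)) with hB
  have hGB : ∀ z, |G z| ≤ B z := fun z =>
    rest_bound hQ (normSq_nonneg z) hC h1 h2 (h.u_sq h0 z) (h.pu_sq z) (chi_abs u z)
  have hu := h.lip.continuous
  obtain ⟨iB1, eB1⟩ := ball_ind_int (t := 2 * Q) (by linarith)
  obtain ⟨iB2, eB2⟩ := ball_ind_int (t := 2) (by linarith)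
  have iB : Integrable B := ((iB1.const_mul _).add iB2).const_mul _
  have eB : ∫ z, B z = (20 * (L:ℝ) ^ 2 + 2) * C * (4 * Real.pi) := by
    rw [hB]
    rw [integral_const_mul, integral_add (iB1.const_mul _) iB2, integral_const_mul, eB1, eB2]
    field_simp; ring
  have q0 : Continuous (fun z : ℂ => normSq z) := continuous_normSq
  have k0 : Continuous (fun z : ℂ => kq Q (normSq z)) := (kq_cd hQ).continuous.comp q0
  have k1' := (contDiff_infty_iff_deriv.1 (kq_cd hQ)).2
  have k1 : Continuous (fun z : ℂ => deriv (kq Q) (normSq z)) := k1'.continuous.comp q0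
  have k2 : Continuous (fun z : ℂ => deriv (deriv (kq Q)) (normSq z)) :=
    (contDiff_infty_iff_deriv.1 k1').2.continuous.comp q0
  have mG : Measurable G := by
    have := h.chi_meas
    have := pu_meas u
    have := hu.measurable
    have := q0.measurable
    have := k0.measurable
    have := k1.measurable
    have := k2.measurable
    fun_prop
  have iG : Integrable G := iB.mono' mG.aestronglyMeasurable (Eventually.of_forall hGB)
  have iF : Integrable F := by
    refine intg (B := fun z => 4 * (L * ‖z‖ + u z) ^ 2) ?_ (by fun_prop) ?_ k0
      (radial_hcs (fun t ht => kq_vanish hQ ht))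
    · exact (((pu_meas u).sub hu.measurable).pow_const 2).const_mul 4
    · intro z
      rw [abs_mul, abs_of_pos (show (0:ℝ) < 4 by norm_num), abs_pow]
      have := abs_sub (pu u z) (u z)
      have := h.pu_abs z
      have h3 : |u z| = u z := abs_of_nonneg (h.nonneg z)
      have : |pu u z - u z| ≤ L * ‖z‖ + u z := by linarith
      gcongr
  have e1 : ∫ z, F z = ∫ z, G z := by
    have : ∫ z, (F z - G z) = 0 := hid
    rw [integral_sub iF iG] at this
    linarith
  have e2 : ∫ z, F z ≤ ∫ z, B z := by
    rw [e1]
    exact integral_mono iG iB (fun z => (le_abs_self _).trans (hGB z))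
  have mS : MeasurableSet {z : ℂ | 2 ≤ normSq z ∧ normSq z ≤ Q} :=
    (measurableSet_le measurable_const q0.measurable).inter
      (measurableSet_le q0.measurable measurable_const)
  have Fn : ∀ z, 0 ≤ F z := fun z => mul_nonneg (by positivity) (kq_nonneg hQ (normSq_nonneg z))
  have e3 : ∫ z in {z : ℂ | 2 ≤ normSq z ∧ normSq z ≤ Q}, F z ≤ ∫ z, F z :=
    setIntegral_le_integral iF (Eventually.of_forall Fn)
  have e4 : ∫ z in {z : ℂ | 2 ≤ normSq z ∧ normSq z ≤ Q}, F z =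
      4 * ∫ z in {z : ℂ | 2 ≤ normSq z ∧ normSq z ≤ Q}, (normSq z ^ 2)⁻¹ * (pu u z - u z) ^ 2 := by
    rw [← integral_const_mul]
    refine setIntegral_congr_fun mS (fun z hz => ?_)
    simp only [hF]
    rw [kq_mid hQ hz.1 hz.2]; ring
  rw [eB] at e2
  linarith

noncomputable def wq (u : ℂ → ℝ) (z : ℂ) : ℝ := (normSq z ^ 2)⁻¹ * (pu u z - u z) ^ 2

lemma wq_nonneg (u : ℂ → ℝ) (z : ℂ) : 0 ≤ wq u z := by unfold wq; positivity

lemma BSol.wq_meas (h : BSol L u) : Measurable (wq u) :=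
  ((continuous_normSq.measurable.pow_const 2).inv).mul
    (((pu_meas u).sub h.lip.continuous.measurable).pow_const 2)

lemma BSol.weiss_int (h : BSol L u) (h0 : u 0 = 0) :
    IntegrableOn (wq u) {z : ℂ | 2 ≤ normSq z} := by
  obtain ⟨D, hD⟩ := h.weiss_bound h0
  have q0 : Continuous (fun z : ℂ => normSq z) := continuous_normSq
  let μ := volume.restrict {z : ℂ | 2 ≤ normSq z}
  have cov : AECover μ (atTop : Filter ℕ) (fun n : ℕ => {z : ℂ | normSq z ≤ (n:ℝ)}) := by
    refine ⟨Eventually.of_forall fun z => ?_, fun n => measurableSet_le q0.measurable measurable_const⟩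
    filter_upwards [eventually_ge_atTop ⌈normSq z⌉₊] with n hn
    exact (Nat.le_ceil _).trans (by exact_mod_cast hn)
  have mS : MeasurableSet {z : ℂ | 2 ≤ normSq z} := measurableSet_le measurable_const q0.measurable
  have re : ∀ n : ℕ, μ.restrict {z : ℂ | normSq z ≤ (n:ℝ)} =
      volume.restrict {z : ℂ | 2 ≤ normSq z ∧ normSq z ≤ n} := by
    intro n
    rw [Measure.restrict_restrict (measurableSet_le q0.measurable measurable_const), inter_comm]
    rfl
  refine cov.integrable_of_integral_bounded_of_nonneg_ae D (fun n => ?_)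
    (Eventually.of_forall (wq_nonneg u)) ?_
  · rw [IntegrableOn, re]
    have mT : MeasurableSet {z : ℂ | 2 ≤ normSq z ∧ normSq z ≤ (n:ℝ)} :=
      mS.inter (measurableSet_le q0.measurable measurable_const)
    refine Measure.integrableOn_of_bounded (M := 4 * (L:ℝ)^2) ?_ h.wq_meas.aestronglyMeasurable ?_
    · refine ((measure_mono (t := closedBall 0 (√n)) ?_).trans_lt measure_closedBall_lt_top).ne
      intro z hz
      rw [mem_closedBall_zero_iff, Real.le_sqrt (norm_nonneg _) (by positivity), ← normSq_eq_norm_sq]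
      exact hz.2
    · rw [ae_restrict_iff' mT]
      refine Eventually.of_forall fun z hz => ?_
      rw [Real.norm_eq_abs, abs_of_nonneg (wq_nonneg u z), wq]
      have h1 := h.u_sq h0 z
      have h2 := h.pu_sq z
      have hz2 : 2 ≤ normSq z := hz.1
      rw [inv_mul_le_iff₀ (by positivity)]
      have : (pu u z - u z) ^ 2 ≤ 4 * (L:ℝ)^2 * normSq z := by nlinarith [sq_nonneg (pu u z + u z)]
      have h3 : normSq z ≤ normSq z ^ 2 := by nlinarith
      have : 4 * (L:ℝ)^2 * normSq z ≤ 4 * (L:ℝ)^2 * normSq z ^ 2 := by gcongr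
      linarith
  · filter_upwards [eventually_ge_atTop 2] with n hn
    have := hD n (by exact_mod_cast hn)
    rw [re]
    exact this

lemma BSol.weiss_tail (h : BSol L u) (h0 : u 0 = 0) {T : ℕ → ℝ} (hT : Tendsto T atTop atTop) :
    Tendsto (fun j => ∫ z in {z : ℂ | T j ≤ normSq z}, wq u z) atTop (𝓝 0) := by
  have q0 : Continuous (fun z : ℂ => normSq z) := continuous_normSq
  have mS : ∀ t : ℝ, MeasurableSet {z : ℂ | t ≤ normSq z} :=
    fun t => measurableSet_le measurable_const q0.measurable
  have hi := h.weiss_int h0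
  rw [← integrable_indicator_iff (mS 2)] at hi
  have e : ∀ᶠ j in atTop, ∫ z in {z : ℂ | T j ≤ normSq z}, wq u z =
      ∫ z, {z : ℂ | T j ≤ normSq z}.indicator (wq u) z :=
    Eventually.of_forall fun j => (integral_indicator (mS _)).symm
  rw [tendsto_congr' e]
  have : Tendsto (fun j => ∫ z, {z : ℂ | T j ≤ normSq z}.indicator (wq u) z) atTop
      (𝓝 (∫ z : ℂ, (0:ℝ))) := by
    refine tendsto_integral_filter_of_dominated_convergence _
      (Eventually.of_forall fun j => (h.wq_meas.indicator (mS _)).aestronglyMeasurable) ?_ hi ?_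
    · filter_upwards [hT.eventually_ge_atTop 2] with j hj
      refine Eventually.of_forall fun z => ?_
      rw [Real.norm_eq_abs, abs_of_nonneg (indicator_nonneg (fun z _ => wq_nonneg u z) z)]
      refine indicator_le_indicator_of_subset (fun z hz => ?_) (wq_nonneg u) z
      exact hj.trans hz
    · refine Eventually.of_forall fun z => ?_
      refine tendsto_const_nhds.congr' ?_
      filter_upwards [hT.eventually_gt_atTop (normSq z)] with j hj
      rw [indicator_of_notMem]
      simpa using hj
  simpa using this

end

section
variable {L : ℝ≥0} {u : ℂ → ℝ}

noncomputable def sc (R : ℝ) (u : ℂ → ℝ) (z : ℂ) : ℝ := R⁻¹ * u ((R:ℂ) * z)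

lemma grad2_sc {R : ℝ} (hR : 0 < R) (u : ℂ → ℝ) (z : ℂ) : grad2 (sc R u) z = grad2 u (R * z) := by
  have e : fderiv ℝ (sc R u) z = fderiv ℝ u (R * z) := by
    have : sc R u = R⁻¹ • fun z : ℂ => u (R • z) := by
      ext z; simp [sc]
    rw [this, fderiv_const_smul_field, Pi.smul_apply, fderiv_comp_smul, smul_smul, inv_mul_cancel₀ hR.ne', one_smul]
    simp
  simp [grad2, e]

lemma pu_sc {R : ℝ} (hR : 0 < R) (u : ℂ → ℝ) (z : ℂ) : pu (sc R u) z = R⁻¹ * pu u (R * z) := by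
  simp only [pu, grad2_sc hR, dot2]
  simp
  field_simp

lemma BSol.scale (h : BSol L u) {R : ℝ} (hR : 0 < R) : BSol L (sc R u) where
  lip := by
    refine LipschitzWith.of_dist_le_mul fun x y => ?_
    have := h.lip.dist_le_mul (R * x) (R * y)
    rw [Real.dist_eq] at this ⊢
    rw [dist_eq_norm, ← mul_sub, norm_mul, norm_real, Real.norm_eq_abs, abs_of_pos hR] at this
    rw [sc, sc, ← mul_sub, abs_mul, abs_of_pos (inv_pos.2 hR), dist_eq_norm, inv_mul_le_iff₀ hR]
    linarith
  nonneg := fun z => mul_nonneg (inv_pos.2 hR).le (h.nonneg _)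
  c2 := by
    refine ContDiffOn.mul contDiffOn_const (h.c2.comp (t := {z | 0 < u z}) ?_ ?_)
    · exact (contDiff_const.mul contDiff_id).contDiffOn
    · intro z hz
      exact (mul_pos_iff_of_pos_left (inv_pos.2 hR)).1 hz
  var := by
    intro ψ hψ hc
    let Ψ := fun y : ℂ => ψ (R⁻¹ • y)
    have hv := h.var Ψ (hψ.comp (contDiff_const_smul _)) (hc.comp_smul (inv_ne_zero hR.ne'))
    have dΨ : ∀ y, fderiv ℝ Ψ y = R⁻¹ • fderiv ℝ ψ (R⁻¹ • y) := fun y => fderiv_comp_smul _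
    have hcv := Measure.integral_comp_smul volume (fun z => (‖grad2 u z‖ ^ 2 +
      Set.indicator {w | 0 < u w} (fun _ => (1 : ℝ)) z) * div2 Ψ z
      - 2 * dot2 (grad2 u z) (fderiv ℝ Ψ z (grad2 u z))) R
    rw [hv, smul_zero] at hcv
    refine Eq.trans ?_ ((congrArg (fun t => R * t) hcv).trans (mul_zero R))
    rw [← integral_const_mul]
    congr 1
    ext z
    have hz : R • z = (R:ℂ) * z := by simp
    have hz' : R⁻¹ • ((R:ℂ) * z) = z := by rw [← hz, smul_smul, inv_mul_cancel₀ hR.ne', one_smul]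
    have hi : Set.indicator {w | 0 < sc R u w} (fun _ => (1 : ℝ)) z =
        Set.indicator {w | 0 < u w} (fun _ => (1 : ℝ)) (R * z) := by
      simp only [indicator, mem_ofPred_eq, sc, mul_pos_iff_of_pos_left (inv_pos.2 hR)]
    rw [grad2_sc hR, hi, hz]
    simp only [div2, dΨ, hz', dot2]
    simp
    field_simp

lemma BSol.sc_L2 (h : BSol L u) (h0 : u 0 = 0) {R : ℕ → ℝ} (hR : Tendsto R atTop atTop)
    {m M : ℝ} (hm : 0 < m) :
    Tendsto (fun j => ∫ z in {z : ℂ | m ≤ normSq z ∧ normSq z ≤ M},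
      (pu (sc (R j) u) z - sc (R j) u z) ^ 2) atTop (𝓝 0) := by
  have hT : Tendsto (fun j => R j ^ 2 * m) atTop atTop :=
    ((tendsto_pow_atTop (by norm_num)).comp hR).atTop_mul_const hm
  have ht := (h.weiss_tail h0 hT).const_mul (M ^ 2)
  rw [mul_zero] at ht
  have q0 : Continuous (fun z : ℂ => normSq z) := continuous_normSq
  have mS : ∀ t : ℝ, MeasurableSet {z : ℂ | t ≤ normSq z} :=
    fun t => measurableSet_le measurable_const q0.measurable
  have mA : MeasurableSet {z : ℂ | m ≤ normSq z ∧ normSq z ≤ M} :=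
    (mS m).inter (measurableSet_le q0.measurable measurable_const)
  refine tendsto_of_tendsto_of_tendsto_of_le_of_le' tendsto_const_nhds ht
    (Eventually.of_forall fun j => integral_nonneg fun z => by positivity) ?_
  have hi := h.weiss_int h0
  filter_upwards [hR.eventually_gt_atTop 0, hT.eventually_ge_atTop 2] with j hj hj2
  have hii : IntegrableOn (wq u) {z : ℂ | R j ^ 2 * m ≤ normSq z} :=
    hi.mono_set fun z hz => le_trans hj2 hz
  rw [← integrable_indicator_iff (mS _)] at hii
  set g := {z : ℂ | R j ^ 2 * m ≤ normSq z}.indicator (wq u) with hg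
  have hgn : ∀ z, 0 ≤ g z := indicator_nonneg (fun z _ => wq_nonneg u z)
  have hcv := Measure.integral_comp_smul volume g (R j)
  have hic : Integrable (fun z => g (R j • z)) := hii.comp_smul hj.ne'
  rw [← integral_indicator (mS _), ← integral_indicator mA]
  have hcv' : ∫ z, g z = R j ^ 2 * ∫ z, g (R j • z) := by
    rw [hcv]
    simp only [Complex.finrank_real_complex, smul_eq_mul]
    rw [abs_of_pos (by positivity)]
    field_simp
  rw [hcv', ← mul_assoc, ← integral_const_mul]
  refine integral_mono_of_nonneg (Eventually.of_forall fun z => ?_) (hic.const_mul _)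
    (Eventually.of_forall fun z => ?_)
  · exact indicator_nonneg (fun z _ => by positivity) z
  · simp only [indicator]
    split_ifs with hz
    · have hz' : R j • z = (R j:ℂ) * z := by simp
      have hn : normSq (R j • z) = R j ^ 2 * normSq z := by
        rw [hz', normSq_mul, normSq_ofReal]; ring
      have hmem : R j • z ∈ {z : ℂ | R j ^ 2 * m ≤ normSq z} := by
        simp only [mem_ofPred_eq, hn]
        have := hz.1
        gcongr
      rw [hg, indicator_of_mem hmem, wq, hn, pu_sc hj, sc, hz', ← mul_sub, mul_pow]
      have h1 : 0 < normSq z := hm.trans_le hz.1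
      have h2 : normSq z ^ 2 ≤ M ^ 2 := by have := hz.2; gcongr
      have e : M ^ 2 * R j ^ 2 * (((R j ^ 2 * normSq z) ^ 2)⁻¹ * (pu u (R j * z) - u (R j * z)) ^ 2)
        = (M ^ 2 / normSq z ^ 2) * ((R j)⁻¹ ^ 2 * (pu u (R j * z) - u (R j * z)) ^ 2) := by
        field_simp
      rw [e]
      have : 1 ≤ M ^ 2 / normSq z ^ 2 := by rw [one_le_div (by positivity)]; exact h2
      exact le_mul_of_one_le_left (by positivity) this
    · have := hgn (R j • z)
      positivity

end

noncomputable def Gc (f : ℂ → ℝ) (z : ℂ) : ℂ := ((fderiv ℝ f z 1 : ℝ) : ℂ) - I * ((fderiv ℝ f z I : ℝ) : ℂ)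

noncomputable def reD : ℂ →L[ℝ] (ℂ →L[ℝ] ℝ) :=
  (ContinuousLinearMap.compL ℝ ℂ ℂ ℝ Complex.reCLM).comp (ContinuousLinearMap.mul ℝ ℂ)

lemma reD_apply (g h : ℂ) : reD g h = (g * h).re := by simp [reD]

lemma reD_inj {g g' : ℂ} (h : reD g = reD g') : g = g' := by
  have h1 := congrArg (fun f => f 1) h
  have h2 := congrArg (fun f => f I) h
  simp [reD_apply] at h1 h2
  exact Complex.ext h1 h2

lemma reD_Gc (f : ℂ → ℝ) (z : ℂ) : reD (Gc f z) = fderiv ℝ f z := by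
  ext h
  rw [reD_apply, clm_eq_dot]
  simp [Gc]; ring

lemma Gc_eq {f : ℂ → ℝ} {z g : ℂ} (h : HasFDerivAt f (reD g) z) : Gc f z = g := by
  apply reD_inj; rw [reD_Gc, h.fderiv]

lemma grad2_Gc (f : ℂ → ℝ) (z : ℂ) : grad2 f z = (starRingEnd ℂ) (Gc f z) := by
  apply Complex.ext <;> simp [grad2, Gc]

lemma grad_est {f : ℂ → ℝ} {z0 : ℂ} {r ε : ℝ} (hr : 0 < r) (hε : 0 < ε)
    (hf : InnerProductSpace.HarmonicOnNhd f (ball z0 r)) (hb : ∀ z ∈ ball z0 r, |f z| ≤ ε) :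
    ‖Gc f z0‖ ≤ 2 * Real.exp 2 * ε / r := by
  obtain ⟨F, hF, hFe⟩ := hf.exists_analyticOnNhd_ball_re_eq
  have hz0 : z0 ∈ ball z0 r := mem_ball_self hr
  have dF : HasDerivAt F (deriv F z0) z0 := (hF z0 hz0).differentiableAt.hasDerivAt
  have dF' : HasFDerivAt (fun z => (F z).re) (reD (deriv F z0)) z0 := by
    have := Complex.reCLM.hasFDerivAt.comp z0 (dF.hasFDerivAt.restrictScalars ℝ)
    refine this.congr_fderiv ?_
    ext h; simp [reD_apply, mul_comm]
  have ev : f =ᶠ[𝓝 z0] fun z => (F z).re :=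
    (hFe.symm).eventuallyEq_of_mem (isOpen_ball.mem_nhds hz0)
  have eG : Gc f z0 = deriv F z0 := Gc_eq (dF'.congr_of_eventuallyEq ev)
  rw [eG]
  let g := fun z => Complex.exp (F z / (ε : ℂ))
  have hgd : DifferentiableOn ℂ g (ball z0 r) := fun z hz =>
    ((hF z hz).differentiableAt.div_const (ε:ℂ)).cexp.differentiableWithinAt
  have hsub : closedBall z0 (r/2) ⊆ ball z0 r := closedBall_subset_ball (by linarith)
  have gn : ∀ z ∈ ball z0 r, ‖g z‖ = Real.exp (f z / ε) := by
    intro z hz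
    simp only [g]
    rw [Complex.norm_exp, Complex.div_ofReal_re]
    congr 2
    exact hFe hz
  have gb : ∀ z ∈ sphere z0 (r/2), ‖g z‖ ≤ Real.exp 1 := by
    intro z hz
    have hz' := hsub (sphere_subset_closedBall hz)
    rw [gn z hz', Real.exp_le_exp, div_le_one hε]
    exact (le_abs_self _).trans (hb z hz')
  have key := Complex.norm_deriv_le_of_forall_mem_sphere_norm_le (by linarith : 0 < r/2)
    (hgd.diffContOnCl_ball hsub) gb
  have dg : HasDerivAt g (g z0 * (deriv F z0 / (ε:ℂ))) z0 := (dF.div_const _).cexp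
  rw [dg.deriv, norm_mul, norm_div, norm_real, Real.norm_eq_abs, abs_of_pos hε, gn z0 hz0] at key
  have lb : Real.exp (-1) ≤ Real.exp (f z0 / ε) := by
    rw [Real.exp_le_exp, le_div_iff₀ hε]
    have := neg_le_of_abs_le (hb z0 hz0)
    linarith
  have key2 : Real.exp (-1) * (‖deriv F z0‖ / ε) ≤ Real.exp 1 / (r / 2) :=
    le_trans (by gcongr) key
  have e2 : Real.exp 2 = Real.exp 1 * Real.exp 1 := by rw [← Real.exp_add]; norm_num
  rw [Real.exp_neg, inv_mul_le_iff₀ (Real.exp_pos 1), div_le_iff₀ hε] at key2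
  calc _ ≤ _ := key2
    _ = _ := by rw [e2]; field_simp

lemma Gc_sub {f g : ℂ → ℝ} {z : ℂ} (hf : DifferentiableAt ℝ f z) (hg : DifferentiableAt ℝ g z) :
    Gc (f - g) z = Gc f z - Gc g z := by
  simp only [Gc, fderiv_sub hf hg]
  simp; ring

lemma harm_conv_aux {f : ℕ → ℂ → ℝ} {w : ℂ → ℝ} {z0 : ℂ} {r : ℝ} (hr : 0 < r)
    (hf : ∀ j, InnerProductSpace.HarmonicOnNhd (f j) (ball z0 (2 * r)))
    (hc : TendstoUniformlyOn f w atTop (ball z0 (2 * r))) :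
    DifferentiableOn ℂ (Gc w) (ball z0 r) ∧ (∀ z ∈ ball z0 r, HasFDerivAt w (reD (Gc w z)) z) ∧
      ∀ z ∈ ball z0 r, Tendsto (fun j => Gc (f j) z) atTop (𝓝 (Gc w z)) := by
  have hsub : ball z0 r ⊆ ball z0 (2 * r) := ball_subset_ball (by linarith)
  have dd : ∀ j, ∀ z ∈ ball z0 (2 * r), DifferentiableAt ℝ (f j) z :=
    fun j z hz => (hf j z hz).1.differentiableAt (by simp)
  have hC : UniformCauchySeqOn (fun j => Gc (f j)) atTop (ball z0 r) := by
    rw [Metric.uniformCauchySeqOn_iff]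
    intro ε hε
    have hcc := Metric.uniformCauchySeqOn_iff.1 hc.uniformCauchySeqOn
    set δ := ε * r / (4 * Real.exp 2) with hδ
    have hδ0 : 0 < δ := by positivity
    obtain ⟨N, hN⟩ := hcc δ hδ0
    refine ⟨N, fun m hm n hn z hz => ?_⟩
    have hs : ball z r ⊆ ball z0 (2 * r) := by
      apply ball_subset_ball'
      rw [mem_ball] at hz; linarith
    have := grad_est (f := f m - f n) (z0 := z) hr hδ0
      (fun y hy => by
        have := (hf m y (hs hy)).add ((hf n y (hs hy)).const_smul (c := (-1:ℝ)))
        rwa [neg_one_smul, ← sub_eq_add_neg] at this)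
      (fun y hy => by
        have := hN m hm n hn y (hs hy)
        rw [Real.dist_eq] at this
        exact this.le)
    rw [Gc_sub (dd m z (hsub hz)) (dd n z (hsub hz))] at this
    rw [dist_eq_norm]
    refine this.trans_lt ?_
    rw [hδ]
    have : 2 * Real.exp 2 * (ε * r / (4 * Real.exp 2)) / r = ε / 2 := by field_simp; norm_num
    rw [this]; linarith
  have hlim : ∀ z, ∃ G, z ∈ ball z0 r → Tendsto (fun j => Gc (f j) z) atTop (𝓝 G) := by
    intro z
    by_cases hz : z ∈ ball z0 r
    · obtain ⟨G, hG⟩ := cauchySeq_tendsto_of_complete (hC.cauchySeq hz)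
      exact ⟨G, fun _ => hG⟩
    · exact ⟨0, fun h => absurd h hz⟩
  choose G hG using hlim
  have hU := hC.tendstoUniformlyOn_of_tendsto (f := G) (fun z hz => hG z hz)
  have hfd : ∀ z ∈ ball z0 r, HasFDerivAt w (reD (G z)) z := by
    intro z hz
    refine hasFDerivAt_of_tendstoUniformlyOn isOpen_ball
      (f := f) (f' := fun j z => reD (Gc (f j) z)) (g' := fun z => reD (G z))
      (reD.uniformContinuous.comp_tendstoUniformlyOn hU) ?_ ?_ hz
    · intro j y hy
      rw [reD_Gc]
      exact (dd j y (hsub hy)).hasFDerivAt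
    · intro y hy
      exact hc.tendsto_at (hsub hy)
  have hGw : ∀ z ∈ ball z0 r, Gc w z = G z := fun z hz => Gc_eq (hfd z hz)
  refine ⟨?_, fun z hz => by rw [hGw z hz]; exact hfd z hz, fun z hz => by rw [hGw z hz]; exact hG z hz⟩
  have : DifferentiableOn ℂ G (ball z0 r) := by
    refine hU.tendstoLocallyUniformlyOn.differentiableOn (Eventually.of_forall fun j => ?_) isOpen_ball
    intro z hz
    exact (HarmonicAt.differentiableAt_complex_partial (hf j z (hsub hz))).differentiableWithinAt
  exact this.congr hGw

lemma harm_conv {f : ℕ → ℂ → ℝ} {w : ℂ → ℝ} {z0 : ℂ} {r : ℝ} (hr : 0 < r)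
    (hf : ∀ᶠ j in atTop, InnerProductSpace.HarmonicOnNhd (f j) (ball z0 (2 * r)))
    (hc : TendstoUniformlyOn f w atTop (ball z0 (2 * r))) :
    DifferentiableOn ℂ (Gc w) (ball z0 r) ∧ (∀ z ∈ ball z0 r, HasFDerivAt w (reD (Gc w z)) z) ∧
      ∀ z ∈ ball z0 r, Tendsto (fun j => Gc (f j) z) atTop (𝓝 (Gc w z)) := by
  obtain ⟨N, hN⟩ := eventually_atTop.1 hf
  have hc' : TendstoUniformlyOn (fun j => f (j + N)) w atTop (ball z0 (2 * r)) := by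
    intro v hv
    exact (tendsto_add_atTop_nat N).eventually (hc v hv)
  obtain ⟨h1, h2, h3⟩ := harm_conv_aux hr (fun j => hN (j + N) (by omega)) hc'
  exact ⟨h1, h2, fun z hz => (tendsto_add_atTop_iff_nat N).1 (h3 z hz)⟩

lemma pu_Gc (f : ℂ → ℝ) (z : ℂ) : pu f z = (Gc f z * z).re := by
  rw [pu, ← fderiv_eq_dot, ← reD_Gc, reD_apply]

structure BD (L : ℝ≥0) (u : ℂ → ℝ) (R : ℕ → ℝ) (w : ℂ → ℝ) : Prop where
  bs : BSol L u
  u0 : u 0 = 0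
  hR : Tendsto R atTop atTop
  conv : TendstoLocallyUniformly (fun j => sc (R j) u) w atTop

section
variable {L : ℝ≥0} {u : ℂ → ℝ} {R : ℕ → ℝ} {w : ℂ → ℝ}

lemma BD.pos (h : BD L u R w) : ∀ᶠ j in atTop, BSol L (sc (R j) u) := by
  filter_upwards [h.hR.eventually_gt_atTop 0] with j hj using h.bs.scale hj

lemma BD.sc0 (h : BD L u R w) (j : ℕ) : sc (R j) u 0 = 0 := by simp [sc, h.u0]

lemma BD.cont (h : BD L u R w) : Continuous w :=
  h.conv.continuous (h.pos.mono fun j hj => hj.lip.continuous).frequently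

lemma BD.tend (h : BD L u R w) (z : ℂ) : Tendsto (fun j => sc (R j) u z) atTop (𝓝 (w z)) :=
  h.conv.tendstoLocallyUniformlyOn.tendsto_at (mem_univ z)

lemma BD.nonneg (h : BD L u R w) (z : ℂ) : 0 ≤ w z :=
  ge_of_tendsto (h.tend z) (h.pos.mono fun j hj => hj.nonneg z)

lemma BD.zero (h : BD L u R w) : w 0 = 0 := by
  refine tendsto_nhds_unique (h.tend 0) ?_
  simp only [h.sc0]
  exact tendsto_const_nhds

lemma BD.unif (h : BD L u R w) (z : ℂ) (r : ℝ) :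
    TendstoUniformlyOn (fun j => sc (R j) u) w atTop (closedBall z r) := by
  have := h.conv.tendstoLocallyUniformlyOn (s := closedBall z r)
  exact (tendstoLocallyUniformlyOn_iff_tendstoUniformlyOn_of_compact (isCompact_closedBall z r)).1 this

/-- near a positive point -/
lemma BD.near (h : BD L u R w) {z0 : ℂ} (hz : 0 < w z0) : ∃ r > 0, r ≤ ‖z0‖ / 4 ∧
    DifferentiableOn ℂ (Gc w) (ball z0 r) ∧ (∀ z ∈ ball z0 r, HasFDerivAt w (reD (Gc w z)) z) ∧
      (∀ z ∈ ball z0 r, Tendsto (fun j => Gc (sc (R j) u) z) atTop (𝓝 (Gc w z))) := by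
  have hz0 : z0 ≠ 0 := by rintro rfl; rw [h.zero] at hz; exact lt_irrefl _ hz
  have hn : 0 < ‖z0‖ := norm_pos_iff.2 hz0
  obtain ⟨s, hs, hsb⟩ := Metric.continuousAt_iff.1 h.cont.continuousAt (w z0 / 2) (by linarith)
  set r := min (s / 3) (‖z0‖ / 4) with hr
  have hr0 : 0 < r := by positivity
  have hrs : 2 * r < s := by have := min_le_left (s / 3) (‖z0‖ / 4); linarith
  refine ⟨r, hr0, min_le_right _ _, ?_⟩
  have hu := (h.unif z0 (2 * r)).mono ball_subset_closedBall
  refine harm_conv hr0 ?_ hu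
  filter_upwards [h.pos, Metric.tendstoUniformlyOn_iff.1 hu (w z0 / 2) (by linarith)] with j hj hj2
  intro z hzz
  apply hj.harmonicAt
  have h1 := hj2 z hzz
  have h2 := hsb (show dist z z0 < s from lt_trans hzz hrs)
  rw [Real.dist_eq, abs_lt] at h1 h2
  linarith

lemma BD.homog (h : BD L u R w) {z0 : ℂ} {r : ℝ} (hr : 0 < r) (hrz : r ≤ ‖z0‖ / 4)
    (hd : DifferentiableOn ℂ (Gc w) (ball z0 r))
    (ht : ∀ z ∈ ball z0 r, Tendsto (fun j => Gc (sc (R j) u) z) atTop (𝓝 (Gc w z))) :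
    ∀ z ∈ ball z0 r, (Gc w z * z).re = w z := by
  have hn : 0 < ‖z0‖ := by linarith
  set m := (‖z0‖ / 2) ^ 2 with hm
  set M := (2 * ‖z0‖) ^ 2 with hM
  have hsub : ball z0 r ⊆ {z : ℂ | m ≤ normSq z ∧ normSq z ≤ M} := by
    intro z hz
    rw [mem_ball, dist_eq_norm] at hz
    have h1 := abs_norm_sub_norm_le z z0
    rw [abs_le] at h1
    constructor <;> rw [normSq_eq_norm_sq] <;> apply pow_le_pow_left₀ <;> linarith [norm_nonneg z]
  have hL2 := h.bs.sc_L2 h.u0 h.hR (m := m) (M := M) (by positivity)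
  have q0 : Continuous (fun z : ℂ => normSq z) := continuous_normSq
  have mA : MeasurableSet {z : ℂ | m ≤ normSq z ∧ normSq z ≤ M} :=
    (measurableSet_le measurable_const q0.measurable).inter
      (measurableSet_le q0.measurable measurable_const)
  have fA : volume {z : ℂ | m ≤ normSq z ∧ normSq z ≤ M} ≠ ⊤ := by
    refine ((measure_mono (t := closedBall 0 (√M)) ?_).trans_lt measure_closedBall_lt_top).ne
    intro z hz
    rw [mem_closedBall_zero_iff, Real.le_sqrt (norm_nonneg _) (by positivity), ← normSq_eq_norm_sq]
    exact hz.2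
  have bb : ∀ j, BSol L (sc (R j) u) → ∀ z ∈ {z : ℂ | m ≤ normSq z ∧ normSq z ≤ M},
      ‖(pu (sc (R j) u) z - sc (R j) u z) ^ 2‖ ≤ 4 * (L:ℝ) ^ 2 * M := by
    intro j hj z hz
    rw [Real.norm_eq_abs, abs_of_nonneg (by positivity)]
    have h1 := hj.u_sq (h.sc0 j) z
    have h2 := hj.pu_sq z
    have h3 : (pu (sc (R j) u) z - sc (R j) u z) ^ 2 ≤ 4 * (L:ℝ)^2 * normSq z := by
      nlinarith [sq_nonneg (pu (sc (R j) u) z + sc (R j) u z)]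
    have := hz.2
    calc _ ≤ _ := h3
      _ ≤ _ := by gcongr
  have mm : ∀ j, BSol L (sc (R j) u) → Measurable (fun z => (pu (sc (R j) u) z - sc (R j) u z) ^ 2) :=
    fun j hj => ((pu_meas _).sub hj.lip.continuous.measurable).pow_const 2
  have t1 : Tendsto (fun j => ∫ z in ball z0 r, (pu (sc (R j) u) z - sc (R j) u z) ^ 2) atTop (𝓝 0) := by
    refine tendsto_of_tendsto_of_tendsto_of_le_of_le' tendsto_const_nhds hL2
      (Eventually.of_forall fun j => integral_nonneg fun z => by positivity) ?_
    filter_upwards [h.pos] with j hj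
    refine setIntegral_mono_set ?_ (Eventually.of_forall fun z => by positivity) hsub.eventuallyLE
    refine Measure.integrableOn_of_bounded fA (mm j hj).aestronglyMeasurable
      (M := 4 * (L:ℝ) ^ 2 * M) ?_
    rw [ae_restrict_iff' mA]
    exact Eventually.of_forall (bb j hj)
  have t2 : Tendsto (fun j => ∫ z in ball z0 r, (pu (sc (R j) u) z - sc (R j) u z) ^ 2) atTop
      (𝓝 (∫ z in ball z0 r, (pu w z - w z) ^ 2)) := by
    refine tendsto_integral_filter_of_dominated_convergence (fun _ => 4 * (L:ℝ) ^ 2 * M)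
      (h.pos.mono fun j hj => (mm j hj).aestronglyMeasurable) ?_
      (integrableOn_const measure_ball_lt_top.ne) ?_
    · filter_upwards [h.pos] with j hj
      rw [ae_restrict_iff' measurableSet_ball]
      exact Eventually.of_forall fun z hz => bb j hj z (hsub hz)
    · rw [ae_restrict_iff' measurableSet_ball]
      refine Eventually.of_forall fun z hz => ?_
      simp only [pu_Gc]
      exact ((Complex.continuous_re.continuousAt.tendsto.comp ((ht z hz).mul_const z)).sub
        (h.tend z)).pow 2
  have e0 := tendsto_nhds_unique t2 t1
  have cw : ContinuousOn (pu w) (ball z0 r) := by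
    have : pu w = fun z => (Gc w z * z).re := by ext z; exact pu_Gc w z
    rw [this]
    exact Complex.continuous_re.comp_continuousOn (hd.continuousOn.mul continuousOn_id)
  have mw : Measurable (fun z => (pu w z - w z) ^ 2) :=
    ((pu_meas _).sub h.cont.measurable).pow_const 2
  have iw : IntegrableOn (fun z => (pu w z - w z) ^ 2) (ball z0 r) := by
    refine Measure.integrableOn_of_bounded measure_ball_lt_top.ne mw.aestronglyMeasurable
      (M := 4 * (L:ℝ) ^ 2 * M) ?_
    rw [ae_restrict_iff' measurableSet_ball]
    refine Eventually.of_forall fun z hz => ?_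
    have : Tendsto (fun j => ‖(pu (sc (R j) u) z - sc (R j) u z) ^ 2‖) atTop
        (𝓝 ‖(pu w z - w z) ^ 2‖) := by
      simp only [pu_Gc]
      exact (((Complex.continuous_re.continuousAt.tendsto.comp ((ht z hz).mul_const z)).sub
        (h.tend z)).pow 2).norm
    exact le_of_tendsto this (h.pos.mono fun j hj => bb j hj z (hsub hz))
  rw [setIntegral_eq_zero_iff_of_nonneg_ae (Eventually.of_forall fun z => by positivity) iw] at e0
  have e1 : pu w =ᵐ[volume.restrict (ball z0 r)] w := by
    filter_upwards [e0] with z hz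
    have : (pu w z - w z) ^ 2 = 0 := hz
    nlinarith
  have := Measure.eqOn_open_of_ae_eq e1 isOpen_ball cw h.cont.continuousOn
  intro z hz
  rw [← pu_Gc]; exact this hz

lemma BD.linear (h : BD L u R w) {z0 : ℂ} (hz : 0 < w z0) : ∃ c : ℂ, ∃ r > 0,
    (∀ z ∈ ball z0 r, w z = (c * z).re) ∧
      (∀ z ∈ ball z0 r, Tendsto (fun j => Gc (sc (R j) u) z) atTop (𝓝 c)) := by
  obtain ⟨r, hr, hrz, hd, hf, ht⟩ := h.near hz
  have hh := h.homog hr hrz hd ht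
  have hcd : ∀ z ∈ ball z0 r, deriv (Gc w) z = 0 := by
    intro z hzz
    have hz0 : z ≠ 0 := by
      rintro rfl
      rw [mem_ball, dist_eq_norm, zero_sub, norm_neg] at hzz
      linarith
    have dG : HasDerivAt (Gc w) (deriv (Gc w) z) z :=
      ((hd z hzz).differentiableAt (isOpen_ball.mem_nhds hzz)).hasDerivAt
    have d1 : HasFDerivAt (fun z => (Gc w z * z).re) (reD (deriv (Gc w) z * z + Gc w z)) z := by
      have := Complex.reCLM.hasFDerivAt.comp z
        ((dG.mul (hasDerivAt_id z)).hasFDerivAt.restrictScalars ℝ)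
      refine this.congr_fderiv ?_
      ext h; simp [reD_apply]; ring
    have ev : w =ᶠ[𝓝 z] fun z => (Gc w z * z).re := by
      filter_upwards [isOpen_ball.mem_nhds hzz] with y hy using (hh y hy).symm
    have d2 := d1.congr_of_eventuallyEq ev
    have := reD_inj (d2.unique (hf z hzz))
    have : deriv (Gc w) z * z = 0 := by linear_combination this
    exact (mul_eq_zero.1 this).resolve_right hz0
  have hconst : ∀ z ∈ ball z0 r, Gc w z = Gc w z0 := by
    intro z hzz
    exact isOpen_ball.is_const_of_deriv_eq_zero (convex_ball z0 r).isPreconnected hd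
      (fun y hy => hcd y hy) hzz (mem_ball_self hr)
  refine ⟨Gc w z0, r, hr, fun z hzz => ?_, fun z hzz => ?_⟩
  · rw [← hh z hzz, hconst z hzz]
  · rw [← hconst z hzz]; exact ht z hzz

lemma lin_unique {c c' z : ℂ} (h : (fun z => (c * z).re) =ᶠ[𝓝 z] fun z => (c' * z).re) : c = c' := by
  have d : ∀ c : ℂ, HasFDerivAt (fun z => (c * z).re) (reD c) z := by
    intro c
    have : (fun z => (c * z).re) = reD c := by ext z; simp [reD_apply]
    rw [this]; exact (reD c).hasFDerivAt
  exact reD_inj (((d c').congr_of_eventuallyEq h).unique (d c)).symm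

lemma BD.half (h : BD L u R w) {z0 : ℂ} (hz : 0 < w z0) : ∃ c : ℂ, 0 < (c * z0).re ∧
    (∀ z, 0 < (c * z).re → w z = (c * z).re) ∧
    (∀ z, 0 < (c * z).re → Tendsto (fun j => Gc (sc (R j) u) z) atTop (𝓝 c)) := by
  obtain ⟨c, r, hr, h1, h2⟩ := h.linear hz
  have hc0 : 0 < (c * z0).re := by rw [← h1 z0 (mem_ball_self hr)]; exact hz
  set A := {z : ℂ | w =ᶠ[𝓝 z] fun z => (c * z).re} with hA
  have oA : IsOpen A := isOpen_iff_mem_nhds.2 fun z hz => hz.eventually_nhds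
  have hcont : Continuous (fun z : ℂ => (c * z).re) := by fun_prop
  have main : {z : ℂ | 0 < (c * z).re} ⊆ A := by
    refine IsPreconnected.subset_of_closure_inter_subset ?_ oA ?_ ?_
    · have : {z : ℂ | 0 < (c * z).re} = (reD c) ⁻¹' Ioi 0 := by ext z; simp [reD_apply]
      rw [this]
      exact ((convex_Ioi (0:ℝ)).linear_preimage (reD c).toLinearMap).isPreconnected
    · refine ⟨z0, hc0, ?_⟩
      filter_upwards [isOpen_ball.mem_nhds (mem_ball_self hr)] with y hy using h1 y hy
    · rintro z ⟨hzA, hzc⟩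
      have hcl : IsClosed {z : ℂ | w z = (c * z).re} := isClosed_eq h.cont hcont
      have hwz : w z = (c * z).re := by
        have : closure A ⊆ {z : ℂ | w z = (c * z).re} :=
          hcl.closure_subset_iff.2 fun y hy => hy.self_of_nhds
        exact this hzA
      obtain ⟨c', r', hr', h1', -⟩ := h.linear (z0 := z) (by rw [hwz]; exact hzc)
      obtain ⟨y, hyA, hy⟩ := mem_closure_iff.1 hzA _ isOpen_ball (mem_ball_self hr')
      have e : c' = c := by
        refine lin_unique (z := y) ?_
        filter_upwards [isOpen_ball.mem_nhds hyA, hy] with x hx1 hx2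
        rw [← h1' x hx1, hx2]
      subst e
      show w =ᶠ[𝓝 z] _
      filter_upwards [isOpen_ball.mem_nhds (mem_ball_self hr')] with x hx using h1' x hx
  refine ⟨c, hc0, fun z hzc => (main hzc).self_of_nhds, fun z hzc => ?_⟩
  obtain ⟨c', r', hr', h1', h2'⟩ := h.linear (z0 := z) (by rw [(main hzc).self_of_nhds]; exact hzc)
  have e : c' = c := by
    refine lin_unique (z := z) ?_
    filter_upwards [isOpen_ball.mem_nhds (mem_ball_self hr'), main hzc] with x hx1 hx2
    rw [← h1' x hx1, hx2]
  rw [← e]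
  exact h2' z (mem_ball_self hr')

lemma neg_mult {k : ℂ} (h : ∀ v : ℂ, 0 < v.re → ¬ 0 < (k * v).re) : k.im = 0 ∧ k.re ≤ 0 := by
  have h1 : k.re ≤ 0 := by simpa using h 1 (by simp)
  refine ⟨?_, h1⟩
  by_contra hi
  have h2 := h (1 + (-(1 - k.re) / k.im : ℝ) * I) (by simp)
  apply h2
  simp
  field_simp
  simp

/-- classification up to constants -/
lemma BD.class (h : BD L u R w) {z0 : ℂ} (hz : 0 < w z0) : ∃ c : ℂ, c ≠ 0 ∧ ∃ k : ℝ, 0 ≤ k ∧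
    (∀ z, w z = max (c * z).re 0 + k * max (-(c * z).re) 0) ∧
    (∀ z, 0 < (c * z).re → Tendsto (fun j => Gc (sc (R j) u) z) atTop (𝓝 c)) ∧
    (0 < k → ∀ z, (c * z).re < 0 → Tendsto (fun j => Gc (sc (R j) u) z) atTop (𝓝 (-k * c))) := by
  obtain ⟨c, hc0, h1, h2⟩ := h.half hz
  have hc : c ≠ 0 := by rintro rfl; simp at hc0
  have other : ∀ z, 0 < w z → ¬ 0 < (c * z).re → ∃ k : ℝ, 0 < k ∧ (c * z).re < 0 ∧
      (∀ y, (c * y).re < 0 → w y = k * -(c * y).re) ∧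
      (∀ y, (c * y).re < 0 → Tendsto (fun j => Gc (sc (R j) u) y) atTop (𝓝 (-k * c))) := by
    intro z hwz hcz
    obtain ⟨c', hc', h1', h2'⟩ := h.half hwz
    have hk := neg_mult (k := c' / c) (fun v hv hkv => by
      have hy : c * (v / c) = v := by field_simp
      have hy' : c' * (v / c) = c' / c * v := by field_simp
      have : c = c' := by
        refine lin_unique (z := v / c) ?_
        have o1 : IsOpen {z : ℂ | 0 < (c * z).re} := isOpen_lt continuous_const (by fun_prop)
        have o2 : IsOpen {z : ℂ | 0 < (c' * z).re} := isOpen_lt continuous_const (by fun_prop)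
        filter_upwards [o1.mem_nhds (show 0 < (c * (v / c)).re by rw [hy]; exact hv),
          o2.mem_nhds (show 0 < (c' * (v / c)).re by rw [hy']; exact hkv)] with x hx1 hx2
        rw [← h1 x hx1, h1' x hx2]
      rw [this] at hcz
      exact hcz hc')
    obtain ⟨k, hkk⟩ : ∃ k : ℝ, c' = (-k : ℝ) * c := by
      refine ⟨-(c' / c).re, ?_⟩
      have : c' / c = ((c' / c).re : ℂ) := by apply Complex.ext <;> simp [hk.1]
      rw [neg_neg, ← this]; field_simp
    have hmul : ∀ y, (c' * y).re = k * -(c * y).re := by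
      intro y
      rw [hkk, mul_assoc, re_ofReal_mul]; ring
    have hk0 : 0 < k := by
      rw [hmul] at hc'
      by_contra hh
      have : 0 ≤ -(c * z).re := by linarith
      nlinarith
    refine ⟨k, hk0, ?_, fun y hy => ?_, fun y hy => ?_⟩
    · rw [hmul] at hc'
      have := pos_of_mul_pos_right hc' hk0.le
      linarith
    · rw [h1' y (by rw [hmul]; nlinarith), hmul]
    · have := h2' y (by rw [hmul]; nlinarith)
      rw [hkk] at this
      simpa using this
  refine ⟨c, hc, ?_⟩
  by_cases hex : ∃ z, 0 < w z ∧ ¬ 0 < (c * z).re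
  · obtain ⟨z1, hz1, hz1'⟩ := hex
    obtain ⟨k, hk, -, h3, h4⟩ := other z1 hz1 hz1'
    refine ⟨k, hk.le, fun z => ?_, h2, fun _ => h4⟩
    rcases lt_trichotomy 0 (c * z).re with hh | hh | hh
    · rw [h1 z hh, max_eq_left hh.le, max_eq_right (by linarith)]; ring
    · rw [← hh]
      simp
      by_contra hne
      obtain ⟨k', hk', hneg, -⟩ := other z (lt_of_le_of_ne (h.nonneg z) (Ne.symm hne)) (by rw [← hh]; simp)
      linarith
    · rw [h3 z hh, max_eq_right hh.le, max_eq_left (by linarith)]; ring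
  · push Not at hex
    refine ⟨0, le_refl _, fun z => ?_, h2, fun hk => absurd hk (lt_irrefl _)⟩
    by_cases hh : 0 < (c * z).re
    · rw [h1 z hh, max_eq_left hh.le]; simp
    · rw [max_eq_right (not_lt.1 hh)]
      simp
      by_contra hne
      exact hh (hex z (lt_of_le_of_ne (h.nonneg z) (Ne.symm hne)))

end

section
variable {L : ℝ≥0} {u : ℂ → ℝ} {R : ℕ → ℝ} {w : ℂ → ℝ}

lemma KK_deriv_nonpos (t : ℝ) : deriv KK t ≤ 0 := KK_anti.deriv_nonpos

lemma KK_deriv_ne : ∃ t, 0 < t ∧ deriv KK t ≠ 0 := by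
  by_contra hh
  push Not at hh
  have : ∀ t, deriv KK t = 0 := by
    intro t
    by_cases ht : 0 < t
    · exact hh t ht
    · exact KK_d_zero (.inl (by linarith))
  have := is_const_of_deriv_eq_zero (KK_cd.differentiable (by simp)) this 1 2
  rw [KK_one le_rfl, KK_zero le_rfl] at this
  norm_num at this

lemma normSq_cast (g : ℂ) : ‖g‖ ^ 2 = normSq g := (normSq_eq_norm_sq g).symm

lemma E_lim {f : ℕ → ℂ → ℝ} (hf : ∀ᶠ j in atTop, BSol L (f j)) {c : ℂ} {k x : ℝ} (hc : c ≠ 0)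
    (hp : ∀ z, 0 < (c * z).re → Tendsto (fun j => Gc (f j) z) atTop (𝓝 c) ∧
      Tendsto (fun j => chi (f j) z) atTop (𝓝 1))
    (hm : ∀ z, (c * z).re < 0 → Tendsto (fun j => Gc (f j) z) atTop (𝓝 (-k * c)) ∧
      Tendsto (fun j => chi (f j) z) atTop (𝓝 x)) :
    1 - normSq c = x - k ^ 2 * normSq c := by
  set e := (starRingEnd ℂ) c with he
  let ψ := fun z : ℂ => ((KK (normSq z) : ℝ) : ℂ) * e
  have dK : ∀ t, HasDerivAt KK (deriv KK t) t := fun t => (KK_cd.differentiable (by simp) t).hasDerivAt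
  have cK : ContDiff ℝ (⊤ : ℕ∞) (fun z : ℂ => KK (normSq z)) := KK_cd.comp normSq_cd
  have sK : HasCompactSupport (fun z : ℂ => KK (normSq z)) := radial_hcs (r := 2) fun t ht => KK_zero ht.le
  have cψ : ContDiff ℝ (⊤ : ℕ∞) ψ := (Complex.ofRealCLM.contDiff.comp cK).mul contDiff_const
  have sψ : HasCompactSupport ψ := (sK.comp_left (g := fun t : ℝ => (t : ℂ)) rfl).mul_right
  let D := fun z : ℂ => deriv KK (normSq z)
  have dψ : ∀ z v, fderiv ℝ ψ z v = ((2 * D z * dot2 z v : ℝ) : ℂ) * e := by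
    intro z v
    have dd : HasFDerivAt ψ _ z :=
      (Complex.ofRealCLM.hasFDerivAt.comp z (radial_hasFDerivAt (dK (normSq z)))).mul_const e
    rw [dd.fderiv]
    simp [D, dot2]
    ring
  have ib : ∀ z, div2 ψ z = 2 * D z * (c * z).re := by
    intro z
    rw [div2, dψ, dψ]
    simp [dot2, he]
    ring
  let F := fun (j : ℕ) (z : ℂ) => (‖grad2 (f j) z‖ ^ 2 + chi (f j) z) * div2 ψ z
      - 2 * dot2 (grad2 (f j) z) (fderiv ℝ ψ z (grad2 (f j) z))
  let Φ := fun (g : ℂ) (y : ℝ) (z : ℂ) => (‖g‖ ^ 2 + y) * (2 * D z * (c * z).re)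
      - 2 * dot2 ((starRingEnd ℂ) g) (((2 * D z * dot2 z ((starRingEnd ℂ) g) : ℝ) : ℂ) * e)
  have hFΦ : ∀ j z, F j z = Φ (Gc (f j) z) (chi (f j) z) z := by
    intro j z
    simp only [F, Φ]
    rw [ib, dψ, grad2_Gc, RCLike.norm_conj]
  have cΦ : ∀ z, Continuous (fun p : ℂ × ℝ => Φ p.1 p.2 z) := by
    intro z
    simp only [Φ, dot2]
    fun_prop
  have vp : ∀ z y, Φ c y z = (y - normSq c) * (2 * D z * (c * z).re) := by
    intro z y
    simp only [Φ, dot2, normSq_cast]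
    simp [he, normSq_apply]; ring
  have vm : ∀ z y, Φ (-k * c) y z = (y - k ^ 2 * normSq c) * (2 * D z * (c * z).re) := by
    intro z y
    simp only [Φ, dot2, normSq_cast]
    simp [he, normSq_apply]; ring
  let J := fun z : ℂ => if 0 < (c * z).re then (1 - normSq c) * (2 * D z * (c * z).re)
    else (x - k ^ 2 * normSq c) * (2 * D z * (c * z).re)
  have nul : volume {z : ℂ | (c * z).re = 0} = 0 := by
    have : {z : ℂ | (c * z).re = 0} = ((reD c).toLinearMap.ker : Set ℂ) := by
      ext z; simp [reD_apply]
    rw [this]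
    apply Measure.addHaar_submodule
    intro htop
    have : (starRingEnd ℂ) c ∈ (reD c).toLinearMap.ker := by rw [htop]; trivial
    rw [LinearMap.mem_ker] at this
    have h2 : (c * (starRingEnd ℂ) c).re = 0 := by rw [← reD_apply]; exact this
    rw [mul_conj, ofReal_re, normSq_eq_zero] at h2
    exact hc h2
  have cD : Continuous D := KK_d_cd.continuous.comp continuous_normSq
  have sD : HasCompactSupport D := radial_hcs (r := 2) fun t ht => KK_d_zero (.inr ht)
  have hlim : Tendsto (fun j => ∫ z, F j z) atTop (𝓝 (∫ z, J z)) := by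
    refine tendsto_integral_filter_of_dominated_convergence
      (fun z => ((L:ℝ) ^ 2 + 1) * (2 * |D z| * (‖c‖ * ‖z‖)) + 2 * (L * (2 * |D z| * (‖z‖ * L) * ‖c‖))) ?_ ?_ ?_ ?_
    · filter_upwards [hf] with j hj
      have h1 := measurable_grad2 (f j)
      have h2 := hj.chi_meas
      have h3 := cD.measurable
      refine Measurable.aestronglyMeasurable ?_
      simp only [F, ib, dψ, dot2]
      fun_prop
    · filter_upwards [hf] with j hj
      refine Eventually.of_forall fun z => ?_
      have h1 := norm_grad2_le hj.lip z
      have h2 := chi_abs (f j) z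
      simp only [F, ib, dψ]
      rw [Real.norm_eq_abs]
      refine (abs_sub _ _).trans (add_le_add ?_ ?_)
      · rw [abs_mul, abs_mul, abs_mul, abs_of_pos (show (0:ℝ) < 2 by norm_num)]
        have h3 : |‖grad2 (f j) z‖ ^ 2 + chi (f j) z| ≤ (L:ℝ) ^ 2 + 1 := by
          refine (abs_add_le _ _).trans (add_le_add ?_ h2)
          rw [abs_of_nonneg (by positivity)]
          gcongr
        have h4 : |(c * z).re| ≤ ‖c‖ * ‖z‖ := by rw [← norm_mul]; exact abs_re_le_norm _
        gcongr
      · rw [abs_mul, abs_of_pos (show (0:ℝ) < 2 by norm_num)]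
        have h5 := abs_dot2_le (grad2 (f j) z) (((2 * D z * dot2 z (grad2 (f j) z) : ℝ) : ℂ) * e)
        have h6 := abs_dot2_le z (grad2 (f j) z)
        rw [norm_mul, norm_real, Real.norm_eq_abs, abs_mul, abs_mul,
          abs_of_pos (show (0:ℝ) < 2 by norm_num), he, RCLike.norm_conj] at h5
        refine mul_le_mul_of_nonneg_left (h5.trans ?_) (by norm_num)
        have h7 : |dot2 z (grad2 (f j) z)| ≤ ‖z‖ * L := h6.trans (by gcongr)
        gcongr
    · have hs : HasCompactSupport fun z => |D z| := sD.norm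
      refine Continuous.integrable_of_hasCompactSupport (by fun_prop) ?_
      refine HasCompactSupport.add ?_ ?_
      · exact (hs.mul_left.mul_right).mul_left
      · exact ((((hs.mul_left).mul_right).mul_right).mul_left).mul_left
    · have : ∀ᵐ z : ℂ, (c * z).re ≠ 0 := by
        rw [ae_iff]; simpa using nul
      filter_upwards [this] with z hz
      simp only [hFΦ]
      rcases lt_or_gt_of_ne hz with hz | hz
      · obtain ⟨a1, a2⟩ := hm z hz
        have := (cΦ z).continuousAt.tendsto.comp (a1.prodMk_nhds a2)
        simp only [vm] at this
        simp only [J, if_neg (not_lt.2 hz.le)]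
        exact this
      · obtain ⟨a1, a2⟩ := hp z hz
        have := (cΦ z).continuousAt.tendsto.comp (a1.prodMk_nhds a2)
        simp only [vp] at this
        simp only [J, if_pos hz]
        exact this
  have hzero : ∫ z, J z = 0 := by
    refine tendsto_nhds_unique hlim (tendsto_const_nhds.congr' ?_)
    filter_upwards [hf] with j hj
    exact (hj.var ψ cψ sψ).symm
  have iE : ∀ A : ℝ, Integrable (fun z : ℂ => A * (2 * D z * (c * z).re)) := fun A =>
    Continuous.integrable_of_hasCompactSupport (by fun_prop) (sD.mul_left.mul_right).mul_left
  have iJ : Integrable J := by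
    have mP : MeasurableSet {z : ℂ | 0 < (c * z).re} := measurableSet_lt measurable_const (by fun_prop)
    exact Integrable.piecewise mP (iE _).integrableOn (iE _).integrableOn
  have hneg : ∫ z, J (-z) = 0 := by rw [integral_neg_eq_self]; exact hzero
  have hsum : ∫ z, (J z + J (-z)) = 0 := by
    rw [integral_add iJ iJ.comp_neg, hzero, hneg, add_zero]
  have hJJ : ∀ z, J z + J (-z) =
      ((x - k ^ 2 * normSq c) - (1 - normSq c)) * (-(2 * D z) * |(c * z).re|) := by
    intro z
    have e1 : D (-z) = D z := by simp [D]
    have e2 : (c * -z).re = -(c * z).re := by simp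
    simp only [J, e1, e2]
    rcases lt_trichotomy 0 (c * z).re with hh | hh | hh
    · rw [if_pos hh, if_neg (by linarith), abs_of_pos hh]; ring
    · rw [← hh]; simp
    · rw [if_neg (by linarith), if_pos (by linarith), abs_of_neg hh]; ring
  simp_rw [hJJ] at hsum
  rw [integral_const_mul, mul_eq_zero] at hsum
  have hpos : 0 < ∫ z, (-(2 * D z) * |(c * z).re|) := by
    obtain ⟨t, ht, htne⟩ := KK_deriv_ne
    have hcn : 0 < ‖c‖ := norm_pos_iff.2 hc
    refine Continuous.integral_pos_of_hasCompactSupport_nonneg_nonzero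
      (x := ((√t / ‖c‖ : ℝ) : ℂ) * e) (by fun_prop) ?_ ?_ ?_
    · exact (sD.mul_left.neg).mul_right
    · intro z
      have := KK_deriv_nonpos (normSq z)
      have h3 : 0 ≤ -(2 * D z) := by simp only [D]; linarith
      exact mul_nonneg h3 (abs_nonneg _)
    · have e1 : normSq (((√t / ‖c‖ : ℝ) : ℂ) * e) = t := by
        rw [normSq_mul, normSq_ofReal, he, normSq_conj, normSq_eq_norm_sq]
        field_simp
        exact Real.sq_sqrt ht.le
      have e2 : (c * (((√t / ‖c‖ : ℝ) : ℂ) * e)).re = √t * ‖c‖ := by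
        rw [mul_left_comm, re_ofReal_mul, he, mul_conj, ofReal_re, normSq_eq_norm_sq]
        field_simp
      simp only [D]
      rw [e1, e2]
      have : √t * ‖c‖ ≠ 0 := by positivity
      simp [htne]
      exact ⟨(Real.sqrt_pos.2 ht).ne', hc⟩
  rcases hsum with h1 | h1
  · linarith
  · linarith

end

def ND (u : ℂ → ℝ) (c : ℝ) : Prop :=
  0 < c ∧ ∀ x ∈ frontier {z | 0 < u z}, ∀ r > 0, ∃ z ∈ ball x r, c * r < u z

lemma posSet_univ (u : ℂ → ℝ) : posSet univ u = {z | 0 < u z} := by ext z; simp [posSet]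

lemma ND.of {u : ℂ → ℝ} {c : ℝ} (hc : 0 < c) (h : Nondegenerate univ u c) : ND u (c / 2) := by
  refine ⟨by positivity, fun x hx r hr => ?_⟩
  have h1 := h x ⟨mem_univ _, by rw [posSet_univ]; exact hx⟩ r hr (subset_univ _)
  have h2 : c / 2 * r < sSup (u '' ball x r) := lt_of_lt_of_le (by nlinarith) h1
  obtain ⟨y, ⟨z, hz, rfl⟩, hy⟩ := exists_lt_of_lt_csSup ((nonempty_ball.2 hr).image u) h2
  exact ⟨z, hz, hy⟩

lemma ND.scale {u : ℂ → ℝ} {c : ℝ} (h : ND u c) {R : ℝ} (hR : 0 < R) : ND (sc R u) c := by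
  refine ⟨h.1, fun x hx r hr => ?_⟩
  let H : ℂ ≃ₜ ℂ := Homeomorph.mulLeft₀ (R:ℂ) (by exact_mod_cast hR.ne')
  have e : {z | 0 < sc R u z} = H ⁻¹' {z | 0 < u z} := by
    ext z
    simp [sc, H, mul_pos_iff_of_pos_left (inv_pos.2 hR)]
  rw [e, ← H.preimage_frontier] at hx
  obtain ⟨y, hy, hyu⟩ := h.2 _ hx (R * r) (by positivity)
  have hRc : (R:ℂ) ≠ 0 := by exact_mod_cast hR.ne'
  have hyy : (R:ℂ) * (y / R) = y := by field_simp
  refine ⟨y / R, ?_, ?_⟩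
  · rw [mem_ball, dist_eq_norm] at hy ⊢
    have : y - H x = R * (y / R - x) := by rw [mul_sub, hyy]; rfl
    rw [this, norm_mul, norm_real, Real.norm_eq_abs, abs_of_pos hR] at hy
    exact lt_of_mul_lt_mul_left hy hR.le
  · rw [sc, hyy, lt_inv_mul_iff₀ hR]
    linarith

section
variable {L : ℝ≥0} {u : ℂ → ℝ} {R : ℕ → ℝ} {w : ℂ → ℝ} {c₀ : ℝ}

lemma BD.nontriv (h : BD L u R w) (hn : ND u c₀) (h0 : (0:ℂ) ∈ frontier {z | 0 < u z}) :
    ∃ z, 0 < w z := by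
  obtain ⟨j, hj, hj2⟩ := ((h.hR.eventually_gt_atTop 0).and
    (Metric.tendstoUniformlyOn_iff.1 (h.unif 0 1) c₀ hn.1)).exists
  obtain ⟨z, hz, hzu⟩ := hn.2 0 h0 (R j) hj
  have hRc : ((R j:ℝ):ℂ) ≠ 0 := by exact_mod_cast hj.ne'
  have hyy : ((R j:ℝ):ℂ) * (z / (R j:ℝ)) = z := by field_simp
  refine ⟨z / (R j : ℝ), ?_⟩
  have h2 := hj2 (z / (R j : ℝ)) (by
    rw [mem_closedBall_zero_iff, norm_div, norm_real, Real.norm_eq_abs, abs_of_pos hj, div_le_one hj]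
    exact (mem_ball_zero_iff.1 hz).le)
  rw [Real.dist_eq, abs_lt, sc, hyy] at h2
  have : c₀ < (R j)⁻¹ * u z := by rw [lt_inv_mul_iff₀ hj]; linarith
  linarith

lemma pre_front {K s : Set ℂ} (hK : IsPreconnected K) (hs : (K ∩ s).Nonempty) (hs' : (K ∩ sᶜ).Nonempty) :
    ∃ x ∈ K, x ∈ frontier s := by
  by_contra hcon
  push Not at hcon
  obtain ⟨b, hb, hbs⟩ := hs
  obtain ⟨a, ha, has⟩ := hs'
  have key : ∀ x ∈ K, x ∈ interior s ∨ x ∈ (closure s)ᶜ := by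
    intro x hx
    by_contra h
    push Not at h
    exact hcon x hx ⟨by simpa using h.2, h.1⟩
  obtain ⟨x, -, hx1, hx2⟩ := hK (interior s) (closure s)ᶜ isOpen_interior isClosed_closure.isOpen_compl
    key ⟨b, hb, (key b hb).resolve_right (fun h => h (subset_closure hbs))⟩
    ⟨a, ha, (key a ha).resolve_left (fun h => has (interior_subset h))⟩
  exact hx2 (subset_closure (interior_subset hx1))

lemma BD.dich (h : BD L u R w) (hn : ND u c₀) {U K : Set ℂ} (hU : IsOpen U) (hw : ∀ z ∈ U, w z = 0)
    (hK : IsCompact K) (hKU : K ⊆ U) (hKc : IsPreconnected K) :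
    ∀ᶠ j in atTop, (∀ y ∈ K, 0 < sc (R j) u y) ∨ (∀ y ∈ K, sc (R j) u y = 0) := by
  obtain ⟨δ, hδ, hsub⟩ := hK.exists_cthickening_subset_open hU hKU
  obtain ⟨M, hM⟩ := (hK.isBounded.cthickening (δ := δ)).subset_closedBall 0
  filter_upwards [h.hR.eventually_gt_atTop 0, Metric.tendstoUniformlyOn_iff.1 (h.unif 0 M) (c₀ * δ)
    (mul_pos hn.1 hδ)] with j hj hj2
  by_contra hcon
  push Not at hcon
  obtain ⟨⟨a, ha, ha0⟩, ⟨b, hb, hb0⟩⟩ := hcon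
  have hbs := h.bs.scale hj
  have hb' : 0 < sc (R j) u b := lt_of_le_of_ne (hbs.nonneg b) (Ne.symm hb0)
  obtain ⟨x, hxK, hxF⟩ := pre_front hKc (s := {z | 0 < sc (R j) u z})
    ⟨b, hb, hb'⟩ ⟨a, ha, not_lt.2 ha0⟩
  obtain ⟨y, hy, hyu⟩ := (hn.scale hj).2 x hxF δ hδ
  have hyT : y ∈ cthickening δ K := mem_cthickening_of_dist_le y x δ K hxK (le_of_lt hy)
  have h1 := hj2 y (hM hyT)
  rw [hw y (hsub hyT), Real.dist_eq, abs_lt] at h1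
  linarith

lemma BD.grad0 (h : BD L u R w) (hn : ND u c₀) {U : Set ℂ} (hU : IsOpen U) (hw : ∀ z ∈ U, w z = 0)
    {z : ℂ} (hz : z ∈ U) : Tendsto (fun j => Gc (sc (R j) u) z) atTop (𝓝 0) := by
  obtain ⟨r, hr, hsub⟩ := Metric.nhds_basis_closedBall.mem_iff.1 (hU.mem_nhds hz)
  rw [Metric.tendsto_nhds]
  intro ε hε
  set ε' := ε * r / (4 * Real.exp 2) with hε'
  have hε0 : 0 < ε' := by positivity
  filter_upwards [h.hR.eventually_gt_atTop 0, Metric.tendstoUniformlyOn_iff.1 (h.unif z r) ε' hε0,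
    h.dich hn hU hw (isCompact_closedBall z r) hsub (convex_closedBall z r).isPreconnected]
    with j hj hj2 hj3
  have hbs := h.bs.scale hj
  rw [dist_zero_right]
  rcases hj3 with hp | hp
  · have := grad_est (f := sc (R j) u) (z0 := z) hr hε0
      (fun y hy => hbs.harmonicAt (hp y (ball_subset_closedBall hy)))
      (fun y hy => by
        have := hj2 y (ball_subset_closedBall hy)
        rw [hw y (hsub (ball_subset_closedBall hy)), Real.dist_eq, zero_sub, abs_neg] at this
        exact this.le)
    refine this.trans_lt ?_
    rw [hε']
    have : 2 * Real.exp 2 * (ε * r / (4 * Real.exp 2)) / r = ε / 2 := by field_simp; norm_num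
    rw [this]; linarith
  · have h1 := grad2_zero hbs.nonneg (hp z (mem_closedBall_self hr.le))
    rw [grad2_Gc, map_eq_zero] at h1
    rw [h1]; simpa using hε

lemma chi_pos {f : ℂ → ℝ} {z : ℂ} (h : 0 < f z) : chi f z = 1 := by
  unfold chi; rw [indicator_of_mem]; exact h

lemma chi_zero {f : ℂ → ℝ} {z : ℂ} (h : f z = 0) : chi f z = 0 := by
  unfold chi; rw [indicator_of_notMem]; simp [h]

lemma BD.chi_tend (h : BD L u R w) {z : ℂ} (hz : 0 < w z) :
    Tendsto (fun j => chi (sc (R j) u) z) atTop (𝓝 1) := by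
  refine tendsto_const_nhds.congr' ?_
  filter_upwards [(h.tend z).eventually (lt_mem_nhds hz)] with j hj
  exact (chi_pos hj).symm

/-- classification of blow-downs -/
lemma BD.main (h : BD L u R w) (hn : ND u c₀) (h0 : (0:ℂ) ∈ frontier {z | 0 < u z}) :
    ∃ c : ℂ, c ≠ 0 ∧ ((∀ z, w z = |(c * z).re|) ∨ (‖c‖ = 1 ∧ ∀ z, w z = max (c * z).re 0)) := by
  obtain ⟨z0, hz0⟩ := h.nontriv hn h0
  obtain ⟨c, hc, k, hk, hw, hp, hm⟩ := h.class hz0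
  refine ⟨c, hc, ?_⟩
  have hnc : 0 < normSq c := normSq_pos.2 hc
  have wp : ∀ z, 0 < (c * z).re → 0 < w z := by
    intro z hz
    rw [hw, max_eq_left hz.le]
    have := le_max_right (-(c * z).re) 0
    positivity
  rcases hk.eq_or_lt with hk0 | hk0
  · -- k = 0
    subst hk0
    right
    set U := {z : ℂ | (c * z).re < 0} with hUdef
    have hU : IsOpen U := isOpen_lt (by fun_prop) continuous_const
    have hwU : ∀ z ∈ U, w z = 0 := by
      intro z hz
      rw [hw, max_eq_right (le_of_lt hz)]; simp
    have hcU : Convex ℝ U := by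
      have : U = (reD c) ⁻¹' Iio 0 := by ext z; simp [reD_apply, hUdef]
      rw [this]
      exact (convex_Iio (0:ℝ)).linear_preimage (reD c).toLinearMap
    set z1 := -(starRingEnd ℂ) c with hz1
    have hz1U : z1 ∈ U := by
      have : (c * z1).re = -normSq c := by rw [hz1, mul_neg, mul_conj, neg_re, ofReal_re]
      show (c * z1).re < 0
      rw [this]; linarith
    have seg : ∀ z ∈ U, ∀ᶠ j in atTop, (0 < sc (R j) u z1 ∧ 0 < sc (R j) u z) ∨
        (sc (R j) u z1 = 0 ∧ sc (R j) u z = 0) := by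
      intro z hz
      have hcomp : IsCompact (segment ℝ z1 z) := by
        rw [segment_eq_image']
        exact isCompact_Icc.image (by fun_prop)
      filter_upwards [h.dich hn hU hwU hcomp (hcU.segment_subset hz1U hz)
        (convex_segment z1 z).isPreconnected] with j hj
      rcases hj with hj | hj
      · exact .inl ⟨hj _ (left_mem_segment ℝ _ _), hj _ (right_mem_segment ℝ _ _)⟩
      · exact .inr ⟨hj _ (left_mem_segment ℝ _ _), hj _ (right_mem_segment ℝ _ _)⟩
    by_cases hfr : ∃ᶠ j in atTop, 0 < sc (R j) u z1
    · exfalso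
      obtain ⟨φ, hφ, hφ2⟩ := extraction_of_frequently_atTop hfr
      have := E_lim (L := L) (f := fun j => sc (R (φ j)) u) (c := c) (k := 0) (x := 1)
        (hφ.tendsto_atTop.eventually h.pos) hc
        (fun z hz => ⟨(hp z hz).comp hφ.tendsto_atTop, (h.chi_tend (wp z hz)).comp hφ.tendsto_atTop⟩)
        (fun z hz => ⟨by
          have := (h.grad0 hn hU hwU hz).comp hφ.tendsto_atTop
          simpa [Function.comp_def] using this, by
          refine tendsto_const_nhds.congr' ?_
          filter_upwards [hφ.tendsto_atTop.eventually (seg z hz)] with j hj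
          rcases hj with hj | hj
          · exact (chi_pos hj.2).symm
          · have := hφ2 j
            rw [hj.1] at this
            exact absurd this (lt_irrefl _)⟩)
      simp at this
      exact hc this
    · rw [not_frequently] at hfr
      have := E_lim (L := L) (f := fun j => sc (R j) u) (c := c) (k := 0) (x := 0)
        h.pos hc
        (fun z hz => ⟨hp z hz, h.chi_tend (wp z hz)⟩)
        (fun z hz => ⟨by simpa using h.grad0 hn hU hwU hz, by
          refine tendsto_const_nhds.congr' ?_
          filter_upwards [seg z hz, hfr] with j hj hj2
          rcases hj with hj | hj
          · exact absurd hj.1 hj2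
          · exact (chi_zero hj.2).symm⟩)
      refine ⟨?_, fun z => by rw [hw]; simp⟩
      have h1 : normSq c = 1 := by linarith
      rw [normSq_eq_norm_sq] at h1
      nlinarith [norm_nonneg c]
  · left
    have wm : ∀ z, (c * z).re < 0 → 0 < w z := by
      intro z hz
      rw [hw, max_eq_right hz.le, max_eq_left (by linarith)]
      nlinarith
    have := E_lim (L := L) (f := fun j => sc (R j) u) (c := c) (k := k) (x := 1)
        h.pos hc
        (fun z hz => ⟨hp z hz, h.chi_tend (wp z hz)⟩)
        (fun z hz => ⟨hm hk0 z hz, h.chi_tend (wm z hz)⟩)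
    have h2 : (k ^ 2 - 1) * normSq c = 0 := by linarith
    have h3 : k ^ 2 - 1 = 0 := (mul_eq_zero.1 h2).resolve_right hnc.ne'
    have hk1 : k = 1 := by nlinarith
    intro z
    rw [hw, hk1]
    rcases le_total 0 (c * z).re with hh | hh
    · rw [max_eq_left hh, max_eq_right (by linarith), abs_of_nonneg hh]; ring
    · rw [max_eq_right hh, max_eq_left (by linarith), abs_of_nonpos hh]; ring

end

lemma circleAvg_eq (w : ℂ → ℝ) (z : ℂ) (r : ℝ) : circleAvg w z r = Real.circleAverage w z r := by
  simp [circleAvg, Real.circleAverage, circleMap]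

lemma circleAvg_lin {w : ℂ → ℝ} {c z : ℂ} {r : ℝ} (hr : 0 < r)
    (h : ∀ x ∈ closedBall z r, w x = (c * x).re) : circleAvg w z r = w z := by
  rw [circleAvg_eq]
  have h1 : Real.circleAverage w z r = Real.circleAverage (fun x => (c * x).re) z r := by
    apply Real.circleAverage_congr_sphere
    intro x hx
    rw [abs_of_pos hr] at hx
    exact h x (sphere_subset_closedBall hx)
  rw [h1, h z (mem_closedBall_self hr.le)]
  have h2 : InnerProductSpace.HarmonicOnNhd (fun x => (c * x).re) (closedBall z |r|) := by
    intro x _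
    have : AnalyticAt ℂ (fun x => c * x) x := by fun_prop
    exact this.harmonicAt_re
  exact h2.circleAverage_eq

lemma tangent {c y x₀ : ℂ} {ρ : ℝ} (hc : c ≠ 0) (hρ : 0 < ρ) (hb : ∀ z ∈ ball y ρ, 0 ≤ (c * z).re)
    (hd : dist x₀ y = ρ) (hx : (c * x₀).re = 0) :
    ∀ a, ‖c‖ * dot2 a ((y - x₀) / (ρ:ℂ)) = (c * a).re := by
  have hnc : 0 < ‖c‖ := norm_pos_iff.2 hc
  have h1 : ρ * ‖c‖ ≤ (c * y).re := by
    have : ∀ t ∈ Ico 0 ρ, t * ‖c‖ ≤ (c * y).re := by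
      intro t ht
      have := hb (y - t / ‖c‖ * (starRingEnd ℂ) c) (by
        rw [mem_ball, dist_eq_norm]
        simp [abs_of_nonneg ht.1, hnc.ne', ht.2])
      have e : c * (y - t / ‖c‖ * (starRingEnd ℂ) c) = c * y - ((t * ‖c‖ : ℝ) : ℂ) := by
        have : c * (starRingEnd ℂ) c = (‖c‖:ℂ) ^ 2 := mul_conj' c
        have hn : (‖c‖:ℂ) ≠ 0 := by exact_mod_cast hnc.ne'
        rw [mul_sub, mul_left_comm, this]; push_cast; field_simp
      rw [e, sub_re, ofReal_re] at this
      linarith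
    by_contra hlt
    push Not at hlt
    have h0 := this 0 ⟨le_rfl, hρ⟩
    set q := (c*y).re / ‖c‖ with hq
    have hq1 : q < ρ := by rw [hq, div_lt_iff₀ hnc]; exact hlt
    have hq0 : 0 ≤ q := by rw [hq]; apply div_nonneg _ hnc.le; simpa using h0
    have := this ((q + ρ)/2) ⟨by linarith, by linarith⟩
    have e : q * ‖c‖ = (c*y).re := by rw [hq]; field_simp
    nlinarith
  set v := (y - x₀) / (ρ:ℂ) with hv
  have hρc : (ρ:ℂ) ≠ 0 := by exact_mod_cast hρ.ne'
  have hnv : ‖v‖ = 1 := by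
    rw [hv, norm_div, norm_real, Real.norm_eq_abs, abs_of_pos hρ, ← dist_eq_norm, dist_comm, hd, div_self hρ.ne']
  have hre : (c * v).re = ‖c * v‖ := by
    apply le_antisymm (re_le_norm _)
    rw [norm_mul, hnv, mul_one]
    have : c * v = ((ρ⁻¹ : ℝ):ℂ) * (c * y - c * x₀) := by rw [hv]; push_cast; field_simp
    rw [this, re_ofReal_mul, sub_re, hx, sub_zero, le_inv_mul_iff₀ hρ]
    exact h1
  have him : c * v = (‖c‖ : ℂ) := by
    have h2 := re_eq_norm.1 hre
    have h3 : (c*v).im = 0 := (Complex.nonneg_iff.1 h2).2.symm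
    apply Complex.ext
    · rw [hre, norm_mul, hnv]; simp
    · simp [h3]
  have hcc : c = ‖c‖ * (starRingEnd ℂ) v := by
    have : v * (starRingEnd ℂ) v = 1 := by rw [mul_conj', hnv]; simp
    rw [← him, mul_assoc, this, mul_one]
  intro a
  have : (c * a).re = ‖c‖ * ((starRingEnd ℂ) v * a).re := by
    rw [← re_ofReal_mul, ← mul_assoc, ← hcc]
  rw [this]
  simp [dot2]; left; ring

lemma hasSlope_of_eq {w : ℂ → ℝ} {x₀ ν : ℂ} {α : ℝ} {R : Set ℂ}
    (h : ∀ x ∈ R, w x = α * max (dot2 (x - x₀) ν) 0) : HasSlopeAt w x₀ ν α R := by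
  refine tendsto_const_nhds.congr' ?_
  filter_upwards [self_mem_nhdsWithin] with x hx
  rw [h x hx]; simp

lemma FB_zero {w : ℂ → ℝ} (hw : Continuous w) (hn : ∀ z, 0 ≤ w z) {x : ℂ} (hx : x ∈ FB univ w) : w x = 0 := by
  have h1 := hx.2
  rw [posSet_univ, (isOpen_lt continuous_const hw).frontier_eq] at h1
  exact le_antisymm (not_lt.1 h1.2) (hn x)

lemma visc_P {w : ℂ → ℝ} {c : ℂ} (hc : ‖c‖ = 1) (hw : ∀ z, w z = max (c * z).re 0) :
    ViscositySolution univ w := by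
  have hc0 : c ≠ 0 := by rw [← norm_pos_iff, hc]; exact one_pos
  have hcont : Continuous w := by
    have : w = fun z => max (c * z).re 0 := funext hw
    rw [this]; fun_prop
  have hnn : ∀ z, 0 ≤ w z := fun z => by rw [hw]; exact le_max_right _ _
  have hpos : ∀ z, z ∈ posSet univ w ↔ 0 < (c * z).re := by
    intro z; rw [posSet_univ]; simp [hw]
  have hlin : ∀ z ∈ posSet univ w, ∀ r : ℝ, 0 < r → closedBall z r ⊆ posSet univ w →
      circleAvg w z r = w z := by
    intro z _ r hr hs
    apply circleAvg_lin hr (c := c)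
    intro x hx
    rw [hw, max_eq_left ((hpos x).1 (hs hx)).le]
  have hFB : ∀ x ∈ FB univ w, (c * x).re = 0 := by
    intro x hx
    have h1 := FB_zero hcont hnn hx
    have h2 : x ∈ closure (posSet univ w) := hx.2.1
    have h3 : closure (posSet univ w) ⊆ {z | 0 ≤ (c * z).re} :=
      closure_minimal (fun z hz => ((hpos z).1 hz).le) (isClosed_le continuous_const (by fun_prop))
    rw [hw] at h1
    exact le_antisymm (h1 ▸ le_max_left _ _) (h3 h2)
  refine ⟨⟨hcont.continuousOn, fun z _ => hnn z, fun z hz r hr hs => (hlin z hz r hr hs).le, ?_⟩,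
    ⟨hcont.continuousOn, fun z _ => hnn z, fun z hz r hr hs => (hlin z hz r hr hs).ge, ?_⟩⟩
  · intro x₀ hx y ρ hρ hb hd
    refine ⟨1, le_rfl, fun C _ => hasSlope_of_eq fun x hx' => ?_⟩
    have := tangent hc0 hρ (fun z hz => ((hpos z).1 (hb hz)).le) hd (hFB _ hx) (x - x₀)
    rw [hc, one_mul] at this
    rw [this, mul_sub, sub_re, hFB _ hx, hw, sub_zero, one_mul]
  · intro x₀ hx y ρ hρ hb hd
    refine ⟨1, le_rfl, fun C _ => hasSlope_of_eq fun x hx' => ?_⟩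
    have := tangent (neg_ne_zero.2 hc0) hρ (fun z hz => by
      have := (hb hz).2
      rw [hw] at this
      rw [neg_mul, neg_re]
      linarith [le_max_left (c * z).re 0]) hd (by rw [neg_mul, neg_re, hFB _ hx, neg_zero]) (x - x₀)
    rw [norm_neg, hc, one_mul, neg_mul, neg_re, mul_sub, sub_re, hFB _ hx, sub_zero] at this
    have e : dot2 (x - x₀) ((x₀ - y) / (ρ:ℂ)) = - dot2 (x - x₀) ((y - x₀) / (ρ:ℂ)) := by
      rw [← neg_sub y x₀, neg_div]; simp only [dot2, neg_re, neg_im]; ring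
    rw [e, this, hw, neg_neg, one_mul]

lemma visc_W {w : ℂ → ℝ} {c : ℂ} (hc0 : c ≠ 0) (hc : ‖c‖ ≤ 1) (hw : ∀ z, w z = |(c * z).re|) :
    ViscositySolution univ w := by
  have hnc : 0 < ‖c‖ := norm_pos_iff.2 hc0
  have hcont : Continuous w := by
    have : w = fun z => |(c * z).re| := funext hw
    rw [this]; fun_prop
  have hnn : ∀ z, 0 ≤ w z := fun z => by rw [hw]; exact abs_nonneg _
  have hpos : ∀ z, z ∈ posSet univ w ↔ (c * z).re ≠ 0 := by
    intro z; rw [posSet_univ]; simp [hw]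
  have side : ∀ K : Set ℂ, IsPreconnected K → K ⊆ posSet univ w →
      ∃ c' : ℂ, (c' = c ∨ c' = -c) ∧ ∀ z ∈ K, 0 < (c' * z).re := by
    intro K hK hs
    by_contra hcon
    push Not at hcon
    obtain ⟨a, ha, ha'⟩ := hcon c (.inl rfl)
    obtain ⟨b, hb, hb'⟩ := hcon (-c) (.inr rfl)
    rw [neg_mul, neg_re] at hb'
    obtain ⟨x, hx, hx'⟩ := hK.intermediate_value ha hb (f := fun z => (c * z).re) (by fun_prop)
      (show (0:ℝ) ∈ _ from ⟨ha', by simpa using hb'⟩)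
    exact (hpos x).1 (hs hx) hx'
  have hw' : ∀ c' : ℂ, (c' = c ∨ c' = -c) → ∀ z, w z = |(c' * z).re| := by
    rintro c' (rfl | rfl) z
    · exact hw z
    · rw [hw, neg_mul, neg_re, abs_neg]
  have hlin : ∀ z ∈ posSet univ w, ∀ r : ℝ, 0 < r → closedBall z r ⊆ posSet univ w →
      circleAvg w z r = w z := by
    intro z _ r hr hs
    obtain ⟨c', h1, h2⟩ := side _ (convex_closedBall z r).isPreconnected hs
    apply circleAvg_lin hr (c := c')
    intro x hx
    rw [hw' c' h1, abs_of_pos (h2 x hx)]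
  refine ⟨⟨hcont.continuousOn, fun z _ => hnn z, fun z hz r hr hs => (hlin z hz r hr hs).le, ?_⟩,
    ⟨hcont.continuousOn, fun z _ => hnn z, fun z hz r hr hs => (hlin z hz r hr hs).ge, ?_⟩⟩
  · intro x₀ hx y ρ hρ hb hd
    obtain ⟨c', h1, h2⟩ := side _ (convex_ball y ρ).isPreconnected hb
    have hn' : ‖c'‖ = ‖c‖ := by rcases h1 with rfl | rfl <;> simp
    have h0 : (c' * x₀).re = 0 := by
      have := FB_zero hcont hnn hx
      rw [hw' c' h1] at this
      exact abs_eq_zero.1 this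
    refine ⟨‖c‖, hc, fun C _ => hasSlope_of_eq fun x hx' => ?_⟩
    have := tangent (norm_pos_iff.1 (hn' ▸ hnc)) hρ (fun z hz => (h2 z hz).le) hd h0 (x - x₀)
    rw [hn', mul_sub, sub_re, h0, sub_zero] at this
    have hxp := h2 x hx'.1
    have : 0 ≤ dot2 (x - x₀) ((y - x₀) / (ρ:ℂ)) := by
      by_contra hcon
      push Not at hcon
      nlinarith
    rw [max_eq_left this, ‹‖c‖ * _ = _›, hw' c' h1, abs_of_pos hxp]
  · intro x₀ hx y ρ hρ hb hd
    exfalso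
    have hz : ∀ z ∈ ball y ρ, (c * z).re = 0 := by
      intro z hz
      have := (hb hz).2
      rw [hw] at this
      exact abs_eq_zero.1 this
    have h0 : (c * x₀).re = 0 := by
      have := FB_zero hcont hnn hx
      rw [hw] at this
      exact abs_eq_zero.1 this
    have h1 := tangent hc0 hρ (fun z hz' => (hz z hz').ge) hd h0 (y - x₀)
    rw [mul_sub, sub_re, h0, hz y (mem_ball_self hρ), sub_zero] at h1
    have h2 : dot2 (y - x₀) ((y - x₀) / (ρ:ℂ)) = ‖y - x₀‖ ^ 2 / ρ := by
      rw [← normSq_eq_norm_sq, normSq_apply]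
      simp only [dot2, div_ofReal_re, div_ofReal_im]; ring
    rw [h2, ← dist_eq_norm, dist_comm, hd] at h1
    have : 0 < ‖c‖ * (ρ ^ 2 / ρ) := by positivity
    linarith

/-- minimum principle -/
lemma min_principle {U : Set ℂ} {g : ℂ → ℝ} (hU : IsOpen U) (hK : IsCompact (closure U))
    (hg : ContinuousOn g (closure U)) (hh : ∀ z ∈ U, InnerProductSpace.HarmonicAt g z)
    (hb : ∀ z ∈ closure U, z ∉ U → 0 ≤ g z) : ∀ z ∈ closure U, 0 ≤ g z := by
  intro z0 hz0
  by_contra hneg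
  push Not at hneg
  obtain ⟨m, hm, hmin⟩ := hK.exists_isMinOn ⟨z0, hz0⟩ hg
  have hmneg : g m < 0 := (hmin hz0).trans_lt hneg
  have hMc : IsCompact (closure U ∩ g ⁻¹' {g m}) :=
    hK.of_isClosed_subset (hg.preimage_isClosed_of_isClosed isClosed_closure isClosed_singleton)
      inter_subset_left
  obtain ⟨x, ⟨hx, hxm⟩, hmax⟩ := hMc.exists_isMaxOn ⟨m, hm, rfl⟩ continuous_re.continuousOn
  have hxm : g x = g m := hxm
  have hxU : x ∈ U := by
    by_contra hcon
    have := hb x hx hcon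
    linarith
  obtain ⟨r, hr, hsub⟩ := Metric.nhds_basis_closedBall.mem_iff.1 (hU.mem_nhds hxU)
  have hav : Real.circleAverage g x r = g x := by
    apply InnerProductSpace.HarmonicOnNhd.circleAverage_eq
    rw [abs_of_pos hr]
    exact fun z hz => hh z (hsub hz)
  have hcont : Continuous (fun θ : ℝ => g (circleMap x r θ)) := by
    rw [← continuousOn_univ]
    refine (hg.mono (hsub.trans subset_closure)).comp (by fun_prop) ?_
    intro θ _
    exact circleMap_mem_closedBall x hr.le θ
  have hge : ∀ θ, g x ≤ g (circleMap x r θ) := fun θ => by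
    rw [hxm]; exact hmin (subset_closure (hsub (circleMap_mem_closedBall x hr.le θ)))
  have hlt : g x < g (circleMap x r 0) := by
    refine lt_of_le_of_ne (hge 0) fun he => ?_
    have h1 : circleMap x r 0 ∈ closure U ∩ g ⁻¹' {g m} :=
      ⟨subset_closure (hsub (circleMap_mem_closedBall x hr.le 0)), by
        show g _ = g m; rw [← he, hxm]⟩
    have h2 : (circleMap x r 0).re ≤ x.re := hmax h1
    simp [circleMap] at h2
    linarith
  have hpi := Real.two_pi_pos
  have hint : 0 < ∫ θ in (0:ℝ)..(2 * Real.pi), (g (circleMap x r θ) - g x) :=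
    intervalIntegral.integral_pos hpi (hcont.sub continuous_const).continuousOn
      (fun θ _ => sub_nonneg.2 (hge θ)) ⟨0, ⟨le_rfl, hpi.le⟩, sub_pos.2 hlt⟩
  rw [intervalIntegral.integral_sub (hcont.intervalIntegrable _ _) (by simp)] at hint
  rw [Real.circleAverage, smul_eq_mul, inv_mul_eq_iff_eq_mul₀ hpi.ne'] at hav
  rw [hav] at hint
  simp at hint

lemma barrier {f : ℂ → ℝ} {y : ℂ} {ρ d κ : ℝ} (hρ : 0 < ρ) (hρd : ρ < d) (hf : Continuous f)
    (hn : ∀ z, 0 ≤ f z) (hh : ∀ z ∈ ball y d, InnerProductSpace.HarmonicAt f z)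
    (hin : ∀ z, dist z y = ρ → κ * Real.log (d / ρ) ≤ f z) :
    ∀ z, ρ ≤ dist z y → dist z y ≤ d → κ * Real.log (d / dist z y) ≤ f z := by
  have hd : 0 < d := hρ.trans hρd
  set U : Set ℂ := {z | ρ < dist z y ∧ dist z y < d} with hUdef
  have hU : IsOpen U := by
    have h1 : Continuous fun z => dist z y := by fun_prop
    exact (isOpen_lt continuous_const h1).inter (isOpen_lt h1 continuous_const)
  set V : Set ℂ := {z | ρ ≤ dist z y ∧ dist z y ≤ d} with hVdef
  have hV : IsClosed V := by
    have h1 : Continuous fun z => dist z y := by fun_prop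
    exact (isClosed_le continuous_const h1).inter (isClosed_le h1 continuous_const)
  have hUV : closure U ⊆ V := closure_minimal (fun z hz => ⟨hz.1.le, hz.2.le⟩) hV
  have hK : IsCompact (closure U) := (isCompact_closedBall y d).of_isClosed_subset isClosed_closure
    (fun z hz => (hUV hz).2)
  have hne : ∀ z ∈ V, z - y ≠ 0 := fun z hz h => by
    have := hz.1
    rw [dist_eq_norm, h, norm_zero] at this
    linarith
  set g : ℂ → ℝ := fun z => f z + κ * (Real.log ‖z - y‖ - Real.log d) with hgdef
  have hg : ContinuousOn g (closure U) := by
    refine hf.continuousOn.add (continuousOn_const.mul (ContinuousOn.sub ?_ continuousOn_const))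
    refine ContinuousOn.log (by fun_prop) fun z hz => norm_ne_zero_iff.2 (hne z (hUV hz))
  have hgv : ∀ z ∈ V, g z = f z - κ * Real.log (d / dist z y) := by
    intro z hz
    rw [Real.log_div hd.ne' (by rw [dist_eq_norm]; exact norm_ne_zero_iff.2 (hne z hz)), dist_eq_norm]
    simp only [hgdef]; ring
  have hbd : ∀ z ∈ V, z ∉ U → 0 ≤ g z := by
    intro z hz hzU
    rw [hgv z hz]
    rcases hz.1.eq_or_lt with h1 | h1
    · have := hin z h1.symm
      rw [← h1]; linarith
    · have h2 : dist z y = d := le_antisymm hz.2 (not_lt.1 fun h => hzU ⟨h1, h⟩)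
      rw [h2, div_self hd.ne', Real.log_one, mul_zero, sub_zero]
      exact hn z
  have hgh : ∀ z ∈ U, InnerProductSpace.HarmonicAt g z := by
    intro z hz
    have h1 : InnerProductSpace.HarmonicAt (fun z : ℂ => Real.log ‖z - y‖) z := by
      have ha : AnalyticAt ℂ (fun z => z - y) z := by fun_prop
      exact ha.harmonicAt_log_norm (hne z ⟨hz.1.le, hz.2.le⟩)
    have h2 := (hh z hz.2).add ((h1.add (InnerProductSpace.harmonicAt_const (-Real.log d))).const_smul (c := κ))
    convert h2 using 1
    funext z
    simp [hgdef]
    ring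
  have key := min_principle hU hK hg hgh (fun z hz => hbd z (hUV hz))
  intro z h1 h2
  have hz : z ∈ V := ⟨h1, h2⟩
  have : 0 ≤ g z := by
    by_cases hzU : z ∈ U
    · exact key z (subset_closure hzU)
    · exact hbd z hz hzU
  rw [hgv z hz] at this
  linarith

lemma slope_contra {u : ℂ → ℝ} (hv : ViscositySupersolution univ u) {y x : ℂ} {d ρ κ : ℝ}
    (hρ : 0 < ρ) (hρd : ρ < d) (hx : x ∈ FB univ u) (hb : ball y d ⊆ posSet univ u) (hd : dist x y = d)
    (hκ : d < κ) (hlow : ∀ z, ρ ≤ dist z y → dist z y ≤ d → κ * Real.log (d / dist z y) ≤ u z) : False := by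
  have hd0 : 0 < d := hρ.trans hρd
  obtain ⟨α, hα, hs⟩ := hv.slope x hx y d hd0 hb hd
  have hs := hs 2 one_lt_two
  unfold HasSlopeAt at hs
  set ν : ℂ := (y - x) / (d:ℂ) with hν
  have hdc : (d:ℂ) ≠ 0 := by exact_mod_cast hd0.ne'
  have hνn : ‖ν‖ = 1 := by
    rw [hν, norm_div, norm_real, Real.norm_eq_abs, abs_of_pos hd0, ← dist_eq_norm, dist_comm, hd, div_self hd0.ne']
  have hyx : y = x + d * ν := by rw [hν]; field_simp; ring
  have hdist : ∀ τ ∈ Ioo 0 (d - ρ), dist (x + τ * ν) y = d - τ := by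
    intro τ hτ
    rw [dist_eq_norm, hyx, show x + τ * ν - (x + d * ν) = ((τ - d : ℝ):ℂ) * ν by push_cast; ring, norm_mul,
      hνn, norm_real, Real.norm_eq_abs, abs_of_neg (by linarith [hτ.2]), mul_one]; ring
  have hev : ∀ᶠ τ in 𝓝[>] (0:ℝ), τ ∈ Ioo 0 (d - ρ) := Ioo_mem_nhdsGT (by linarith)
  have hcurve : Tendsto (fun τ : ℝ => x + τ * ν) (𝓝[>] 0) (𝓝[NontangentialIn (ball y d) x 2] x) := by
    rw [tendsto_nhdsWithin_iff]
    constructor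
    · have : Continuous (fun τ : ℝ => x + τ * ν) := by fun_prop
      have := this.tendsto 0
      simp only [ofReal_zero, zero_mul, add_zero] at this
      exact this.mono_left nhdsWithin_le_nhds
    · filter_upwards [hev] with τ hτ
      have h1 := hdist τ hτ
      refine ⟨by rw [mem_ball, h1]; linarith [hτ.1], ?_⟩
      have h2 : τ ≤ infDist (x + τ * ν) (ball y d)ᶜ := by
        refine (le_infDist ⟨x, by simp [hd]⟩).2 fun z hz => ?_
        have hz : d ≤ dist z y := by simpa using hz
        have := dist_triangle_left z y (x + τ * ν)
        linarith
      have h3 : ‖x + τ * ν - x‖ = τ := by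
        rw [add_sub_cancel_left, norm_mul, hνn, norm_real, Real.norm_eq_abs, abs_of_pos hτ.1, mul_one]
      rw [h3]; linarith [hτ.1]
  have ht := hs.comp hcurve
  have hge : κ / d - 1 ≤ 0 := by
    refine ge_of_tendsto ht ?_
    filter_upwards [hev] with τ hτ
    have h1 := hdist τ hτ
    have h3 : ‖x + τ * ν - x‖ = τ := by
      rw [add_sub_cancel_left, norm_mul, hνn, norm_real, Real.norm_eq_abs, abs_of_pos hτ.1, mul_one]
    have h4 : dot2 (x + τ * ν - x) ν = τ := by
      have : ν.re * ν.re + ν.im * ν.im = 1 := by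
        rw [← normSq_apply, normSq_eq_norm_sq, hνn, one_pow]
      rw [add_sub_cancel_left]
      simp only [dot2, re_ofReal_mul, im_ofReal_mul]
      linear_combination τ * this
    have h5 := hlow (x + τ * ν) (by rw [h1]; linarith [hτ.2]) (by rw [h1]; linarith [hτ.1])
    rw [h1] at h5
    have hτd : 0 < d - τ := by linarith [hτ.2]
    have h6 : τ / d ≤ Real.log (d / (d - τ)) := by
      have := Real.one_sub_inv_le_log_of_pos (x := d / (d - τ)) (by positivity)
      rw [inv_div] at this
      have e : 1 - (d - τ) / d = τ / d := by field_simp; ring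
      linarith
    have h7 : κ * (τ / d) ≤ u (x + τ * ν) := (mul_le_mul_of_nonneg_left h6 (by linarith)).trans h5
    simp only [Function.comp]
    rw [h3, h4, max_eq_left hτ.1.le, le_div_iff₀ hτ.1]
    have : (κ / d - 1) * τ = κ * (τ / d) - τ := by ring
    nlinarith [hτ.1]
  have : 1 < κ / d := by rw [one_lt_div hd0]; exact hκ
  linarith

lemma BD.slope_le {L : ℝ≥0} {u : ℂ → ℝ} {R : ℕ → ℝ} {w : ℂ → ℝ} (h : BD L u R w) {c : ℂ}
    (hw : ∀ z, w z = |(c * z).re|) (hv : ViscositySupersolution univ u) : ‖c‖ ≤ 1 := by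
  by_contra hs
  push Not at hs
  set s := ‖c‖ with hsdef
  have hs0 : 0 < s := by linarith
  obtain ⟨q, hq1, hq2⟩ := exists_between (show s⁻¹ < 1 from inv_lt_one_of_one_lt₀ hs)
  have hq0 : 0 < q := (inv_pos.2 hs0).trans hq1
  have hqs : q⁻¹ < s := inv_lt_of_inv_lt₀ hs0 hq1
  set δ := (1 - q) * (s - q⁻¹) / 2 with hδdef
  have hδ : 0 < δ := by
    have : 0 < (1 - q) * (s - q⁻¹) := mul_pos (by linarith) (by linarith)
    positivity
  obtain ⟨j, hj, hj2⟩ := ((h.hR.eventually_gt_atTop 0).and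
    (Metric.tendstoUniformlyOn_iff.1 (h.unif 0 2) δ hδ)).exists
  set r := R j with hr
  set e : ℂ := (starRingEnd ℂ) c / s with he
  have hsc : (s:ℂ) ≠ 0 := by exact_mod_cast hs0.ne'
  have hce : c * e = s := by
    have : c * (starRingEnd ℂ) c = (s:ℂ) ^ 2 := mul_conj' c
    rw [he, mul_div_assoc', this]; field_simp
  have hen : ‖e‖ = 1 := by
    rw [he, norm_div, norm_real, Real.norm_eq_abs, abs_of_pos hs0, norm_conj, div_self hs0.ne']
  have hrc : (r:ℂ) ≠ 0 := by exact_mod_cast hj.ne'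
  set y : ℂ := r * e with hy
  -- lower bound
  have low : ∀ z, dist z y ≤ r * q → r * (s * (1 - q) - δ) ≤ u z := by
    intro z hz
    set ζ := z / r with hζ
    have hzz : (r:ℂ) * ζ = z := by rw [hζ]; field_simp
    have hζe : ‖ζ - e‖ ≤ q := by
      have : z - y = r * (ζ - e) := by rw [mul_sub, hzz]
      rw [dist_eq_norm, this, norm_mul, norm_real, Real.norm_eq_abs, abs_of_pos hj] at hz
      exact le_of_mul_le_mul_left hz hj
    have h1 := hj2 ζ (by
      rw [mem_closedBall_zero_iff]
      have := norm_add_le (ζ - e) e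
      rw [sub_add_cancel] at this
      linarith)
    rw [Real.dist_eq, abs_lt, sc, hzz, hw] at h1
    have h2 : s * (1 - q) ≤ (c * ζ).re := by
      have e1 : c * ζ = s + c * (ζ - e) := by rw [mul_sub, hce]; ring
      have h3 := (abs_le.1 (abs_re_le_norm (c * (ζ - e)))).1
      rw [norm_mul] at h3
      rw [e1, add_re, ofReal_re]
      nlinarith [mul_le_mul_of_nonneg_left hζe hs0.le]
    have h4 := le_abs_self (c * ζ).re
    have h5 : s * (1 - q) - δ ≤ r⁻¹ * u z := by linarith [h1.2]
    rwa [le_inv_mul_iff₀ hj] at h5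
  have hmain : (1 - q) / q < s * (1 - q) - δ := by
    have : s * (1 - q) - δ - (1 - q) / q = δ := by rw [hδdef]; field_simp; ring
    linarith
  have hm0 : 0 < s * (1 - q) - δ := lt_trans (div_pos (by linarith) hq0) hmain
  have hcu : Continuous u := h.bs.lip.continuous
  -- touching point
  have hZc : IsClosed {z | u z = 0} := isClosed_eq hcu continuous_const
  have hZ0 : (0:ℂ) ∈ {z | u z = 0} := h.u0
  obtain ⟨x, hxZ, hxd⟩ := hZc.exists_infDist_eq_dist ⟨0, hZ0⟩ y
  have hxZ : u x = 0 := hxZ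
  set d := infDist y {z | u z = 0} with hd
  have hdr : d ≤ r := by
    refine (infDist_le_dist_of_mem hZ0).trans ?_
    rw [dist_zero_right, hy, norm_mul, hen, norm_real, Real.norm_eq_abs, abs_of_pos hj, mul_one]
  have hqd : r * q < d := by
    by_contra hcon
    push Not at hcon
    have := low x (by rw [dist_comm, ← hxd]; exact hcon)
    rw [hxZ] at this
    have := mul_pos hj hm0
    linarith
  have hb : ∀ z ∈ ball y d, 0 < u z := by
    intro z hz
    refine lt_of_le_of_ne (h.bs.nonneg z) fun h0 => ?_
    have := infDist_le_dist_of_mem (s := {z | u z = 0}) (x := y) (y := z) h0.symm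
    rw [dist_comm] at this
    exact absurd hz (not_lt.2 this)
  have hρ : 0 < r * q := mul_pos hj hq0
  have hd0 : 0 < d := hρ.trans hqd
  have hb' : ball y d ⊆ posSet univ u := fun z hz => ⟨mem_univ _, hb z hz⟩
  have hxF : x ∈ FB univ u := by
    refine ⟨mem_univ _, ?_, ?_⟩
    · refine closure_mono hb' ?_
      rw [closure_ball y hd0.ne', mem_closedBall, dist_comm, ← hxd]
    · rw [posSet_univ, (isOpen_lt continuous_const hcu).interior_eq]
      simp [hxZ]
  have hlog0 : 0 < Real.log (d / (r * q)) := Real.log_pos (by rw [one_lt_div hρ]; exact hqd)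
  have hlog1 : Real.log (d / (r * q)) ≤ (1 - q) / q := by
    have h1 : Real.log (d / (r * q)) ≤ d / (r * q) - 1 := Real.log_le_sub_one_of_pos (by positivity)
    have h2 : d / (r * q) ≤ q⁻¹ := by
      rw [div_le_iff₀ hρ]; field_simp; exact hdr
    have h3 : (1 - q) / q = q⁻¹ - 1 := by field_simp
    linarith
  set κ := r * (s * (1 - q) - δ) / Real.log (d / (r * q)) with hκ
  refine slope_contra hv hρ hqd hxF hb' (by rw [dist_comm, ← hxd]) (κ := κ) ?_ ?_
  · rw [hκ, lt_div_iff₀ hlog0]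
    calc d * Real.log (d / (r * q)) ≤ r * ((1 - q) / q) := by gcongr
      _ < _ := by gcongr
  · refine barrier hρ hqd hcu h.bs.nonneg (fun z hz => h.bs.harmonicAt (hb z hz)) fun z hz => ?_
    rw [hκ, div_mul_cancel₀ _ hlog0.ne']
    exact low z hz.le

lemma rot_c {c : ℂ} (z : ℂ) : (c * rot (-c.arg) z).re = ‖c‖ * z.re := by
  have h1 : c * Complex.exp (((-c.arg : ℝ):ℂ) * I) = ‖c‖ := by
    conv_lhs => rw [← norm_mul_exp_arg_mul_I c]
    rw [mul_assoc, norm_mul_exp_arg_mul_I, ← Complex.exp_add]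
    simp
  rw [rot, ← mul_assoc, h1, re_ofReal_mul]

/-- characterization of blow-down limits of entire Lipschitz,
non-degenerate variational (and viscosity) solutions. -/
theorem blowdown_classification (u : ℂ → ℝ)
    (hvar : VariationalSolution Set.univ u)
    (hLip : ∃ L : ℝ≥0, LipschitzOnWith L u Set.univ)
    (hnd : ∃ c : ℝ, 0 < c ∧ Nondegenerate Set.univ u c)
    (h0 : (0 : ℂ) ∈ FB Set.univ u)
    (R : ℕ → ℝ) (hR : Filter.Tendsto R atTop atTop)
    (w : ℂ → ℝ)
    (hconv : TendstoLocallyUniformly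
      (fun j z => (R j)⁻¹ * u (((R j : ℝ) : ℂ) * z)) w atTop) :
    (∃ θ : ℝ, w ∘ rot θ = Pfun ∨ ∃ s : ℝ, 0 < s ∧ w ∘ rot θ = Wfun s) ∧
    (ViscositySolution Set.univ u →
      ViscositySolution Set.univ w ∧
      ∃ θ : ℝ, w ∘ rot θ = Pfun ∨ ∃ s : ℝ, 0 < s ∧ s ≤ 1 ∧ w ∘ rot θ = Wfun s) := by
  obtain ⟨L, hL⟩ := hLip
  obtain ⟨c₀, hc₀, hnd⟩ := hnd
  have hbs : BSol L u := BSol.of_var hvar hL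
  have hu0 : u 0 = 0 := FB_zero hbs.lip.continuous hbs.nonneg h0
  have h : BD L u R w := ⟨hbs, hu0, hR, hconv⟩
  have h0' : (0:ℂ) ∈ frontier {z | 0 < u z} := by
    have := h0.2
    rwa [posSet_univ] at this
  obtain ⟨c, hc, hW | ⟨hc1, hP⟩⟩ := h.main (ND.of hc₀ hnd) h0'
  · have hnc : 0 < ‖c‖ := norm_pos_iff.2 hc
    have hrot : w ∘ rot (-c.arg) = Wfun ‖c‖ := by
      funext z
      rw [Function.comp, hW, rot_c, Wfun, abs_mul, abs_of_pos hnc]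
    refine ⟨⟨-c.arg, .inr ⟨‖c‖, hnc, hrot⟩⟩, fun hv => ?_⟩
    have hle := h.slope_le hW hv.1
    exact ⟨visc_W hc hle hW, -c.arg, .inr ⟨‖c‖, hnc, hle, hrot⟩⟩
  · have hrot : w ∘ rot (-c.arg) = Pfun := by
      funext z
      rw [Function.comp, hP, rot_c, Pfun, hc1, one_mul]
    exact ⟨⟨-c.arg, .inl hrot⟩, fun _ => ⟨visc_P hc1 hP, -c.arg, .inl hrot⟩⟩
end

section
/- There is an absolute constant C > 0 such that if 0 < δ < 1/4 and u is a classical solution of the one-phase free boundary problem in the annulus B₁ ∖ closure(B_δ) ⊆ ℝ² satisfying condition (A), then |∇u(x)| ≤ C for all x ∈ (B_{1/2} ∖ closure(B_{2δ})) ∩ {u > 0}. -/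
open Complex Metric Set Filter MeasureTheory
open scoped Topology Classical NNReal

open InnerProductSpace

lemma harnack {u : ℂ → ℝ} {c w : ℂ} {R : ℝ} (hu : HarmonicContOnCl u (ball c R))
    (h0 : ∀ z ∈ closedBall c R, 0 ≤ u z) (hw : w ∈ ball c R) :
    (R - ‖w - c‖) / (R + ‖w - c‖) * u c ≤ u w ∧
    u w ≤ (R + ‖w - c‖) / (R - ‖w - c‖) * u c := by
  have hR : 0 < R := pos_of_mem_ball hw
  have hP := HarmonicContOnCl.circleAverage_re_herglotzRieszKernel_smul hu hw
  have hM : Real.circleAverage u c R = u c :=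
    InnerProductSpace.HarmonicContOnCl.circleAverage_eq (by rwa [abs_of_pos hR])
  have hcont : ContinuousOn u (sphere c R) :=
    hu.continuousOn_ball.mono sphere_subset_closedBall
  have hi1 : CircleIntegrable u c R := hcont.circleIntegrable hR.le
  have hi2 : CircleIntegrable ((re ∘ herglotzRieszKernel c w) • u) c R := by
    apply ContinuousOn.circleIntegrable hR.le
    apply ContinuousOn.smul _ hcont
    rw [herglotzRieszKernel_fun_def]
    have : ∀ x ∈ sphere c R, x - c - (w - c) ≠ 0 := by
      intro x hx h
      have : x = w := by linear_combination h
      subst this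
      simp only [mem_sphere, mem_ball] at hx hw
      linarith
    exact Complex.continuous_re.comp_continuousOn (by fun_prop (disch := assumption))
  have hs : ∀ k : ℝ, Real.circleAverage (k • u) c R = k * u c := by
    intro k
    rw [Real.circleAverage_smul, hM, smul_eq_mul]
  constructor
  · rw [← hs, ← hP]
    apply Real.circleAverage_mono (hi1.const_smul) hi2
    intro x hx
    rw [abs_of_pos hR] at hx
    have := le_re_herglotzRieszKernel hx hw
    exact mul_le_mul_of_nonneg_right this (h0 x (sphere_subset_closedBall hx))
  · rw [← hs, ← hP]
    apply Real.circleAverage_mono hi2 (hi1.const_smul)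
    intro x hx
    rw [abs_of_pos hR] at hx
    have := re_herglotzRieszKernel_le hx hw
    exact mul_le_mul_of_nonneg_right this (h0 x (sphere_subset_closedBall hx))

lemma dir_bound {u : ℂ → ℝ} {x v : ℂ} {R : ℝ} (hR : 0 < R)
    (hu : HarmonicContOnCl u (ball x R))
    (h0 : ∀ z ∈ closedBall x R, 0 ≤ u z) (hv : ‖v‖ = 1) :
    fderiv ℝ u x v ≤ 2 * u x / R := by
  have hd : DifferentiableAt ℝ u x := hu.differentiableAt (mem_ball_self hR)
  have hl : HasDerivAt (fun t : ℝ => u (x + t • v)) (fderiv ℝ u x v) 0 := by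
    have := hd.hasFDerivAt.hasLineDerivAt v
    exact this
  have h1 := hl.tendsto_slope_zero_right
  have h2 : Tendsto (fun t : ℝ => 2 * u x / (R - t)) (𝓝[>] 0) (𝓝 (2 * u x / R)) := by
    have : ContinuousAt (fun t : ℝ => 2 * u x / (R - t)) 0 := by
      apply ContinuousAt.div (by fun_prop) (by fun_prop)
      simpa using hR.ne'
    have h := this.tendsto.mono_left (nhdsWithin_le_nhds (s := Ioi 0))
    simpa using h
  refine le_of_tendsto_of_tendsto h1 h2 ?_
  filter_upwards [Ioo_mem_nhdsGT hR] with t ht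
  have hn : ‖x + t • v - x‖ = t := by
    simp [norm_smul, hv, abs_of_pos ht.1]
  have hw : x + t • v ∈ ball x R := by
    rw [mem_ball_iff_norm, hn]; exact ht.2
  have h := (harnack hu h0 hw).2
  rw [hn] at h
  have hRt : 0 < R - t := by linarith [ht.2]
  have ht0 := ht.1
  simp only [zero_add, zero_smul, add_zero, smul_eq_mul]
  rw [inv_mul_le_iff₀ ht0]
  have : (R + t) / (R - t) * u x - u x = t * (2 * u x / (R - t)) := by
    field_simp; ring
  linarith

lemma grad_bound {u : ℂ → ℝ} {x : ℂ} {R : ℝ} (hR : 0 < R)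
    (hu : HarmonicContOnCl u (ball x R))
    (h0 : ∀ z ∈ closedBall x R, 0 ≤ u z) :
    ‖grad2 u x‖ ≤ 4 * u x / R := by
  have a1 := dir_bound hR hu h0 (v := 1) (by simp)
  have a2 := dir_bound hR hu h0 (v := -1) (by simp)
  have a3 := dir_bound hR hu h0 (v := I) (by simp)
  have a4 := dir_bound hR hu h0 (v := -I) (by simp)
  rw [map_neg] at a2 a4
  have b1 : |fderiv ℝ u x 1| ≤ 2 * u x / R := abs_le.2 ⟨by linarith, a1⟩
  have b2 : |fderiv ℝ u x I| ≤ 2 * u x / R := abs_le.2 ⟨by linarith, a3⟩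
  have : 4 * u x / R = 2 * u x / R + 2 * u x / R := by ring
  rw [this]
  unfold grad2
  refine (norm_add_le _ _).trans ?_
  simp only [norm_mul, norm_real, norm_I, mul_one, Real.norm_eq_abs]
  linarith

lemma fderiv_le_grad2 (u : ℂ → ℝ) (z v : ℂ) : |fderiv ℝ u z v| ≤ ‖grad2 u z‖ * ‖v‖ := by
  have h : fderiv ℝ u z v = ((grad2 u z) * (starRingEnd ℂ) v).re := by
    have hv : v = v.re • (1 : ℂ) + v.im • I := by
      simp [Complex.re_add_im]
    conv_lhs => rw [hv, map_add, map_smul, map_smul]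
    simp [grad2]
    ring
  rw [h]
  refine (Complex.abs_re_le_norm _).trans ?_
  simp

lemma posSet_open {Ω : Set ℂ} {u : ℂ → ℝ} (hΩ : IsOpen Ω) (hu : IsClassicalSolution Ω u) :
    IsOpen (posSet Ω u) :=
  hu.contOn.isOpen_inter_preimage hΩ isOpen_Ioi

lemma harmonic_posSet {Ω : Set ℂ} {u : ℂ → ℝ} (hΩ : IsOpen Ω) (hu : IsClassicalSolution Ω u) :
    HarmonicOnNhd u (posSet Ω u) := by
  have hP := posSet_open hΩ hu
  intro x hx
  refine ⟨hu.harm.1.contDiffAt (hP.mem_nhds hx), ?_⟩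
  filter_upwards [hP.mem_nhds hx] with z hz
  have hc : ContDiffAt ℝ 2 u z := hu.harm.1.contDiffAt (hP.mem_nhds hz)
  have hd : DifferentiableAt ℝ (fderiv ℝ u) z :=
    (hc.fderiv_right (m := 1) (by norm_num)).differentiableAt (by norm_num)
  have key : ∀ v w : ℂ, hess u z v w = fderiv ℝ (fderiv ℝ u) z w v := by
    intro v w
    unfold hess
    rw [fderiv_clm_apply hd (by fun_prop)]
    simp
  have h := hu.harm.2 z hz
  rw [key, key] at h
  rw [laplacian_eq_iteratedFDeriv_complexPlane]
  simp only [iteratedFDeriv_two_apply]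
  simpa using h

lemma hcc {Ω : Set ℂ} {u : ℂ → ℝ} (hΩ : IsOpen Ω) (hu : IsClassicalSolution Ω u)
    {x : ℂ} {R : ℝ} (h1 : closedBall x R ⊆ Ω) (h2 : ball x R ⊆ posSet Ω u) :
    HarmonicContOnCl u (ball x R) :=
  HarmonicContOnCl.mk_ball ((harmonic_posSet hΩ hu).mono h2) (hu.contOn.mono h1)

/-- Hopf-type bound. -/
lemma hopf {Ω : Set ℂ} {u : ℂ → ℝ} (hΩ : IsOpen Ω) (hu : IsClassicalSolution Ω u)
    {x y : ℂ} {d : ℝ} (hd : 0 < d) (h1 : closedBall x d ⊆ Ω) (h2 : ball x d ⊆ posSet Ω u)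
    (hy : ‖y - x‖ = d) (hyP : y ∉ posSet Ω u) : u x ≤ 4 * d := by
  have hyB : y ∈ closedBall x d := by rw [mem_closedBall_iff_norm, hy]
  have hyΩ : y ∈ Ω := h1 hyB
  have hy0 : u y = 0 := by
    refine le_antisymm (not_lt.1 fun h => hyP ⟨hyΩ, h⟩) (hu.nonneg y hyΩ)
  have hH := hcc hΩ hu h1 h2
  have h0 : ∀ z ∈ closedBall x d, 0 ≤ u z := fun z hz => hu.nonneg z (h1 hz)
  have hyF : y ∈ FB Ω u := by
    refine ⟨hyΩ, ?_⟩
    rw [frontier, (posSet_open hΩ hu).interior_eq]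
    refine ⟨closure_mono h2 ?_, hyP⟩
    rwa [closure_ball x hd.ne']
  have hg := hu.grad_one y hyF
  have hg2 : ∀ᶠ w in 𝓝[posSet Ω u] y, ‖grad2 u w‖ < 2 :=
    hg.eventually (gt_mem_nhds (by norm_num))
  rw [eventually_nhdsWithin_iff, Metric.eventually_nhds_iff] at hg2
  obtain ⟨ε, hε, hg2⟩ := hg2
  -- parametrise the segment from `y` towards `x`
  let γ : ℝ → ℂ := fun s => y + s • (x - y)
  have hxy : ‖x - y‖ = d := by rw [norm_sub_rev, hy]
  have hγd : ∀ s : ℝ, 0 ≤ s → dist (γ s) y = s * d := by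
    intro s hs
    simp [γ, dist_eq_norm, abs_of_nonneg hs]
    simp [hxy]
  have hγx : ∀ s : ℝ, s ≤ 1 → ‖γ s - x‖ = (1 - s) * d := by
    intro s hs
    have : γ s - x = (1 - s) • (y - x) := by
      simp only [γ, real_smul]; push_cast; ring
    rw [this, norm_smul, hy, Real.norm_of_nonneg (by linarith)]
  have hγP : ∀ s : ℝ, 0 < s → s ≤ 1 → γ s ∈ ball x d := by
    intro s hs hs1
    rw [mem_ball_iff_norm, hγx s hs1]
    nlinarith
  obtain ⟨s, hs0, hs1, hsε⟩ : ∃ s : ℝ, 0 < s ∧ s < 1 ∧ s * d < ε := by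
    refine ⟨min (1/2) (ε / (2 * d)), by positivity, ?_, ?_⟩
    · exact (min_le_left _ _).trans_lt (by norm_num)
    · have := min_le_right (1/2 : ℝ) (ε / (2 * d))
      calc _ ≤ ε / (2 * d) * d := by gcongr
        _ = ε / 2 := by field_simp
        _ < ε := by linarith
  -- upper bound by mean value theorem
  have hup : u (γ s) ≤ 2 * d * s := by
    have hder : ∀ t ∈ Ioo (0:ℝ) s, HasDerivAt (fun t => u (γ t)) (fderiv ℝ u (γ t) (x - y)) t := by
      intro t ht
      have hdu : DifferentiableAt ℝ u (γ t) :=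
        hH.differentiableAt (hγP t ht.1 (by linarith [ht.2]))
      have hdγ : HasDerivAt γ (x - y) t := by
        have := ((hasDerivAt_id t).smul_const (x - y)).const_add y
        simpa [γ] using this
      exact hdu.hasFDerivAt.comp_hasDerivAt t hdγ
    have hcont : ContinuousOn (fun t => u (γ t)) (Icc 0 s) := by
      refine hu.contOn.comp (by fun_prop) ?_
      intro t ht
      apply h1
      rw [mem_closedBall_iff_norm, hγx t (by linarith [ht.2])]
      nlinarith [ht.1]
    obtain ⟨t, ht, hmv⟩ := exists_hasDerivAt_eq_slope (fun t => u (γ t))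
      (fun t => fderiv ℝ u (γ t) (x - y)) hs0 hcont hder
    have hb := fderiv_le_grad2 u (γ t) (x - y)
    have hb2 : ‖grad2 u (γ t)‖ < 2 := by
      refine hg2 ?_ (h2 (hγP t ht.1 (by linarith [ht.2])))
      rw [hγd t ht.1.le]
      nlinarith [ht.2]
    have hγ0 : γ 0 = y := by simp [γ]
    rw [hγ0, hy0, sub_zero, sub_zero] at hmv
    rw [hxy] at hb
    have h3 : u (γ s) / s ≤ 2 * d := by
      rw [← hmv]
      refine (le_abs_self _).trans (hb.trans ?_)
      nlinarith
    rwa [div_le_iff₀ hs0] at h3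
  have hlow := (harnack hH h0 (hγP s hs0 hs1.le)).1
  rw [hγx s hs1.le] at hlow
  have hx0 : 0 ≤ u x := h0 x (mem_closedBall_self hd.le)
  have e : (d - (1 - s) * d) / (d + (1 - s) * d) = s / (2 - s) := by
    rw [div_eq_div_iff (by nlinarith) (by linarith)]; ring
  rw [e] at hlow
  have h4 : s / 2 * u x ≤ s / (2 - s) * u x := by
    apply mul_le_mul_of_nonneg_right _ hx0
    apply div_le_div_of_nonneg_left hs0.le (by linarith) (by linarith)
  have h5 : s * u x ≤ s * (4 * d) := by linarith
  exact le_of_mul_le_mul_left h5 hs0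

lemma near {Ω : Set ℂ} {u : ℂ → ℝ} (hΩ : IsOpen Ω) (hu : IsClassicalSolution Ω u)
    {x : ℂ} {ρ : ℝ} (hx : x ∈ posSet Ω u) (h1 : closedBall x ρ ⊆ Ω)
    (h2 : ¬ ball x ρ ⊆ posSet Ω u) : u x ≤ 4 * ρ ∧ ‖grad2 u x‖ ≤ 16 := by
  have hP := posSet_open hΩ hu
  obtain ⟨q, hq, hqP⟩ := not_subset.1 h2
  obtain ⟨y, hyP, hyd⟩ := hP.isClosed_compl.exists_infDist_eq_dist ⟨q, hqP⟩ x
  have hd : 0 < dist x y := dist_pos.2 (fun h => hyP (h ▸ hx))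
  have hlt : dist x y < ρ := by
    rw [← hyd]
    refine (infDist_le_dist_of_mem hqP).trans_lt ?_
    rwa [dist_comm]
  have h3 : closedBall x (dist x y) ⊆ Ω := (closedBall_subset_closedBall hlt.le).trans h1
  have h4 : ball x (dist x y) ⊆ posSet Ω u := by
    intro z hz
    by_contra hzP
    have := infDist_le_dist_of_mem (x := x) (s := (posSet Ω u)ᶜ) hzP
    rw [mem_ball, dist_comm] at hz
    linarith
  have h5 := hopf hΩ hu hd h3 h4 (by rw [← dist_eq_norm, dist_comm]) hyP
  have h6 := grad_bound hd (hcc hΩ hu h3 h4) (fun z hz => hu.nonneg z (h3 hz))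
  refine ⟨by linarith, h6.trans ?_⟩
  rw [div_le_iff₀ hd]
  linarith

lemma ann_open (δ R : ℝ) : IsOpen (ann δ R) :=
  (isOpen_lt continuous_const continuous_norm).inter (isOpen_lt continuous_norm continuous_const)

lemma meets {δ r : ℝ} {u : ℂ → ℝ} (hu : IsClassicalSolution (ann δ 1) u)
    (hA : ConditionA δ 1 u) (h1 : δ < r) (h2 : r < 1) : ∃ p : ℂ, ‖p‖ = r ∧ u p = 0 := by
  obtain ⟨F₁, F₂, ⟨z, hz⟩, -, -, hU, hc, -, -, -, ⟨a, ha, ha'⟩, ⟨b, hb, hb'⟩, -, -⟩ := hA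
  have hpre : IsPreconnected F₁ := by
    rw [← hc z hz]; exact isPreconnected_connectedComponentIn
  have hsub : F₁ ⊆ FB (ann δ 1) u := hU ▸ subset_union_left
  rw [mem_sphere_zero_iff_norm] at ha' hb'
  obtain ⟨a1, ha1, ha2⟩ := mem_closure_iff.1 ha {w | ‖w‖ < r}
    (isOpen_lt continuous_norm continuous_const) (by simpa [ha'] using h1)
  obtain ⟨b1, hb1, hb2⟩ := mem_closure_iff.1 hb {w | r < ‖w‖}
    (isOpen_lt continuous_const continuous_norm) (by simpa [hb'] using h2)
  obtain ⟨p, hp, hpr⟩ := hpre.intermediate_value ha2 hb2 continuous_norm.continuousOn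
    ⟨le_of_lt ha1, le_of_lt hb1⟩
  refine ⟨p, hpr, ?_⟩
  have hpF := hsub hp
  have hP := posSet_open (ann_open δ 1) hu
  have hn : p ∉ posSet (ann δ 1) u := by
    have := hpF.2
    rw [frontier, hP.interior_eq] at this
    exact this.2
  exact le_antisymm (not_lt.1 fun h => hn ⟨hpF.1, h⟩) (hu.nonneg p hpF.1)

/-- uniform Lipschitz bound in the punctured annulus under condition (A). -/
theorem lipschitz_bound_annulus :
    ∃ C : ℝ, 0 < C ∧
    ∀ δ : ℝ, 0 < δ → δ < 1 / 4 →
    ∀ u : ℂ → ℝ, IsClassicalSolution (ann δ 1) u → ConditionA δ 1 u →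
    ∀ x ∈ Metric.ball (0 : ℂ) (1 / 2) \ Metric.closedBall 0 (2 * δ),
      0 < u x → ‖grad2 u x‖ ≤ C := by
  refine ⟨16 * 3 ^ 32, by positivity, ?_⟩
  intro δ hδ hδ4 u hu hA x hx hux
  have hxr : ‖x‖ < 1 / 2 := by simpa using hx.1
  have hxδ : 2 * δ < ‖x‖ := by simpa using hx.2
  obtain ⟨r, hr⟩ : ∃ r, r = ‖x‖ := ⟨_, rfl⟩
  rw [← hr] at hxr hxδ
  have hr0 : 0 < r := by linarith
  have hΩ := ann_open δ 1
  have hball : ∀ z : ℂ, ‖z‖ = r → closedBall z (r / 4) ⊆ ann δ 1 := by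
    intro z hz w hw
    rw [mem_closedBall_iff_norm] at hw
    have e1 := norm_sub_norm_le z w
    have e2 := norm_sub_norm_le w z
    rw [norm_sub_rev] at e1
    exact ⟨by linarith, by linarith⟩
  have hin : ∀ z : ℂ, ‖z‖ = r → z ∈ ann δ 1 := fun z hz =>
    hball z hz (mem_closedBall_self (by linarith))
  have hxP : x ∈ posSet (ann δ 1) u := ⟨hin x hr.symm, hux⟩
  by_cases hb : ball x (r / 4) ⊆ posSet (ann δ 1) u
  swap
  · refine (near hΩ hu hxP (hball x hr.symm) hb).2.trans (by norm_num)
  obtain ⟨p, hpr, hp0⟩ := meets hu hA (r := r) (by linarith) (by linarith)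
  have hp : p ≠ 0 := by rw [← norm_pos_iff]; linarith
  obtain ⟨α, hα⟩ : ∃ α, α = (x / p).arg := ⟨_, rfl⟩
  have hxp : x = p * cexp (α * I) := by
    have h := Complex.norm_mul_exp_arg_mul_I (x / p)
    rw [norm_div, ← hr, hpr, div_self hr0.ne', ← hα] at h
    rw [show cexp (α * I) = x / p by simpa using h]
    field_simp
  have hαπ : |α| ≤ 4 := by
    rw [hα]; exact (Complex.abs_arg_le_pi _).trans Real.pi_le_four
  let f : ℕ → ℂ := fun k => p * cexp (((α * k / 32 : ℝ) : ℂ) * I)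
  have hfn : ∀ k, ‖f k‖ = r := by
    intro k
    simp only [f, norm_mul, Complex.norm_exp_ofReal_mul_I, hpr, mul_one]
  have hf0 : f 0 = p := by simp [f]
  have hf32 : f 32 = x := by
    rw [hxp]; simp [f]
  have hstep : ∀ k, ‖f k - f (k + 1)‖ ≤ r / 8 := by
    intro k
    have e : f k - f (k+1) =
        -(p * cexp (((α * k / 32 : ℝ) : ℂ) * I) * (cexp (I * ((α / 32 : ℝ) : ℂ)) - 1)) := by
      simp only [f]
      rw [show (((α * (k + 1 : ℕ) / 32 : ℝ) : ℂ) * I) =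
        ((α * k / 32 : ℝ) : ℂ) * I + I * ((α / 32 : ℝ) : ℂ) by push_cast; ring, Complex.exp_add]
      ring
    rw [e, norm_neg, norm_mul, norm_mul, Complex.norm_exp_ofReal_mul_I, hpr, mul_one]
    have h := Real.norm_exp_I_mul_ofReal_sub_one_le (x := α / 32)
    have h' : ‖α / 32‖ ≤ 1 / 8 := by
      rw [Real.norm_eq_abs, abs_div]; norm_num; linarith
    have := mul_le_mul_of_nonneg_left (h.trans h') hr0.le
    linarith
  have hchain : ∀ k, u (f k) ≤ 3 ^ k * r := by
    intro k
    induction k with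
    | zero => rw [hf0, hp0]; positivity
    | succ k ih =>
      have h3k : (1 : ℝ) ≤ 3 ^ (k + 1) := one_le_pow₀ (by norm_num)
      have hN := hfn (k + 1)
      by_cases hpos : f (k+1) ∈ posSet (ann δ 1) u
      swap
      · have : u (f (k+1)) ≤ 0 := not_lt.1 fun h => hpos ⟨hin _ hN, h⟩
        exact this.trans (by positivity)
      by_cases hb' : ball (f (k+1)) (r / 4) ⊆ posSet (ann δ 1) u
      swap
      · have := (near hΩ hu hpos (hball _ hN) hb').1
        nlinarith
      have hs := hstep k
      have hmem : f k ∈ ball (f (k+1)) (r / 4) := by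
        rw [mem_ball_iff_norm]; linarith
      have hh := (harnack (hcc hΩ hu (hball _ hN) hb')
        (fun z hz => hu.nonneg z (hball _ hN hz)) hmem).1
      have hc : (1 / 3 : ℝ) ≤ (r / 4 - ‖f k - f (k+1)‖) / (r / 4 + ‖f k - f (k+1)‖) := by
        rw [div_le_div_iff₀ (by norm_num) (by positivity)]
        linarith
      have := mul_le_mul_of_nonneg_right hc hpos.2.le
      rw [pow_succ]
      linarith
  have hux2 := hchain 32
  rw [hf32] at hux2
  have hg := grad_bound (by linarith) (hcc hΩ hu (hball x hr.symm) hb)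
    (fun z hz => hu.nonneg z (hball x hr.symm hz))
  refine hg.trans ?_
  rw [div_le_iff₀ (by linarith)]
  linarith
end
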